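/- Let k be an algebraically closed field of characteristic zero. Let C, D be projective curves over k with C smooth, and let f : C → ℙ¹_k and g : D → ℙ¹_k be surjective morphisms with deg f = n ≥ 2 and deg g = d. Let X = (C ×_{ℙ¹} D)_red be the reduction of the fiber product. Assume: (1) the field extension k(ℙ¹) ⊂ k(C) induced by f has no non-trivial intermediate field extension; (2) #f^{-1}(∞) = 1; (3) the composition of the normalization map ν : D̃ → D with g is étale over ∞. Then X is irreducible and 2g_X − 2 ≥ n(2g_D − 2) + (n − 1)d. -/

import Mathlib

/-!
STATEMENT 9: Let `k` be an algebraically closed field of characteristic zero, `C, D`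
projective curves over `k` with `C` smooth, and `f : C → ℙ¹`, `g : D → ℙ¹` surjective
morphisms with `deg f = n ≥ 2`, `deg g = d`.  Let `X = (C ×_{ℙ¹} D)_red`.  Assume:
(1) `k(ℙ¹) ⊂ k(C)` has no non-trivial intermediate field;
(2) `#f^{-1}(∞) = 1`;
(3) `D̃ → D → ℙ¹` is étale over `∞` (`ν : D̃ → D` the normalization).
Then `X` is irreducible and `2g_X − 2 ≥ n(2g_D − 2) + (n − 1)d`.

Formalization notes.  The statement is rendered in terms of function fields, which carry all
of its content:
* `k(ℙ¹) = RatFunc k`, and the data of `C` (smooth projective, surjecting onto `ℙ¹` with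
  degree `n`) is exactly the finite extension `K_C/RatFunc k` of degree `n`; similarly `D`
  gives `K_D` of degree `d` (only the function field of `D` is relevant to the hypotheses and
  the conclusion, which involve the smooth model `D̃` and geometric genera).
* Closed points of the smooth projective model of a function field `L/k` are the places of
  `L/k`, i.e. the valuation subrings `A ⊊ L` containing `k`; `ordAt A` is the corresponding
  normalized order function.  A point lies over `∞ ∈ ℙ¹` iff `t ∉ A`, where `t` is the image
  of `RatFunc.X`; hypothesis (2) says there is exactly one such place for `K_C`, and
  hypothesis (3) says every such place of `K_D` is unramified over `k(t)`,
  i.e. `ordAt A t = −1`.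
* Since `C → ℙ¹` is finite flat, the irreducible components of `C ×_{ℙ¹} D` and their
  function fields are those of the (automatically reduced, char 0) generic fibre
  `Spec (K_C ⊗_{k(t)} K_D)`; thus `X` is irreducible iff `K_C ⊗_{k(t)} K_D` is a field, in
  which case it is the function field of `X`.
* The geometric genus `g` of a function field `L/k` is defined via Riemann's theorem:
  `g − 1` is the supremum over all divisors `D` of `deg D − ℓ(D)`, where `ℓ(D)` is the
  dimension of the Riemann–Roch space of `D`.
-/

open scoped Classical TensorProduct

noncomputable section

/-- A place of the one-variable function field `L/k`: a valuation subring of `L` containing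
`k` and different from `L`. -/
def FFPlace (k L : Type) [Field k] [Field L] [Algebra k L] : Type :=
  {A : ValuationSubring L // (∀ c : k, algebraMap k L c ∈ A) ∧ A ≠ ⊤}

/-- A uniformizer at `A` (junk value `1` if the maximal ideal is not principal). -/
def unifAt {L : Type} [Field L] (A : ValuationSubring L) : L :=
  if h : ∃ π : A, IsLocalRing.maximalIdeal A = Ideal.span {π} ∧ (π : L) ≠ 0 then (h.choose : L)
  else 1

/-- The order of vanishing at `A` of an element of `L` (junk value `0` for `f = 0`). -/
def ordAt {L : Type} [Field L] (A : ValuationSubring L) (f : L) : ℤ :=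
  if h : ∃ n : ℤ, A.valuation f = A.valuation (unifAt A) ^ n then h.choose else 0

/-- The degree of a divisor (`k` algebraically closed, so all residue degrees are `1`). -/
def divDeg {k L : Type} [Field k] [Field L] [Algebra k L] (D : FFPlace k L →₀ ℤ) : ℤ :=
  D.sum fun _ n => n

/-- The dimension `ℓ(D)` of the Riemann–Roch space
`L(D) = {f ∈ L | div(f) + D ≥ 0}` of a divisor `D`. -/
def rrDim (k : Type) {L : Type} [Field k] [Field L] [Algebra k L] (D : FFPlace k L →₀ ℤ) : ℕ :=
  Module.finrank k (Submodule.span k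
    {f : L | f ≠ 0 → ∀ A : FFPlace k L, -(D A) ≤ ordAt A.1 f})

/-- The genus of a one-variable function field `L/k`: by Riemann's theorem,
`g = 1 + sup_D (deg D − ℓ(D))`. -/
def ffGenus (k L : Type) [Field k] [Field L] [Algebra k L] : ℕ :=
  (1 + sSup {m : ℤ | ∃ D : FFPlace k L →₀ ℤ, m = divDeg D - (rrDim k D : ℤ)}).toNat

/-- The genus of a commutative `k`-algebra which happens to be a field (junk value `0`
otherwise). -/
def genusRing (k T : Type) [Field k] [CommRing T] [Algebra k T] : ℕ :=
  if h : IsField T then @ffGenus k T _ h.toField (by exact inferInstanceAs (Algebra k T)) else 0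

set_option linter.unusedSectionVars false

section PlaceBasics

variable {k L : Type} [Field k] [Field L] [Algebra k L]

theorem FFPlace.valuation_const (A : FFPlace k L) {c : k} (hc : c ≠ 0) :
    A.1.valuation (algebraMap k L c) = 1 := by
  apply le_antisymm
  · exact (A.1.valuation_le_one_iff _).2 (A.2.1 c)
  · have h := (A.1.valuation_le_one_iff _).2 (A.2.1 c⁻¹)
    rw [map_inv₀, map_inv₀] at h
    have h0 : A.1.valuation (algebraMap k L c) ≠ 0 := by simpa using hc
    exact (inv_le_one₀ (zero_lt_iff.2 h0)).1 h

theorem FFPlace.valuation_const_le (A : FFPlace k L) (c : k) :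
    A.1.valuation (algebraMap k L c) ≤ 1 := (A.1.valuation_le_one_iff _).2 (A.2.1 c)

/-- `x` is, up to a unit with constant nonzero residue, a power of `s`. -/
def HasLeadingTerm (A : FFPlace k L) (s x : L) : Prop :=
  ∃ i : ℤ, ∃ c : k, c ≠ 0 ∧ A.1.valuation (x * s ^ (-i) - algebraMap k L c) < 1

theorem FFPlace.valuation_eq_one_of_sub_const (A : FFPlace k L) {x : L} {c : k} (hc : c ≠ 0)
    (h : A.1.valuation (x - algebraMap k L c) < 1) : A.1.valuation x = 1 := by
  have := Valuation.map_eq_of_sub_lt A.1.valuation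
    (x := algebraMap k L c) (y := x) (by rwa [A.valuation_const hc])
  rwa [A.valuation_const hc] at this

namespace HasLeadingTerm

variable {A : FFPlace k L} {s x y : L}

theorem const {c : k} (hc : c ≠ 0) : HasLeadingTerm A s (algebraMap k L c) :=
  ⟨0, c, hc, by simp⟩

theorem mul (hs : s ≠ 0) (hx : HasLeadingTerm A s x) (hy : HasLeadingTerm A s y) :
    HasLeadingTerm A s (x * y) := by
  obtain ⟨i, c, hc, hi⟩ := hx
  obtain ⟨j, d, hd, hj⟩ := hy
  refine ⟨i + j, c * d, mul_ne_zero hc hd, ?_⟩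
  have e : x * y * s ^ (-(i + j)) - algebraMap k L (c * d) =
      (x * s ^ (-i) - algebraMap k L c) * (y * s ^ (-j)) +
        algebraMap k L c * (y * s ^ (-j) - algebraMap k L d) := by
    rw [neg_add, zpow_add₀ hs, map_mul]; ring
  rw [e]
  refine Valuation.map_add_lt _ ?_ ?_
  · rwa [map_mul, A.valuation_eq_one_of_sub_const hd hj, mul_one]
  · rwa [map_mul, A.valuation_const hc, one_mul]

theorem inv (hx : HasLeadingTerm A s x) : HasLeadingTerm A s x⁻¹ := by
  obtain ⟨i, c, hc, hi⟩ := hx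
  have h1 := A.valuation_eq_one_of_sub_const hc hi
  have hne : x * s ^ (-i) ≠ 0 := by
    intro h; rw [h, map_zero] at h1; exact zero_ne_one h1
  have hx0 : x ≠ 0 := left_ne_zero_of_mul hne
  have hs0 : s ^ (-i) ≠ 0 := right_ne_zero_of_mul hne
  have hc' : algebraMap k L c ≠ 0 := by simpa using hc
  refine ⟨-i, c⁻¹, inv_ne_zero hc, ?_⟩
  have e : x⁻¹ * s ^ (- -i) - algebraMap k L c⁻¹ =
      -((x * s ^ (-i) - algebraMap k L c) * ((x * s ^ (-i))⁻¹ * (algebraMap k L c)⁻¹)) := by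
    rw [map_inv₀, zpow_neg s (-i)]
    field_simp
    ring
  rw [e, Valuation.map_neg, map_mul, map_mul, map_inv₀, map_inv₀, h1, A.valuation_const hc]
  simpa using hi

theorem valuation_eq (hx : HasLeadingTerm A s x) :
    ∃ i : ℤ, A.1.valuation x = A.1.valuation s ^ i := by
  obtain ⟨i, c, hc, hi⟩ := hx
  have h1 := A.valuation_eq_one_of_sub_const hc hi
  refine ⟨i, ?_⟩
  rw [map_mul, map_zpow₀, zpow_neg] at h1
  have : A.1.valuation s ^ i ≠ 0 := by
    intro h; rw [h] at h1; simp at h1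
  exact (mul_inv_eq_one₀ this).1 h1

end HasLeadingTerm

section Base

variable [IsAlgClosed k] [Algebra (RatFunc k) L] [IsScalarTower k (RatFunc k) L]

theorem algebraMap_C (c : k) : algebraMap (RatFunc k) L (RatFunc.C c) = algebraMap k L c := by
  rw [IsScalarTower.algebraMap_apply k (RatFunc k) L]; rfl

/-- A multiplicative predicate that holds for nonzero constants and for all `X - b` holds for all
nonzero rational functions. -/
theorem ratFunc_induction_linear {P : RatFunc k → Prop} (hC : ∀ c : k, c ≠ 0 → P (RatFunc.C c))
    (hX : ∀ b : k, P (RatFunc.X - RatFunc.C b)) (hmul : ∀ x y, P x → P y → P (x * y))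
    (hinv : ∀ x, P x → P x⁻¹) {q : RatFunc k} (hq : q ≠ 0) : P q := by
  have hpoly : ∀ p : Polynomial k, p ≠ 0 → P (algebraMap (Polynomial k) (RatFunc k) p) := by
    intro p hp
    rw [(IsAlgClosed.splits p).eq_prod_roots, map_mul]
    refine hmul _ _ ?_ ?_
    · rw [RatFunc.algebraMap_C]; exact hC _ (by simpa using hp)
    · generalize p.roots = m
      induction m using Multiset.induction_on with
      | empty => simpa using hC 1 one_ne_zero
      | cons a m ih =>
        rw [Multiset.map_cons, Multiset.prod_cons, map_mul]
        refine hmul _ _ ?_ ih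
        rw [map_sub, RatFunc.algebraMap_X, RatFunc.algebraMap_C]; exact hX a
  rw [← RatFunc.num_div_denom q, div_eq_mul_inv]
  exact hmul _ _ (hpoly _ (by simpa using hq)) (hinv _ (hpoly _ q.denom_ne_zero))

theorem FFPlace.exists_mem_of_valuation_ratFunc [FiniteDimensional (RatFunc k) L]
    (A : FFPlace k L)
    (h : ∀ q : RatFunc k, A.1.valuation (algebraMap (RatFunc k) L q) ≤ 1) : False := by
  apply A.2.2
  refine top_unique fun z _ => ?_
  have hz : IsIntegral (RatFunc k) z := IsIntegral.of_finite _ z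
  let f : RatFunc k →+* A.1 := (algebraMap (RatFunc k) L).codRestrict A.1.toSubring
    (fun q => (A.1.valuation_le_one_iff _).1 (h q))
  have : IsIntegral A.1 z := by
    obtain ⟨p, hp, hpz⟩ := hz
    refine ⟨p.map f, hp.map f, ?_⟩
    rw [Polynomial.eval₂_map]
    exact hpz
  obtain ⟨y, hy⟩ := IsIntegrallyClosed.isIntegral_iff.1 this
  rw [← hy]; exact y.2

/-- The restriction of a place to `k(t)` has a local parameter, `t - a` or `1 / t`. -/
theorem FFPlace.exists_parameter [FiniteDimensional (RatFunc k) L] (A : FFPlace k L) :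
    ∃ s : RatFunc k, s ≠ 0 ∧ A.1.valuation (algebraMap (RatFunc k) L s) < 1 ∧
      (∀ q : RatFunc k, q ≠ 0 →
        HasLeadingTerm A (algebraMap (RatFunc k) L s) (algebraMap (RatFunc k) L q)) ∧
      ((algebraMap (RatFunc k) L RatFunc.X ∈ A.1 ∧ ∃ a : k, s = RatFunc.X - RatFunc.C a) ∨
        (algebraMap (RatFunc k) L RatFunc.X ∉ A.1 ∧ s = RatFunc.X⁻¹)) := by
  have key : ∀ s : RatFunc k, s ≠ 0 →
      (∀ b : k, HasLeadingTerm A (algebraMap (RatFunc k) L s)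
        (algebraMap (RatFunc k) L (RatFunc.X - RatFunc.C b))) →
      (∀ q : RatFunc k, q ≠ 0 →
        HasLeadingTerm A (algebraMap (RatFunc k) L s) (algebraMap (RatFunc k) L q)) := by
    intro s hs hX q hq
    have hs' : algebraMap (RatFunc k) L s ≠ 0 := by simpa using hs
    refine ratFunc_induction_linear (P := fun q => HasLeadingTerm A (algebraMap (RatFunc k) L s)
      (algebraMap (RatFunc k) L q)) ?_ hX ?_ ?_ hq
    · intro c hc; rw [algebraMap_C]; exact HasLeadingTerm.const hc
    · intro x y hx hy; rw [map_mul]; exact hx.mul hs' hy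
    · intro x hx; rw [map_inv₀]; exact hx.inv
  by_cases ht : algebraMap (RatFunc k) L RatFunc.X ∈ A.1
  · have : ∃ a : k,
        A.1.valuation (algebraMap (RatFunc k) L (RatFunc.X - RatFunc.C a)) < 1 := by
      by_contra! hcon
      refine A.exists_mem_of_valuation_ratFunc fun q => ?_
      by_cases hq : q = 0
      · simp [hq]
      refine le_of_eq (ratFunc_induction_linear
        (P := fun q => A.1.valuation (algebraMap (RatFunc k) L q) = 1) ?_ ?_ ?_ ?_ hq)
      · intro c hc; rw [algebraMap_C, A.valuation_const hc]
      · intro b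
        refine le_antisymm ?_ (hcon b)
        rw [map_sub, algebraMap_C]
        exact (A.1.valuation_le_one_iff _).2 (sub_mem ht (A.2.1 b))
      · intro x y hx hy; rw [map_mul, map_mul, hx, hy, one_mul]
      · intro x hx; rw [map_inv₀, map_inv₀, hx, inv_one]
    obtain ⟨a, ha⟩ := this
    have h0 : (RatFunc.X - RatFunc.C a : RatFunc k) ≠ 0 := by
      rw [← RatFunc.algebraMap_X, ← RatFunc.algebraMap_C, ← map_sub]
      exact RatFunc.algebraMap_ne_zero (Polynomial.X_sub_C_ne_zero a)
    refine ⟨_, h0, ha, key _ h0 fun b => ?_, Or.inl ⟨ht, a, rfl⟩⟩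
    by_cases hb : b = a
    · subst hb
      refine ⟨1, 1, one_ne_zero, ?_⟩
      have h0' : algebraMap (RatFunc k) L (RatFunc.X - RatFunc.C b) ≠ 0 := by
        rwa [map_ne_zero]
      rw [zpow_neg, zpow_one, mul_inv_cancel₀ h0', map_one, sub_self, map_zero]
      exact zero_lt_one
    · refine ⟨0, a - b, sub_ne_zero.2 (Ne.symm hb), ?_⟩
      have e : algebraMap (RatFunc k) L (RatFunc.X - RatFunc.C b) *
          algebraMap (RatFunc k) L (RatFunc.X - RatFunc.C a) ^ (-(0 : ℤ)) -
          algebraMap k L (a - b) = algebraMap (RatFunc k) L (RatFunc.X - RatFunc.C a) := by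
        simp only [map_sub, algebraMap_C, neg_zero, zpow_zero, mul_one]
        ring
      rw [e]
      exact ha
  · have h0 : (RatFunc.X⁻¹ : RatFunc k) ≠ 0 := inv_ne_zero RatFunc.X_ne_zero
    have h1 : A.1.valuation (algebraMap (RatFunc k) L RatFunc.X⁻¹) < 1 := by
      rw [map_inv₀, map_inv₀]
      apply inv_lt_one_of_one_lt₀
      rw [← not_le, A.1.valuation_le_one_iff]; exact ht
    refine ⟨_, h0, h1, key _ h0 fun b => ?_, Or.inr ⟨ht, rfl⟩⟩
    refine ⟨-1, 1, one_ne_zero, ?_⟩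
    have hX : algebraMap (RatFunc k) L RatFunc.X ≠ 0 := by
      simpa using (RatFunc.X_ne_zero (K := k))
    have e : algebraMap (RatFunc k) L (RatFunc.X - RatFunc.C b) *
        algebraMap (RatFunc k) L RatFunc.X⁻¹ ^ (-(-1 : ℤ)) - algebraMap k L 1 =
        -(algebraMap k L b * algebraMap (RatFunc k) L RatFunc.X⁻¹) := by
      simp only [map_sub, algebraMap_C, neg_neg, zpow_one, map_inv₀, map_one]
      field_simp
      ring
    rw [e, Valuation.map_neg, map_mul]
    exact mul_lt_one_of_nonneg_of_lt_one_right (A.valuation_const_le b) zero_le h1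

end Base
end PlaceBasics

section Discreteness

variable {k L : Type} [Field k] [Field L] [Algebra k L]
variable [IsAlgClosed k] [Algebra (RatFunc k) L] [IsScalarTower k (RatFunc k) L]
  [FiniteDimensional (RatFunc k) L]

theorem Valuation.exists_ne_eq_of_sum_eq_zero {R Γ ι : Type*} [Ring R]
    [LinearOrderedCommGroupWithZero Γ] (v : Valuation R Γ) (S : Finset ι) (f : ι → R)
    (h0 : ∑ i ∈ S, f i = 0) (hne : ∃ i ∈ S, v (f i) ≠ 0) :
    ∃ i ∈ S, ∃ j ∈ S, i ≠ j ∧ v (f i) = v (f j) ∧ v (f j) ≠ 0 := by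
  by_contra! hcon
  obtain ⟨i0, hi0, hi0'⟩ := hne
  obtain ⟨j, hj, hmax⟩ := Finset.exists_max_image S (fun i => v (f i)) ⟨i0, hi0⟩
  have hj0 : v (f j) ≠ 0 := fun h => hi0' (le_zero_iff.1 (h ▸ hmax i0 hi0))
  have := v.map_sum_eq_of_lt (s := S) (f := f) hj (fun i hi => by
    rw [Finset.mem_sdiff, Finset.mem_singleton] at hi
    refine lt_of_le_of_ne (hmax i hi.1) fun h => hj0 (hcon i hi.1 j hj hi.2 h))
  rw [h0, map_zero] at this
  exact hj0 this.symm

theorem FFPlace.exists_pow_eq (A : FFPlace k L) {s : RatFunc k} (hs0 : s ≠ 0)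
    (hs : ∀ q : RatFunc k, q ≠ 0 →
        HasLeadingTerm A (algebraMap (RatFunc k) L s) (algebraMap (RatFunc k) L q))
    {z : L} (hz : z ≠ 0) :
    ∃ j : ℕ, 1 ≤ j ∧ j ≤ Module.finrank (RatFunc k) L ∧ ∃ l : ℤ,
      A.1.valuation z ^ j = A.1.valuation (algebraMap (RatFunc k) L s) ^ l := by
  have hint : IsIntegral (RatFunc k) z := IsIntegral.of_finite _ z
  set p := minpoly (RatFunc k) z with hp
  have hsum : ∑ i ∈ Finset.range (p.natDegree + 1),
      algebraMap (RatFunc k) L (p.coeff i) * z ^ i = 0 := by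
    have := minpoly.aeval (RatFunc k) z
    rwa [Polynomial.aeval_eq_sum_range, ← hp, Finset.sum_congr rfl
      (fun i _ => Algebra.smul_def _ _)] at this
  have hvz : A.1.valuation z ≠ 0 := by simpa using hz
  have main : ∀ i ∈ Finset.range (p.natDegree + 1), ∀ j ∈ Finset.range (p.natDegree + 1), i < j →
      A.1.valuation (algebraMap (RatFunc k) L (p.coeff i) * z ^ i) =
        A.1.valuation (algebraMap (RatFunc k) L (p.coeff j) * z ^ j) →
      A.1.valuation (algebraMap (RatFunc k) L (p.coeff j) * z ^ j) ≠ 0 →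
      ∃ j : ℕ, 1 ≤ j ∧ j ≤ Module.finrank (RatFunc k) L ∧ ∃ l : ℤ,
        A.1.valuation z ^ j = A.1.valuation (algebraMap (RatFunc k) L s) ^ l := by
    intro i hi j hj hij he hne
    have hcj : p.coeff j ≠ 0 := by
      rintro h; simp [h] at hne
    have hci : p.coeff i ≠ 0 := by
      rintro h; rw [← he] at hne; simp [h] at hne
    obtain ⟨a, ha⟩ := (hs _ hci).valuation_eq
    obtain ⟨b, hb⟩ := (hs _ hcj).valuation_eq
    refine ⟨j - i, by omega, ?_, a - b, ?_⟩
    · have : p.natDegree ≤ _ := minpoly.natDegree_le (A := RatFunc k) z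
      rw [Finset.mem_range] at hj
      omega
    · rw [map_mul, map_mul, map_pow, map_pow, ha, hb] at he
      have hs0 : A.1.valuation (algebraMap (RatFunc k) L s) ≠ 0 := by simpa using hs0
      rw [zpow_sub₀ hs0, eq_div_iff (zpow_ne_zero _ hs0), pow_sub₀ _ hvz hij.le,
        mul_assoc, mul_comm (_⁻¹), ← mul_assoc, mul_comm (A.1.valuation z ^ j), ← he]
      field_simp
  obtain ⟨i, hi, j, hj, hij, he, hne⟩ := A.1.valuation.exists_ne_eq_of_sum_eq_zero _ _ hsum
    ⟨p.natDegree, by simp, by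
      rw [(minpoly.monic hint).coeff_natDegree, map_one, one_mul, map_pow]
      exact pow_ne_zero _ hvz⟩
  rcases lt_or_gt_of_ne hij with h | h
  · exact main i hi j hj h he hne
  · exact main j hj i hi h he.symm (he ▸ hne)

theorem FFPlace.exists_uniformizer (A : FFPlace k L) :
    ∃ π : L, π ≠ 0 ∧ A.1.valuation π < 1 ∧
      ∀ z : L, z ≠ 0 → ∃ i : ℤ, A.1.valuation z = A.1.valuation π ^ i := by
  obtain ⟨s, hs0, hs1, hs, -⟩ := A.exists_parameter
  set σ := A.1.valuation (algebraMap (RatFunc k) L s) with hσ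
  have hσ0 : σ ≠ 0 := by rw [hσ]; simpa using hs0
  set M := (Module.finrank (RatFunc k) L).factorial with hM
  have hMpos : M ≠ 0 := Nat.factorial_ne_zero _
  have key : ∀ z : L, z ≠ 0 → ∃ w : ℤ, A.1.valuation z ^ M = σ ^ w := by
    intro z hz
    obtain ⟨j, hj1, hjN, l, hl⟩ := A.exists_pow_eq hs0 hs hz
    obtain ⟨c, hc⟩ := Nat.dvd_factorial hj1 hjN
    refine ⟨l * c, ?_⟩
    rw [hM, hc, pow_mul, hl, zpow_mul, zpow_natCast]
  have hex : ∃ m : ℕ, 0 < m ∧ ∃ z : L, z ≠ 0 ∧ A.1.valuation z ^ M = σ ^ m :=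
    ⟨M, Nat.pos_of_ne_zero hMpos, algebraMap (RatFunc k) L s, by simpa using hs0, rfl⟩
  obtain ⟨hm, π, hπ, hπm⟩ := Nat.find_spec hex
  have hmin := fun m' (h : m' < Nat.find hex) => Nat.find_min hex h
  set m := Nat.find hex
  have hvπ : A.1.valuation π ≠ 0 := by simpa using hπ
  refine ⟨π, hπ, ?_, fun z hz => ?_⟩
  · by_contra! h
    have h1 : 1 ≤ A.1.valuation π ^ M := one_le_pow₀ h
    rw [hπm] at h1
    exact absurd (pow_lt_one₀ zero_le hs1 hm.ne') (not_lt.2 h1)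
  · obtain ⟨w, hw⟩ := key z hz
    refine ⟨w / m, ?_⟩
    have e : A.1.valuation (z * π ^ (-(w / m))) ^ M = σ ^ (w % m) := by
      rw [map_mul, map_zpow₀, mul_pow, hw, ← zpow_natCast (_ ^ (-(w / m))), ← zpow_mul,
        mul_comm (-(w / m)), zpow_mul, zpow_natCast, hπm, ← zpow_natCast σ, ← zpow_mul,
        ← zpow_add₀ hσ0]
      congr 1
      have := Int.emod_add_mul_ediv w m
      linarith
    have hmod0 : w % m = 0 := by
      have h1 : 0 ≤ w % m := Int.emod_nonneg _ (by positivity)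
      have h2 : w % m < m := Int.emod_lt_of_pos _ (by positivity)
      obtain ⟨r, hr⟩ := Int.eq_ofNat_of_zero_le h1
      rw [hr] at e h2 ⊢
      by_contra h3
      exact hmin r (by exact_mod_cast h2) ⟨by omega,
        z * π ^ (-(w / m)), mul_ne_zero hz (zpow_ne_zero _ hπ), by rw [e, zpow_natCast]⟩
    rw [hmod0, zpow_zero] at e
    have h1 := (pow_eq_one_iff_of_nonneg zero_le hMpos).1 e
    rw [map_mul, map_zpow₀, zpow_neg] at h1
    exact (mul_inv_eq_one₀ (zpow_ne_zero _ hvπ)).1 h1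

end Discreteness

section Order

variable {k L : Type} [Field k] [Field L] [Algebra k L]
variable [IsAlgClosed k] [Algebra (RatFunc k) L] [IsScalarTower k (RatFunc k) L]
  [FiniteDimensional (RatFunc k) L]

namespace FFPlace

variable (A : FFPlace k L)

theorem unifAt_spec : unifAt A.1 ≠ 0 ∧ A.1.valuation (unifAt A.1) < 1 ∧
    ∀ z : L, z ≠ 0 → ∃ i : ℤ, A.1.valuation z = A.1.valuation (unifAt A.1) ^ i := by
  obtain ⟨π, hπ, hπ1, hex⟩ := A.exists_uniformizer
  have hπA : π ∈ A.1 := (A.1.valuation_le_one_iff _).1 hπ1.le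
  have hvπ : A.1.valuation π ≠ 0 := by simpa using hπ
  have hmem : ∀ x : A.1, x ∈ IsLocalRing.maximalIdeal A.1 ↔ A.1.valuation (x : L) < 1 :=
    fun x => A.1.valuation_lt_one_iff x
  have hgen : IsLocalRing.maximalIdeal A.1 = Ideal.span {(⟨π, hπA⟩ : A.1)} := by
    apply le_antisymm
    · intro x hx
      rw [hmem] at hx
      rw [Ideal.mem_span_singleton]
      by_cases hx0 : (x : L) = 0
      · have : x = 0 := Subtype.ext hx0
        rw [this]; exact dvd_zero _
      · obtain ⟨i, hi⟩ := hex _ hx0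
        have hi1 : 1 ≤ i := by
          by_contra! h
          rw [hi] at hx
          exact absurd hx (not_lt.2 (one_le_zpow_of_nonpos₀ (zero_lt_iff.2 hvπ) hπ1.le (by omega)))
        have hq : (x : L) / π ∈ A.1 := by
          rw [← A.1.valuation_le_one_iff, map_div₀, hi, div_eq_mul_inv, ← zpow_sub_one₀ hvπ]
          exact zpow_le_one₀ (zero_lt_iff.2 hvπ) hπ1.le (by omega)
        refine ⟨⟨_, hq⟩, Subtype.ext ?_⟩
        change (x : L) = π * (x / π)
        field_simp
    · rw [Ideal.span_singleton_le_iff_mem, hmem]; exact hπ1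
  have h : ∃ π : A.1, IsLocalRing.maximalIdeal A.1 = Ideal.span {π} ∧ (π : L) ≠ 0 :=
    ⟨_, hgen, hπ⟩
  have e : unifAt A.1 = (h.choose : L) := by rw [unifAt, dif_pos h]
  obtain ⟨h1, h2⟩ := h.choose_spec
  rw [← e] at h2
  have hlt : A.1.valuation (unifAt A.1) < 1 := by
    rw [e, ← hmem]; exact h1.ge (Ideal.mem_span_singleton_self _)
  have hle : A.1.valuation (unifAt A.1) = A.1.valuation π := by
    have hA : Associated h.choose ⟨π, hπA⟩ := by
      rw [← Ideal.span_singleton_eq_span_singleton, ← h1, hgen]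
    obtain ⟨u, hu⟩ := hA
    have hu' : (h.choose : L) * (u : A.1) = π := congrArg Subtype.val hu
    rw [← hu', map_mul, ← e, (A.1.valuation_eq_one_iff _).1 u.isUnit, mul_one]
  exact ⟨h2, hlt, by rwa [hle]⟩

/-- The normalised order at a place. -/
abbrev ord (z : L) : ℤ := ordAt A.1 z

theorem valuation_unifAt_ne_zero : A.1.valuation (unifAt A.1) ≠ 0 := by
  simpa using A.unifAt_spec.1

theorem valuation_eq_zpow {z : L} (hz : z ≠ 0) :
    A.1.valuation z = A.1.valuation (unifAt A.1) ^ A.ord z := by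
  have h := A.unifAt_spec.2.2 z hz
  rw [ord, ordAt, dif_pos h]
  exact h.choose_spec

theorem zpow_lt_zpow_iff {i j : ℤ} :
    A.1.valuation (unifAt A.1) ^ i < A.1.valuation (unifAt A.1) ^ j ↔ j < i :=
  (zpow_right_strictAnti₀ (zero_lt_iff.2 A.valuation_unifAt_ne_zero) A.unifAt_spec.2.1).lt_iff_gt

theorem zpow_le_zpow_iff {i j : ℤ} :
    A.1.valuation (unifAt A.1) ^ i ≤ A.1.valuation (unifAt A.1) ^ j ↔ j ≤ i :=
  (zpow_right_strictAnti₀ (zero_lt_iff.2 A.valuation_unifAt_ne_zero) A.unifAt_spec.2.1).le_iff_ge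

theorem zpow_inj {i j : ℤ}
    (h : A.1.valuation (unifAt A.1) ^ i = A.1.valuation (unifAt A.1) ^ j) : i = j :=
  le_antisymm (A.zpow_le_zpow_iff.1 h.ge) (A.zpow_le_zpow_iff.1 h.le)

theorem ord_eq {z : L} {i : ℤ} (h : A.1.valuation z = A.1.valuation (unifAt A.1) ^ i) :
    A.ord z = i := by
  have hz : z ≠ 0 := by
    rintro rfl
    rw [map_zero] at h
    exact zpow_ne_zero i A.valuation_unifAt_ne_zero h.symm
  exact A.zpow_inj ((A.valuation_eq_zpow hz).symm.trans h)

theorem ord_zero : A.ord (0 : L) = 0 := by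
  rw [ord, ordAt, dif_neg]
  rintro ⟨n, hn⟩
  rw [map_zero] at hn
  exact zpow_ne_zero n A.valuation_unifAt_ne_zero hn.symm

theorem ord_mul {z w : L} (hz : z ≠ 0) (hw : w ≠ 0) : A.ord (z * w) = A.ord z + A.ord w := by
  apply A.ord_eq
  rw [map_mul, A.valuation_eq_zpow hz, A.valuation_eq_zpow hw,
    zpow_add₀ A.valuation_unifAt_ne_zero]

theorem ord_inv (z : L) : A.ord z⁻¹ = - A.ord z := by
  by_cases hz : z = 0
  · rw [hz, inv_zero, A.ord_zero, neg_zero]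
  · apply A.ord_eq
    rw [map_inv₀, A.valuation_eq_zpow hz, zpow_neg]

theorem ord_one : A.ord (1 : L) = 0 := A.ord_eq (by simp)

theorem ord_zpow (z : L) (i : ℤ) (hz : z ≠ 0) : A.ord (z ^ i) = i * A.ord z := by
  apply A.ord_eq
  rw [map_zpow₀, A.valuation_eq_zpow hz, ← zpow_mul, mul_comm]

theorem ord_pow (z : L) (i : ℕ) : A.ord (z ^ i) = i * A.ord z := by
  by_cases hz : z = 0
  · subst hz
    rcases Nat.eq_zero_or_pos i with rfl | hi
    · simp [A.ord_one]
    · rw [zero_pow hi.ne', A.ord_zero, mul_zero]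
  · rw [← zpow_natCast, A.ord_zpow z i hz]

theorem ord_const (c : k) : A.ord (algebraMap k L c) = 0 := by
  by_cases hc : c = 0
  · rw [hc, map_zero, A.ord_zero]
  · apply A.ord_eq
    rw [A.valuation_const hc, zpow_zero]

theorem ord_unifAt : A.ord (unifAt A.1) = 1 := A.ord_eq (by rw [zpow_one])

/-- The elements of order at least `m`. -/
def ordGE (m : ℤ) : Submodule k L where
  carrier := {z | A.1.valuation z ≤ A.1.valuation (unifAt A.1) ^ m}
  add_mem' := fun ha hb => A.1.valuation.map_add_le ha hb
  zero_mem' := by simp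
  smul_mem' := fun c z hz => by
    rw [Set.mem_ofPred_eq, Algebra.smul_def, map_mul]
    exact (mul_le_of_le_one_left zero_le (A.valuation_const_le c)).trans hz

theorem mem_ordGE_iff_valuation {m : ℤ} {z : L} :
    z ∈ A.ordGE m ↔ A.1.valuation z ≤ A.1.valuation (unifAt A.1) ^ m := Iff.rfl

theorem mem_ordGE {m : ℤ} {z : L} : z ∈ A.ordGE m ↔ (z ≠ 0 → m ≤ A.ord z) := by
  by_cases hz : z = 0
  · simp [hz]
  · rw [mem_ordGE_iff_valuation, A.valuation_eq_zpow hz, A.zpow_le_zpow_iff]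
    simp [hz]

theorem mem_ordGE_of_ne {m : ℤ} {z : L} (hz : z ≠ 0) : z ∈ A.ordGE m ↔ m ≤ A.ord z := by
  simp [A.mem_ordGE, hz]

theorem ordGE_anti {m m' : ℤ} (h : m ≤ m') : A.ordGE m' ≤ A.ordGE m := fun _ hz =>
  A.mem_ordGE.2 fun h0 => h.trans (A.mem_ordGE.1 hz h0)

theorem mul_mem_ordGE {m m' : ℤ} {z w : L} (hz : z ∈ A.ordGE m) (hw : w ∈ A.ordGE m') :
    z * w ∈ A.ordGE (m + m') := by
  rw [mem_ordGE_iff_valuation, map_mul, zpow_add₀ A.valuation_unifAt_ne_zero]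
  exact mul_le_mul' hz hw

theorem mul_mem_ordGE_iff {m : ℤ} {z w : L} (hw : w ≠ 0) :
    z * w ∈ A.ordGE m ↔ z ∈ A.ordGE (m - A.ord w) := by
  rw [mem_ordGE, mem_ordGE]
  by_cases hz : z = 0
  · simp [hz]
  · simp only [ne_eq, mul_eq_zero, hz, hw, or_self, not_false_eq_true, forall_const,
      A.ord_mul hz hw]
    constructor <;> intro h <;> linarith

theorem mem_ordGE_zero {z : L} : z ∈ A.ordGE 0 ↔ z ∈ A.1 := by
  rw [mem_ordGE_iff_valuation, zpow_zero, A.1.valuation_le_one_iff]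

theorem mem_ordGE_one {z : L} : z ∈ A.ordGE 1 ↔ A.1.valuation z < 1 := by
  by_cases hz : z = 0
  · simp [hz]
  · rw [A.mem_ordGE_of_ne hz, A.valuation_eq_zpow hz,
      ← zpow_zero (A.1.valuation (unifAt A.1)), A.zpow_lt_zpow_iff]
    constructor <;> intro h <;> linarith

theorem const_mem (c : k) : algebraMap k L c ∈ A.ordGE 0 := A.mem_ordGE_zero.2 (A.2.1 c)

theorem const_mem_ordGE_one {c : k} (h : algebraMap k L c ∈ A.ordGE 1) : c = 0 := by
  by_contra hc
  rw [mem_ordGE_one, A.valuation_const hc] at h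
  exact lt_irrefl _ h

theorem self_mem_ordGE {z : L} : z ∈ A.ordGE (A.ord z) := A.mem_ordGE.2 fun _ => le_rfl

theorem ord_add_eq_of_lt {z w : L} (hz : z ≠ 0) (h : w ∈ A.ordGE (A.ord z + 1)) :
    z + w ≠ 0 ∧ A.ord (z + w) = A.ord z := by
  have h1 : A.1.valuation w < A.1.valuation z := by
    refine lt_of_le_of_lt h ?_
    rw [A.valuation_eq_zpow hz, A.zpow_lt_zpow_iff]
    omega
  have h2 := Valuation.map_add_eq_of_lt_left A.1.valuation h1
  have h3 : z + w ≠ 0 := by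
    intro h; rw [h, map_zero] at h2
    exact hz (by simpa using h2.symm)
  refine ⟨h3, A.ord_eq ?_⟩
  rw [h2, A.valuation_eq_zpow hz]

theorem ne_zero_of_notMem {m : ℤ} {z : L} (h : z ∉ A.ordGE m) : z ≠ 0 := by
  rintro rfl; exact h (zero_mem _)

theorem ord_lt_of_notMem {m : ℤ} {z : L} (h : z ∉ A.ordGE m) : A.ord z < m := by
  rw [A.mem_ordGE] at h
  push Not at h
  exact h.2

theorem pow_mem_ordGE {z : L} {m : ℤ} (h : z ∈ A.ordGE m) (i : ℕ) :
    z ^ i ∈ A.ordGE (i * m) := by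
  induction i with
  | zero => simpa using A.const_mem (1 : k)
  | succ i ih =>
    rw [pow_succ]
    have := A.mul_mem_ordGE ih h
    rwa [show (i : ℤ) * m + m = ((i + 1 : ℕ) : ℤ) * m by push_cast; ring] at this

theorem exists_residue_ratFunc {q : RatFunc k} (hq : algebraMap (RatFunc k) L q ∈ A.ordGE 0) :
    ∃ c : k, algebraMap (RatFunc k) L q - algebraMap k L c ∈ A.ordGE 1 := by
  by_cases hq0 : q = 0
  · exact ⟨0, by simp [hq0]⟩
  obtain ⟨s, hs0, hs1, hs, -⟩ := A.exists_parameter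
  have hs0' : A.1.valuation (algebraMap (RatFunc k) L s) ≠ 0 := by simpa using hs0
  obtain ⟨i, c, hc, h⟩ := hs q hq0
  have h1 := A.valuation_eq_one_of_sub_const hc h
  rw [map_mul, map_zpow₀, zpow_neg, mul_inv_eq_one₀ (zpow_ne_zero _ hs0')] at h1
  rw [mem_ordGE_iff_valuation, zpow_zero] at hq
  rcases lt_trichotomy i 0 with hi | rfl | hi
  · rw [h1] at hq
    exact absurd hq (not_le.2 (one_lt_zpow_of_neg₀ (zero_lt_iff.2 hs0') hs1 hi))
  · rw [neg_zero, zpow_zero, mul_one] at h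
    exact ⟨c, A.mem_ordGE_one.2 h⟩
  · refine ⟨0, ?_⟩
    rw [map_zero, sub_zero, mem_ordGE_one, h1]
    exact zpow_lt_one₀ (zero_lt_iff.2 hs0') hs1 hi

theorem exists_scaling {ι F : Type*} [Field F] [Algebra F L]
    (hF : ∀ q : F, algebraMap F L q ∈ A.ordGE 0 →
      ∃ c : k, algebraMap F L q - algebraMap k L c ∈ A.ordGE 1)
    (S : Finset ι) (a : ι → F) (hne : ∃ i ∈ S, a i ≠ 0) :
    ∃ q : F, q ≠ 0 ∧ ∃ c : ι → k,
      (∀ i ∈ S, algebraMap F L (a i * q) - algebraMap k L (c i) ∈ A.ordGE 1) ∧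
      ∃ i ∈ S, c i ≠ 0 := by
  obtain ⟨i0, hi0, h0⟩ := hne
  obtain ⟨j, hj, hmax⟩ := Finset.exists_max_image S
    (fun i => A.1.valuation (algebraMap F L (a i))) ⟨i0, hi0⟩
  have hj0 : a j ≠ 0 := by
    intro h
    have := hmax i0 hi0
    simp [h, h0] at this
  have hj' : A.1.valuation (algebraMap F L (a j)) ≠ 0 := by simpa using hj0
  have hint : ∀ i ∈ S, algebraMap F L (a i * (a j)⁻¹) ∈ A.ordGE 0 := by
    intro i hi
    rw [mem_ordGE_iff_valuation, zpow_zero, map_mul, map_inv₀, map_mul, map_inv₀]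
    exact (mul_inv_le_iff₀ (zero_lt_iff.2 hj')).2 (by simpa using hmax i hi)
  have hc : ∀ i, ∃ c : k, i ∈ S → algebraMap F L (a i * (a j)⁻¹) -
      algebraMap k L c ∈ A.ordGE 1 := by
    intro i
    by_cases hi : i ∈ S
    · obtain ⟨c, hc⟩ := hF _ (hint i hi)
      exact ⟨c, fun _ => hc⟩
    · exact ⟨0, fun h => absurd h hi⟩
  choose c hc using hc
  refine ⟨_, inv_ne_zero hj0, c, hc, j, hj, fun h => ?_⟩
  have := hc j hj
  rw [h, map_zero, sub_zero, mul_inv_cancel₀ hj0] at this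
  have h1 := A.const_mem_ordGE_one (c := 1) (by simpa using this)
  exact one_ne_zero h1

/-- The residue field of a place is `k`. -/
theorem exists_residue {z : L} (hz : z ∈ A.ordGE 0) :
    ∃ c : k, z - algebraMap k L c ∈ A.ordGE 1 := by
  have hint : IsIntegral (RatFunc k) z := IsIntegral.of_finite _ z
  set p := minpoly (RatFunc k) z with hp
  have hsum : ∑ i ∈ Finset.range (p.natDegree + 1),
      algebraMap (RatFunc k) L (p.coeff i) * z ^ i = 0 := by
    have := minpoly.aeval (RatFunc k) z
    rwa [Polynomial.aeval_eq_sum_range, ← hp, Finset.sum_congr rfl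
      (fun i _ => Algebra.smul_def _ _)] at this
  obtain ⟨q, hq, c, hc, i0, hi0, hci0⟩ := A.exists_scaling (fun q => A.exists_residue_ratFunc)
    (Finset.range (p.natDegree + 1)) p.coeff ⟨p.natDegree, by simp, by
      rw [(minpoly.monic hint).coeff_natDegree]; exact one_ne_zero⟩
  let r : Polynomial k := ∑ i ∈ Finset.range (p.natDegree + 1), Polynomial.monomial i (c i)
  have hr0 : r ≠ 0 := by
    intro h
    have : r.coeff i0 = c i0 := by
      simp only [r, Polynomial.finsetSum_coeff, Polynomial.coeff_monomial]
      rw [Finset.sum_ite_eq' , if_pos hi0]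
    rw [h, Polynomial.coeff_zero] at this
    exact hci0 this.symm
  have hr : Polynomial.aeval z r ∈ A.ordGE 1 := by
    have e : Polynomial.aeval z r = -∑ i ∈ Finset.range (p.natDegree + 1),
        (algebraMap (RatFunc k) L (p.coeff i * q) - algebraMap k L (c i)) * z ^ i := by
      have h2 : ∑ i ∈ Finset.range (p.natDegree + 1),
          algebraMap (RatFunc k) L (p.coeff i * q) * z ^ i = 0 := by
        rw [← mul_zero (algebraMap (RatFunc k) L q), ← hsum, Finset.mul_sum]
        refine Finset.sum_congr rfl fun i _ => ?_
        rw [map_mul]; ring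
      simp only [sub_mul, Finset.sum_sub_distrib, h2, r, map_sum, Polynomial.aeval_monomial]
      ring
    rw [e]
    refine neg_mem (sum_mem fun i hi => ?_)
    have := A.mul_mem_ordGE (hc i hi) (A.pow_mem_ordGE hz i)
    simpa using this
  rw [(IsAlgClosed.splits r).eq_prod_roots, map_mul, Polynomial.aeval_C, mem_ordGE_one, map_mul,
    A.valuation_const (Polynomial.leadingCoeff_ne_zero.2 hr0), one_mul] at hr
  by_contra! hcon
  refine absurd hr (not_lt.2 ?_)
  generalize r.roots = m
  induction m using Multiset.induction_on with
  | empty => simp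
  | cons a m ih =>
    rw [Multiset.map_cons, Multiset.prod_cons, map_mul, map_mul]
    refine one_le_mul ?_ ih
    have := hcon a
    rw [mem_ordGE_one, not_lt] at this
    simpa using this

end FFPlace

end Order

section RiemannRochSpaces

variable {k L : Type} [Field k] [Field L] [Algebra k L]

theorem isIntegral_of_forall_place (R : Subring L) (hk : ∀ c : k, algebraMap k L c ∈ R) (z : L)
    (hz : ∀ A : FFPlace k L, (∀ r ∈ R, r ∈ A.1) → z ∈ A.1) : IsIntegral R z := by
  have h := iInf_valuationSubring_superset (K := L) (s := (R : Set L))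
  have hz' : z ∈ (⨅ V : {V : ValuationSubring L // (R : Set L) ⊆ V.toSubring}, V.1.toSubring) := by
    rw [Subring.mem_iInf]
    rintro ⟨V, hV⟩
    by_cases htop : V = ⊤
    · change z ∈ V
      rw [htop]; trivial
    · exact hz ⟨V, fun c => hV (hk c), htop⟩ fun r hr => hV hr
  rw [h] at hz'
  rw [Subring.closure_eq] at hz'
  exact hz'

variable [IsAlgClosed k] [Algebra (RatFunc k) L] [IsScalarTower k (RatFunc k) L]
  [FiniteDimensional (RatFunc k) L]

theorem FFPlace.finrank_le_inf_ordGE_succ (A : FFPlace k L) {W : Submodule k L} {m : ℤ}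
    (hW : W ≤ A.ordGE m) (hfin : FiniteDimensional k (W ⊓ A.ordGE (m + 1) : Submodule k L)) :
    FiniteDimensional k W ∧
      Module.finrank k W ≤ Module.finrank k (W ⊓ A.ordGE (m + 1) : Submodule k L) + 1 := by
  by_cases h : W ≤ A.ordGE (m + 1)
  · rw [inf_eq_left.2 h] at hfin ⊢
    exact ⟨hfin, by omega⟩
  obtain ⟨w, hw, hw'⟩ := Set.not_subset.1 h
  have hw0 := A.ne_zero_of_notMem hw'
  have hord : A.ord w = m := by
    have h1 := A.ord_lt_of_notMem hw'
    have h2 := (A.mem_ordGE_of_ne hw0).1 (hW hw)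
    omega
  have hle : W ≤ (W ⊓ A.ordGE (m + 1)) ⊔ Submodule.span k {w} := by
    intro z hz
    have h1 : z * w⁻¹ ∈ A.ordGE 0 := by
      rw [A.mul_mem_ordGE_iff (inv_ne_zero hw0), A.ord_inv, hord]
      simpa using hW hz
    obtain ⟨c, hc⟩ := A.exists_residue h1
    have h2 : z - c • w ∈ A.ordGE (m + 1) := by
      have e : z - c • w = (z * w⁻¹ - algebraMap k L c) * w := by
        rw [Algebra.smul_def]; field_simp
      rw [e, A.mul_mem_ordGE_iff hw0, hord]
      simpa using hc
    have : z = (z - c • w) + c • w := by ring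
    rw [this]
    exact Submodule.add_mem_sup ⟨sub_mem hz (Submodule.smul_mem _ _ hw), h2⟩
      (Submodule.smul_mem _ _ (Submodule.mem_span_singleton_self w))
  refine ⟨Submodule.finiteDimensional_of_le hle, ?_⟩
  refine (Submodule.finrank_mono hle).trans ?_
  refine (Submodule.finrank_add_le_finrank_add_finrank _ _).trans ?_
  gcongr
  exact (finrank_span_le_card _).trans (by simp)

theorem FFPlace.finrank_le_inf_ordGE_add (A : FFPlace k L) (e : ℕ) {W : Submodule k L} {m : ℤ}
    (hW : W ≤ A.ordGE m) (hfin : FiniteDimensional k (W ⊓ A.ordGE (m + e) : Submodule k L)) :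
    FiniteDimensional k W ∧
      Module.finrank k W ≤ Module.finrank k (W ⊓ A.ordGE (m + e) : Submodule k L) + e := by
  induction e with
  | zero =>
    have e0 : W ⊓ A.ordGE (m + (0 : ℕ)) = W := by
      rw [Nat.cast_zero, add_zero]; exact inf_eq_left.2 hW
    rw [e0] at hfin ⊢
    exact ⟨hfin, le_rfl⟩
  | succ e ih =>
    have e1 : W ⊓ A.ordGE (m + (e + 1 : ℕ)) =
        (W ⊓ A.ordGE (m + e)) ⊓ A.ordGE ((m + e) + 1) := by
      rw [inf_assoc, inf_eq_right.2 (A.ordGE_anti (by omega : m + e ≤ m + e + 1)), Nat.cast_add,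
        Nat.cast_one, add_assoc]
    rw [e1] at hfin ⊢
    obtain ⟨h1, h2⟩ := A.finrank_le_inf_ordGE_succ inf_le_right hfin
    obtain ⟨h3, h4⟩ := ih h1
    exact ⟨h3, by omega⟩

theorem finrank_le_inf_iInf_ordGE (S : Finset (FFPlace k L)) (m : FFPlace k L → ℤ)
    (E : FFPlace k L → ℕ) {W : Submodule k L} (hW : ∀ A ∈ S, W ≤ A.ordGE (m A))
    (hfin : FiniteDimensional k (W ⊓ ⨅ A ∈ S, A.ordGE (m A + E A) : Submodule k L)) :
    FiniteDimensional k W ∧ Module.finrank k W ≤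
      Module.finrank k (W ⊓ ⨅ A ∈ S, A.ordGE (m A + E A) : Submodule k L) + ∑ A ∈ S, E A := by
  induction S using Finset.induction_on generalizing W with
  | empty =>
    have e0 : W ⊓ (⨅ A ∈ (∅ : Finset (FFPlace k L)), A.ordGE (m A + E A)) = W := by simp
    rw [e0] at hfin ⊢
    exact ⟨hfin, by simp⟩
  | insert A S hA ih =>
    have e1 : (⨅ B ∈ insert A S, B.ordGE (m B + E B)) =
        A.ordGE (m A + E A) ⊓ ⨅ B ∈ S, B.ordGE (m B + E B) := Finset.iInf_insert _ _ _
    rw [e1, ← inf_assoc] at hfin ⊢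
    obtain ⟨h1, h2⟩ := ih (fun B hB => inf_le_left.trans (hW B (Finset.mem_insert_of_mem hB))) hfin
    obtain ⟨h3, h4⟩ := A.finrank_le_inf_ordGE_add (E A) (hW A (Finset.mem_insert_self A S)) h1
    rw [Finset.sum_insert hA]
    exact ⟨h3, by omega⟩

/-- The Riemann–Roch space of a divisor. -/
def rrSpace (D : FFPlace k L →₀ ℤ) : Submodule k L := ⨅ A : FFPlace k L, A.ordGE (-(D A))

theorem mem_rrSpace {D : FFPlace k L →₀ ℤ} {z : L} :
    z ∈ rrSpace D ↔ ∀ A : FFPlace k L, z ∈ A.ordGE (-(D A)) := Submodule.mem_iInf _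

theorem rrDim_eq (D : FFPlace k L →₀ ℤ) : rrDim k D = Module.finrank k (rrSpace D) := by
  have : {f : L | f ≠ 0 → ∀ A : FFPlace k L, -(D A) ≤ ordAt A.1 f} = (rrSpace D : Set L) := by
    ext z
    rw [SetLike.mem_coe, mem_rrSpace]
    simp only [FFPlace.mem_ordGE]
    exact ⟨fun h A hz => h hz A, fun h hz A => h A hz⟩
  rw [rrDim, this, Submodule.span_eq]

theorem divDeg_eq_sum (D : FFPlace k L →₀ ℤ) {S : Finset (FFPlace k L)} (h : D.support ⊆ S) :
    divDeg D = ∑ A ∈ S, D A := Finsupp.sum_of_support_subset _ h _ (fun _ _ => rfl)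

theorem divDeg_add (D D' : FFPlace k L →₀ ℤ) : divDeg (D + D') = divDeg D + divDeg D' :=
  Finsupp.sum_add_index' (fun _ => rfl) (fun _ _ _ => rfl)

theorem divDeg_zsmul (r : ℤ) (D : FFPlace k L →₀ ℤ) : divDeg (r • D) = r * divDeg D := by
  rw [divDeg_eq_sum (r • D) (Finsupp.support_smul), divDeg_eq_sum D subset_rfl, Finset.mul_sum]
  rfl

theorem divDeg_sub (D D' : FFPlace k L →₀ ℤ) : divDeg (D - D') = divDeg D - divDeg D' := by
  have := divDeg_add (D - D') D'
  rw [sub_add_cancel] at this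
  linarith

theorem divDeg_single (A : FFPlace k L) (n : ℤ) : divDeg (Finsupp.single A n) = n :=
  Finsupp.sum_single_index rfl

theorem rrSpace_mono_finrank {D D' : FFPlace k L →₀ ℤ} (h : D ≤ D')
    (hfin : FiniteDimensional k (rrSpace D)) :
    FiniteDimensional k (rrSpace D') ∧
      (Module.finrank k (rrSpace D') : ℤ) ≤ Module.finrank k (rrSpace D) + divDeg (D' - D) := by
  set S := D.support ∪ D'.support
  have hE : ∀ A, ((D' A - D A).toNat : ℤ) = D' A - D A := fun A =>
    Int.toNat_of_nonneg (sub_nonneg.2 (h A))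
  have e : rrSpace D = rrSpace D' ⊓
      ⨅ A ∈ S, A.ordGE (-(D' A) + ((D' A - D A).toNat : ℤ)) := by
    ext z
    simp only [hE, Submodule.mem_inf, Submodule.mem_iInf, mem_rrSpace,
      show ∀ A, -(D' A) + (D' A - D A) = - D A by intro A; ring]
    refine ⟨fun hz => ⟨fun A => A.ordGE_anti (neg_le_neg (h A)) (hz A), fun A _ => hz A⟩,
      fun hz A => ?_⟩
    by_cases hA : A ∈ S
    · exact hz.2 A hA
    · simp only [S, Finset.mem_union, Finsupp.mem_support_iff, not_or, not_not] at hA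
      rw [hA.1, ← hA.2]; exact hz.1 A
  rw [e] at hfin
  obtain ⟨h1, h2⟩ := finrank_le_inf_iInf_ordGE S (fun A => -(D' A))
    (fun A => (D' A - D A).toNat) (fun A _ z hz => mem_rrSpace.1 hz A) hfin
  refine ⟨h1, ?_⟩
  rw [← e] at h2
  have h3 : divDeg (D' - D) = ((∑ A ∈ S, (D' A - D A).toNat : ℕ) : ℤ) := by
    push_cast
    rw [divDeg_sub, divDeg_eq_sum D' Finset.subset_union_right,
      divDeg_eq_sum D Finset.subset_union_left, ← Finset.sum_sub_distrib]
    exact Finset.sum_congr rfl fun A _ => (hE A).symm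
  rw [h3]
  exact_mod_cast h2

theorem exists_const_of_forall_place {z : L} (hz : ∀ A : FFPlace k L, z ∈ A.1) :
    ∃ c : k, z = algebraMap k L c := by
  have h := isIntegral_of_forall_place (k := k) (algebraMap k L).range (fun c => ⟨c, rfl⟩) z
    (fun A _ => hz A)
  have h2 : IsIntegral k z := by
    obtain ⟨p, hp, hpz⟩ := h
    have hsurj : Function.Surjective (algebraMap k L).rangeRestrict :=
      (algebraMap k L).rangeRestrict_surjective
    obtain ⟨q, hq, hdeg, hqm⟩ := Polynomial.lifts_and_natDegree_eq_and_monic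
      (f := (algebraMap k L).rangeRestrict) (p := p)
      ((Polynomial.mem_lifts p).2 (Polynomial.map_surjective _ hsurj p)) hp
    refine ⟨q, hqm, ?_⟩
    rw [← hq, Polynomial.eval₂_map] at hpz
    exact hpz
  have h3 : z ∈ algebraicClosure k L := mem_algebraicClosure_iff.2 h2.isAlgebraic
  rw [IntermediateField.eq_bot_of_isAlgClosed_of_isAlgebraic (algebraicClosure k L),
    IntermediateField.mem_bot] at h3
  obtain ⟨c, hc⟩ := h3
  exact ⟨c, hc.symm⟩

theorem rrSpace_zero_finrank : FiniteDimensional k (rrSpace (0 : FFPlace k L →₀ ℤ)) ∧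
    Module.finrank k (rrSpace (0 : FFPlace k L →₀ ℤ)) = 1 := by
  have : rrSpace (0 : FFPlace k L →₀ ℤ) = Submodule.span k {(1 : L)} := by
    apply le_antisymm
    · intro z hz
      rw [mem_rrSpace] at hz
      obtain ⟨c, rfl⟩ := exists_const_of_forall_place (k := k) (z := z) fun A =>
        A.mem_ordGE_zero.1 (by simpa using hz A)
      rw [Algebra.algebraMap_eq_smul_one]
      exact Submodule.smul_mem _ _ (Submodule.mem_span_singleton_self _)
    · rw [Submodule.span_le, Set.singleton_subset_iff, SetLike.mem_coe, mem_rrSpace]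
      intro A
      simpa using A.const_mem (1 : k)
  rw [this]
  exact ⟨inferInstance, finrank_span_singleton one_ne_zero⟩

theorem rrSpace_finiteDimensional (D : FFPlace k L →₀ ℤ) : FiniteDimensional k (rrSpace D) := by
  obtain ⟨h1, -⟩ := rrSpace_mono_finrank (D := 0) (D' := D ⊔ 0) le_sup_right
    rrSpace_zero_finrank.1
  refine Submodule.finiteDimensional_of_le (S₂ := rrSpace (D ⊔ 0)) fun z hz => ?_
  rw [mem_rrSpace] at hz ⊢
  exact fun A => A.ordGE_anti (neg_le_neg ((le_sup_left : D ≤ D ⊔ 0) A)) (hz A)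

theorem rrDim_le {D D' : FFPlace k L →₀ ℤ} (h : D ≤ D') :
    (rrDim k D' : ℤ) ≤ rrDim k D + divDeg (D' - D) := by
  rw [rrDim_eq, rrDim_eq]
  exact (rrSpace_mono_finrank h (rrSpace_finiteDimensional D)).2

end RiemannRochSpaces

section ResidueHom

variable {k F : Type} [Field k] [Field F] [Algebra k F]
variable [IsAlgClosed k] [Algebra (RatFunc k) F] [IsScalarTower k (RatFunc k) F]
  [FiniteDimensional (RatFunc k) F]

namespace FFPlace

variable (p : FFPlace k F)

theorem residue_unique {z : F} {c c' : k} (h : z - algebraMap k F c ∈ p.ordGE 1)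
    (h' : z - algebraMap k F c' ∈ p.ordGE 1) : c = c' := by
  have h2 := sub_mem h' h
  have e : z - algebraMap k F c' - (z - algebraMap k F c) = algebraMap k F (c - c') := by
    rw [map_sub]; ring
  rw [e] at h2
  exact sub_eq_zero.1 (p.const_mem_ordGE_one h2)

theorem mul_sub_const_mem {z w : F} {c d : k} (h : z - algebraMap k F c ∈ p.ordGE 1)
    (h' : w - algebraMap k F d ∈ p.ordGE 1) : z * w - algebraMap k F (c * d) ∈ p.ordGE 1 := by
  have hz : z ∈ p.ordGE 0 := by
    have := add_mem (p.ordGE_anti zero_le_one h) (p.const_mem c)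
    rwa [sub_add_cancel] at this
  have e : z * w - algebraMap k F (c * d) =
      z * (w - algebraMap k F d) + algebraMap k F d * (z - algebraMap k F c) := by
    rw [map_mul]; ring
  rw [e]
  have h1 := p.mul_mem_ordGE hz h'
  have h2 := p.mul_mem_ordGE (p.const_mem d) h
  exact add_mem (by simpa using h1) (by simpa using h2)

/-- Evaluation at a place. -/
def residueHom : p.1 →+* k where
  toFun z := (p.exists_residue (p.mem_ordGE_zero.2 z.2)).choose
  map_one' := p.residue_unique (z := 1)
    (p.exists_residue (p.mem_ordGE_zero.2 (1 : p.1).2)).choose_spec (by simp)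
  map_mul' z w := p.residue_unique (z := z * w)
    (p.exists_residue (p.mem_ordGE_zero.2 (z * w).2)).choose_spec
    (p.mul_sub_const_mem (p.exists_residue (p.mem_ordGE_zero.2 z.2)).choose_spec
      (p.exists_residue (p.mem_ordGE_zero.2 w.2)).choose_spec)
  map_zero' := p.residue_unique (z := 0)
    (p.exists_residue (p.mem_ordGE_zero.2 (0 : p.1).2)).choose_spec (by simp)
  map_add' z w := p.residue_unique (z := z + w)
    (p.exists_residue (p.mem_ordGE_zero.2 (z + w).2)).choose_spec (by
      have := add_mem (p.exists_residue (p.mem_ordGE_zero.2 z.2)).choose_spec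
        (p.exists_residue (p.mem_ordGE_zero.2 w.2)).choose_spec
      rw [map_add]
      convert this using 1
      ring)

theorem residueHom_spec (z : p.1) :
    (z : F) - algebraMap k F (p.residueHom z) ∈ p.ordGE 1 :=
  (p.exists_residue (p.mem_ordGE_zero.2 z.2)).choose_spec

theorem residueHom_eq {z : p.1} {c : k} (h : (z : F) - algebraMap k F c ∈ p.ordGE 1) :
    p.residueHom z = c := p.residue_unique (p.residueHom_spec z) h

theorem residueHom_eq_zero_iff {z : p.1} : p.residueHom z = 0 ↔ (z : F) ∈ p.ordGE 1 := by
  refine ⟨fun h => ?_, fun h => p.residueHom_eq (by simpa using h)⟩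
  have := p.residueHom_spec z
  rwa [h, map_zero, sub_zero] at this

theorem eq_of_forall_mem {A B : FFPlace k F} (h : ∀ x ∈ A.1, x ∈ B.1) : A = B := by
  refine Subtype.ext (SetLike.ext fun x => ⟨h x, fun hx => ?_⟩)
  by_contra hxA
  apply B.2.2
  refine top_unique fun y _ => ?_
  have hx0 : x ≠ 0 := by rintro rfl; exact hxA (zero_mem _)
  have hlt : A.ord x < 0 := A.ord_lt_of_notMem (by rwa [A.mem_ordGE_zero])
  by_cases hy : y = 0
  · rw [hy]; exact zero_mem _
  set N := (A.ord y).natAbs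
  have h1 : y * (x ^ N)⁻¹ ∈ A.1 := by
    have hxN : x ^ N ≠ 0 := pow_ne_zero _ hx0
    rw [← A.mem_ordGE_zero, A.mem_ordGE_of_ne (mul_ne_zero hy (inv_ne_zero hxN)),
      A.ord_mul hy (inv_ne_zero hxN), A.ord_inv, A.ord_pow]
    have h2 : (N : ℤ) = |A.ord y| := Int.natCast_natAbs _
    rw [h2]
    have h3 := neg_abs_le (A.ord y)
    nlinarith [abs_nonneg (A.ord y)]
  have h2 := mul_mem (h _ h1) (pow_mem hx N)
  rwa [inv_mul_cancel_right₀ (pow_ne_zero _ hx0)] at h2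

theorem exists_notMem {A B : FFPlace k F} (h : A ≠ B) : ∃ x ∈ A.1, x ∉ B.1 := by
  by_contra! hcon
  exact h (eq_of_forall_mem hcon)

end FFPlace

end ResidueHom

section Relative

variable {k L : Type} (F : Type) [Field k] [Field F] [Field L] [Algebra k F] [Algebra k L]
  [Algebra F L] [IsScalarTower k F L] [FiniteDimensional F L]
variable [IsAlgClosed k] [Algebra (RatFunc k) F] [IsScalarTower k (RatFunc k) F]
  [FiniteDimensional (RatFunc k) F] [Algebra (RatFunc k) L] [IsScalarTower k (RatFunc k) L]
  [FiniteDimensional (RatFunc k) L]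

namespace FFPlace

/-- The restriction of a place to a subfield. -/
def restrict (A : FFPlace k L) : FFPlace k F :=
  ⟨A.1.comap (algebraMap F L), fun c => by
    rw [ValuationSubring.mem_comap, ← IsScalarTower.algebraMap_apply]; exact A.2.1 c, fun h => by
    have hF : ∀ q : F, algebraMap F L q ∈ A.1 := fun q => by
      have : q ∈ A.1.comap (algebraMap F L) := by rw [h]; trivial
      exact this
    apply A.2.2
    refine top_unique fun z _ => ?_
    have hz : IsIntegral F z := IsIntegral.of_finite _ z
    let f : F →+* A.1 := (algebraMap F L).codRestrict A.1.toSubring hF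
    have : IsIntegral A.1 z := by
      obtain ⟨p, hp, hpz⟩ := hz
      refine ⟨p.map f, hp.map f, ?_⟩
      rw [Polynomial.eval₂_map]
      exact hpz
    obtain ⟨y, hy⟩ := IsIntegrallyClosed.isIntegral_iff.1 this
    rw [← hy]; exact y.2⟩

variable {F}

theorem mem_restrict {A : FFPlace k L} {x : F} :
    x ∈ (A.restrict F).1 ↔ algebraMap F L x ∈ A.1 := Iff.rfl

theorem restrict_eq {A : FFPlace k L} {p : FFPlace k F} (h : ∀ x ∈ p.1, algebraMap F L x ∈ A.1) :
    A.restrict F = p := (eq_of_forall_mem h).symm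

variable (F) in
/-- The ramification index. -/
def ramIdx (A : FFPlace k L) : ℕ := (A.ord (algebraMap F L (unifAt (A.restrict F).1))).toNat

theorem mem_restrict_ordGE_one {A : FFPlace k L} {x : F} :
    x ∈ (A.restrict F).ordGE 1 ↔ algebraMap F L x ∈ A.ordGE 1 := by
  by_cases hx : x = 0
  · simp [hx]
  have hx' : algebraMap F L x ≠ 0 := by simpa using hx
  have h := (A.restrict F).mem_ordGE_zero (z := x⁻¹)
  have h' := A.mem_ordGE_zero (z := (algebraMap F L x)⁻¹)
  rw [mem_restrict, map_inv₀, ← h', mem_ordGE_of_ne _ (inv_ne_zero hx),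
    mem_ordGE_of_ne _ (inv_ne_zero hx'), ord_inv, ord_inv] at h
  rw [mem_ordGE_of_ne _ hx, mem_ordGE_of_ne _ hx']
  constructor <;> intro h1 <;> by_contra h2 <;> [have := h.2 (by omega); have := h.1 (by omega)]
    <;> omega

variable (F) in
theorem one_le_ord_unif (A : FFPlace k L) :
    1 ≤ A.ord (algebraMap F L (unifAt (A.restrict F).1)) := by
  have h0 : unifAt (A.restrict F).1 ≠ 0 := (A.restrict F).unifAt_spec.1
  have h1 : unifAt (A.restrict F).1 ∈ (A.restrict F).ordGE 1 := by
    rw [mem_ordGE_of_ne _ h0, ord_unifAt]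
  rw [mem_restrict_ordGE_one, mem_ordGE_of_ne _ (by simpa using h0)] at h1
  exact h1

theorem one_le_ramIdx (A : FFPlace k L) : 1 ≤ A.ramIdx F := by
  have := A.one_le_ord_unif F
  rw [ramIdx]; omega

theorem ord_algebraMap (A : FFPlace k L) (x : F) :
    A.ord (algebraMap F L x) = A.ramIdx F * (A.restrict F).ord x := by
  by_cases hx : x = 0
  · rw [hx, map_zero, ord_zero, ord_zero, mul_zero]
  have hcast : (A.ramIdx F : ℤ) = A.ord (algebraMap F L (unifAt (A.restrict F).1)) := by
    have := A.one_le_ord_unif F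
    rw [ramIdx]; omega
  set p := A.restrict F with hp
  set π := unifAt p.1
  have hπ : π ≠ 0 := p.unifAt_spec.1
  set u := x * π ^ (-(p.ord x)) with hu
  have hπz : π ^ (-(p.ord x)) ≠ 0 := zpow_ne_zero _ hπ
  have hu0 : u ≠ 0 := mul_ne_zero hx hπz
  have hu' : algebraMap F L u ≠ 0 := by simpa using hu0
  have hou : p.ord u = 0 := by
    rw [hu, p.ord_mul hx hπz, p.ord_zpow _ _ hπ, p.ord_unifAt]; ring
  have h1 : 0 ≤ A.ord (algebraMap F L u) := by
    rw [← mem_ordGE_of_ne _ hu', mem_ordGE_zero, ← mem_restrict, ← mem_ordGE_zero,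
      mem_ordGE_of_ne _ hu0, ← hp, hou]
  have h2 : 0 ≤ A.ord (algebraMap F L u⁻¹) := by
    have : algebraMap F L u⁻¹ ≠ 0 := by simpa using hu0
    rw [← mem_ordGE_of_ne _ this, mem_ordGE_zero, ← mem_restrict, ← mem_ordGE_zero,
      mem_ordGE_of_ne _ (inv_ne_zero hu0), ← hp, ord_inv, hou, neg_zero]
  rw [map_inv₀, ord_inv] at h2
  have h3 : A.ord (algebraMap F L u) = 0 := by omega
  have hx' : algebraMap F L x ≠ 0 := by simpa using hx
  have hπ' : algebraMap F L π ≠ 0 := by simpa using hπ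
  rw [hu, map_mul, map_zpow₀, ord_mul _ hx' (zpow_ne_zero _ hπ'), ord_zpow _ _ _ hπ', ← hcast] at h3
  linarith

theorem algebraMap_mem_ordGE {A : FFPlace k L} {x : F} {m : ℤ} (h : x ∈ (A.restrict F).ordGE m) :
    algebraMap F L x ∈ A.ordGE (A.ramIdx F * m) := by
  rw [mem_ordGE] at h ⊢
  intro hx
  rw [ord_algebraMap]
  have h1 := h (by rintro rfl; simp at hx)
  gcongr

theorem isIntegral_of_forall_over (p : FFPlace k F) (z : L)
    (hz : ∀ A : FFPlace k L, A.restrict F = p → z ∈ A.1) : IsIntegral p.1 z := by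
  have h := isIntegral_of_forall_place (k := k) (p.1.toSubring.map (algebraMap F L))
    (fun c => ⟨algebraMap k F c, p.2.1 c, (IsScalarTower.algebraMap_apply k F L c).symm⟩) z
    (fun A hA => hz A (restrict_eq fun x hx => hA _ ⟨x, hx, rfl⟩))
  obtain ⟨P, hP, hPz⟩ := h
  let f : p.1 →+* p.1.toSubring.map (algebraMap F L) :=
    ((algebraMap F L).comp p.1.subtype).codRestrict _ fun x => ⟨x, x.2, rfl⟩
  have hf : Function.Surjective f := by
    rintro ⟨_, x, hx, rfl⟩
    exact ⟨⟨x, hx⟩, rfl⟩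
  obtain ⟨q, hq, -, hqm⟩ := Polynomial.lifts_and_natDegree_eq_and_monic
      (f := f) (p := P) ((Polynomial.mem_lifts P).2 (Polynomial.map_surjective _ hf P)) hP
  refine ⟨q, hqm, ?_⟩
  rw [← hq, Polynomial.eval₂_map] at hPz
  exact hPz

theorem mem_of_isIntegral {p : FFPlace k F} {z : L} (h : IsIntegral p.1 z) {A : FFPlace k L}
    (hA : A.restrict F = p) : z ∈ A.1 := by
  subst hA
  have : IsIntegral A.1 z := by
    obtain ⟨P, hP, hPz⟩ := h
    let f : (A.restrict F).1 →+* A.1 :=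
      ((algebraMap F L).comp (A.restrict F).1.subtype).codRestrict A.1.toSubring fun x => x.2
    refine ⟨P.map f, hP.map f, ?_⟩
    rw [Polynomial.eval₂_map]
    exact hPz
  obtain ⟨y, hy⟩ := IsIntegrallyClosed.isIntegral_iff.1 this
  rw [← hy]; exact y.2

theorem trace_mem_of_forall_over (p : FFPlace k F) {z : L}
    (hz : ∀ A : FFPlace k L, A.restrict F = p → z ∈ A.1) : Algebra.trace F L z ∈ p.1 := by
  obtain ⟨y, hy⟩ := IsIntegrallyClosed.isIntegral_iff.1
    (Algebra.isIntegral_trace (L := F) (isIntegral_of_forall_over p z hz))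
  rw [← hy]; exact y.2

end FFPlace

end Relative

section ReducedTrace

variable {k L F : Type} [Field k] [Field F] [Field L] [Algebra k F] [Algebra k L]
  [Algebra F L] [IsScalarTower k F L] [FiniteDimensional F L]
variable [IsAlgClosed k] [Algebra (RatFunc k) F] [IsScalarTower k (RatFunc k) F]
  [FiniteDimensional (RatFunc k) F] [Algebra (RatFunc k) L] [IsScalarTower k (RatFunc k) L]
  [FiniteDimensional (RatFunc k) L]

namespace FFPlace

/-- A constant, as an element of the valuation ring of a place. -/
def constIn (p : FFPlace k F) (c : k) : p.1 := ⟨algebraMap k F c, p.2.1 c⟩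

theorem residueHom_constIn (p : FFPlace k F) (c : k) : p.residueHom (p.constIn c) = c :=
  p.residueHom_eq (by simp [constIn])

/-- The roots of the reduced minimal polynomial of an integral element are among its values at the
places above. -/
theorem exists_place_of_isRoot (p : FFPlace k F) {y : L}
    (hy : ∀ A : FFPlace k L, A.restrict F = p → y ∈ A.1) {c : k}
    (hc : ((minpoly p.1 y).map p.residueHom).IsRoot c) :
    ∃ A : FFPlace k L, A.restrict F = p ∧ y - algebraMap k L c ∈ A.ordGE 1 := by
  by_contra! hcon
  set u := y - algebraMap k L c with hu
  have hw : IsIntegral p.1 u⁻¹ := by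
    refine isIntegral_of_forall_over p _ fun A hA => ?_
    have h1 := A.ord_lt_of_notMem (hcon A hA)
    rw [← A.mem_ordGE_zero, A.mem_ordGE, A.ord_inv]
    intro _; omega
  by_cases hu0 : u = 0
  · have h1 : y = algebraMap p.1 L (p.constIn c) := by
      rw [sub_eq_zero.1 hu0, IsScalarTower.algebraMap_apply k F L]; rfl
    have h2 : minpoly p.1 y ∣ Polynomial.X - Polynomial.C (p.constIn c) :=
      minpoly.isIntegrallyClosed_dvd (isIntegral_of_forall_over p y hy) (by
        rw [map_sub, Polynomial.aeval_X, Polynomial.aeval_C, h1, sub_self])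
    by_cases hne : ∃ A : FFPlace k L, A.restrict F = p
    · obtain ⟨A, hA⟩ := hne
      exact hcon A hA (by rw [hu0]; exact zero_mem _)
    · push Not at hne
      have hint : ∀ z : L, IsIntegral p.1 z := fun z =>
        isIntegral_of_forall_over p z fun A hA => absurd hA (hne A)
      have h3 := hint (algebraMap F L (unifAt p.1))⁻¹
      rw [← map_inv₀, isIntegral_algebraMap_iff (algebraMap F L).injective] at h3
      obtain ⟨z, hz⟩ := IsIntegrallyClosed.isIntegral_iff.1 h3
      have h4 : (unifAt p.1)⁻¹ ∈ p.1 := by rw [← hz]; exact z.2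
      rw [← p.mem_ordGE_zero, p.mem_ordGE_of_ne (inv_ne_zero p.unifAt_spec.1), p.ord_inv,
        p.ord_unifAt] at h4
      omega
  obtain ⟨Q, hQ, hQw⟩ := hw
  have hQ0 : Q.reverse.coeff 0 = 1 := by
    rw [Polynomial.coeff_zero_reverse, hQ.leadingCoeff]
  have hQu : Polynomial.aeval u Q.reverse = 0 := by
    let _ := invertibleOfNonzero (inv_ne_zero hu0)
    have := (Polynomial.eval₂_reverse_eq_zero_iff (algebraMap p.1 L) u⁻¹ Q).2 hQw
    rwa [invOf_eq_inv, inv_inv] at this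
  have hdvd : minpoly p.1 y ∣ Q.reverse.comp (Polynomial.X - Polynomial.C (p.constIn c)) := by
    refine minpoly.isIntegrallyClosed_dvd (isIntegral_of_forall_over p y hy) ?_
    rw [Polynomial.aeval_comp, map_sub, Polynomial.aeval_X, Polynomial.aeval_C]
    have : algebraMap p.1 L (p.constIn c) = algebraMap k L c := by
      rw [IsScalarTower.algebraMap_apply k F L]; rfl
    rw [this]; exact hQu
  have h1 := Polynomial.map_dvd p.residueHom hdvd
  have h2 := hc.dvd h1
  have h3 := Polynomial.eval₂_at_apply (p := Q.reverse.comp (Polynomial.X -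
    Polynomial.C (p.constIn c))) p.residueHom (p.constIn c)
  rw [p.residueHom_constIn] at h3
  rw [Polynomial.IsRoot, Polynomial.eval_map, h3,
    Polynomial.eval_comp, Polynomial.eval_sub, Polynomial.eval_X, Polynomial.eval_C, sub_self,
    ← Polynomial.coeff_zero_eq_eval_zero, hQ0, map_one] at h2
  exact one_ne_zero h2

theorem residueHom_trace (p : FFPlace k F) {y : L}
    (hy : ∀ A : FFPlace k L, A.restrict F = p → y ∈ A.1) :
    ∃ r : ℕ, 0 < r ∧ Algebra.trace F L y - algebraMap k F
      (r * ((minpoly p.1 y).map p.residueHom).roots.sum) ∈ p.ordGE 1 := by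
  have hint := isIntegral_of_forall_over p y hy
  have h1 := trace_eq_finrank_mul_minpoly_nextCoeff F y
  have hmon := (minpoly.monic hint).map p.residueHom
  rw [minpoly.isIntegrallyClosed_eq_field_fractions' F hint,
    Polynomial.nextCoeff_map (FaithfulSMul.algebraMap_injective p.1 F)] at h1
  refine ⟨_, Module.finrank_pos (R := IntermediateField.adjoin F {y}) (M := L), ?_⟩
  have h2 : ((minpoly p.1 y).map p.residueHom).roots.sum =
      p.residueHom (-(minpoly p.1 y).nextCoeff) := by
    have h3 :=
      (IsAlgClosed.splits ((minpoly p.1 y).map p.residueHom)).nextCoeff_eq_neg_sum_roots_of_monic hmon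
    have h4 : ((minpoly p.1 y).map p.residueHom).nextCoeff =
      p.residueHom (minpoly p.1 y).nextCoeff := by
      rw [Polynomial.nextCoeff, Polynomial.nextCoeff, (minpoly.monic hint).natDegree_map]
      split_ifs
      · simp
      · rw [Polynomial.coeff_map]
    rw [map_neg, ← h4, h3, neg_neg]
  rw [h1, h2, map_mul, map_natCast, ← mul_sub]
  have h5 := p.mul_mem_ordGE (p.const_mem (Module.finrank (IntermediateField.adjoin F {y}) L : k))
    (p.residueHom_spec (-(minpoly p.1 y).nextCoeff))
  rw [map_natCast, zero_add] at h5
  exact h5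

theorem trace_mem_ordGE_one (p : FFPlace k F) {y : L}
    (hy : ∀ A : FFPlace k L, A.restrict F = p → y ∈ A.ordGE 1) :
    Algebra.trace F L y ∈ p.ordGE 1 := by
  have hy0 : ∀ A : FFPlace k L, A.restrict F = p → y ∈ A.1 := fun A hA =>
    A.mem_ordGE_zero.1 (A.ordGE_anti zero_le_one (hy A hA))
  obtain ⟨r, -, h⟩ := residueHom_trace p hy0
  have h0 : ((minpoly p.1 y).map p.residueHom).roots.sum = 0 := by
    refine Multiset.sum_eq_zero fun c hc => ?_
    obtain ⟨A, hA, h1⟩ := exists_place_of_isRoot p hy0 (Polynomial.isRoot_of_mem_roots hc)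
    exact (A.residue_unique (c := 0) (by simpa using hy A hA) h1).symm
  rwa [h0, mul_zero, map_zero, sub_zero] at h

theorem trace_notMem_ordGE_one [CharZero k] (p : FFPlace k F) {y : L} (A₀ : FFPlace k L)
    (hA₀ : A₀.restrict F = p) (hy₀ : y - 1 ∈ A₀.ordGE 1)
    (hy : ∀ A : FFPlace k L, A.restrict F = p → A ≠ A₀ → y ∈ A.ordGE 1) :
    Algebra.trace F L y ∉ p.ordGE 1 := by
  have hy0 : ∀ A : FFPlace k L, A.restrict F = p → y ∈ A.1 := fun A hA => by
    by_cases h : A = A₀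
    · subst h
      have := add_mem (A.mem_ordGE_zero.1 (A.ordGE_anti zero_le_one hy₀)) (one_mem A.1)
      rwa [sub_add_cancel] at this
    · exact A.mem_ordGE_zero.1 (A.ordGE_anti zero_le_one (hy A hA h))
  have hint := isIntegral_of_forall_over p y hy0
  obtain ⟨r, hr, h⟩ := residueHom_trace p hy0
  intro hcon
  have h1 : (r * ((minpoly p.1 y).map p.residueHom).roots.sum : k) = 0 := by
    have := sub_mem hcon h
    rw [sub_sub_cancel] at this
    exact p.const_mem_ordGE_one this
  have h2 : ((minpoly p.1 y).map p.residueHom).roots.sum = 0 :=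
    (mul_eq_zero.1 h1).resolve_left (by exact_mod_cast hr.ne')
  have hroots : ∀ c ∈ ((minpoly p.1 y).map p.residueHom).roots, c ≠ 0 → c = 1 := by
    intro c hc hc0
    obtain ⟨A, hA, h3⟩ := exists_place_of_isRoot p hy0 (Polynomial.isRoot_of_mem_roots hc)
    by_cases hA0 : A = A₀
    · subst hA0
      exact A.residue_unique h3 (by simpa using hy₀)
    · exact absurd (A.residue_unique h3 (by simpa using hy A hA hA0)) hc0
  have h3 : ((minpoly p.1 y).map p.residueHom).roots.sum =
      (((minpoly p.1 y).map p.residueHom).roots.count 1 : k) := by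
    generalize ((minpoly p.1 y).map p.residueHom).roots = m at hroots
    induction m using Multiset.induction_on with
    | empty => simp
    | cons a m ih =>
      rw [Multiset.sum_cons, ih fun c hc => hroots c (Multiset.mem_cons_of_mem hc),
        Multiset.count_cons]
      by_cases ha : a = 0
      · subst ha; simp
      · rw [hroots a (Multiset.mem_cons_self a m) ha]; simp [add_comm]
  rw [h3, Nat.cast_eq_zero, Multiset.count_eq_zero] at h2
  apply h2
  rw [Polynomial.mem_roots ((minpoly.monic hint).map _).ne_zero, Polynomial.IsRoot,
    Polynomial.eval_map, ← p.residueHom.map_one, Polynomial.eval₂_at_apply,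
    p.residueHom_eq_zero_iff]
  subst hA₀
  rw [mem_restrict_ordGE_one]
  have h5 : algebraMap (A₀.restrict F).1 L ((minpoly (A₀.restrict F).1 y).eval 1) ∈ A₀.ordGE 1 := by
    let f : (A₀.restrict F).1 →+* A₀.1 :=
      ((algebraMap F L).comp (A₀.restrict F).1.subtype).codRestrict A₀.1.toSubring fun x => x.2
    have h6 : A₀.residueHom ⟨y, hy0 A₀ rfl⟩ = 1 := A₀.residueHom_eq (by simpa using hy₀)
    have h7 : ((minpoly (A₀.restrict F).1 y).map f).eval ⟨y, hy0 A₀ rfl⟩ = 0 := by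
      apply Subtype.ext
      have h8 := minpoly.aeval (A₀.restrict F).1 y
      have h9 := Polynomial.hom_eval₂ (minpoly (A₀.restrict F).1 y) f A₀.1.subtype ⟨y, hy0 A₀ rfl⟩
      rw [Polynomial.eval_map]
      exact h9.trans h8
    have h10 : A₀.residueHom (f ((minpoly (A₀.restrict F).1 y).eval 1)) = 0 := by
      rw [← Polynomial.eval₂_at_one, ← Polynomial.eval_map, ← Polynomial.eval₂_at_one, ← h6,
        Polynomial.eval₂_at_apply, h7, map_zero]
    exact A₀.residueHom_eq_zero_iff.1 h10
  exact h5

end FFPlace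

end ReducedTrace

section WeakApproximation

variable {k L : Type} [Field k] [Field L] [Algebra k L]
variable [IsAlgClosed k] [Algebra (RatFunc k) L] [IsScalarTower k (RatFunc k) L]
  [FiniteDimensional (RatFunc k) L]

namespace FFPlace

theorem one_add_of_pos (A : FFPlace k L) {x : L} (h : x ∈ A.ordGE 1) :
    1 + x ≠ 0 ∧ A.ord (1 + x) = 0 := by
  have := A.ord_add_eq_of_lt (z := 1) (w := x) one_ne_zero (by rwa [A.ord_one, zero_add])
  rwa [A.ord_one] at this

theorem one_add_of_neg (A : FFPlace k L) {x : L} (hx : x ≠ 0) (h : A.ord x < 0) :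
    1 + x ≠ 0 ∧ A.ord (1 + x) = A.ord x := by
  rw [add_comm]
  refine A.ord_add_eq_of_lt hx (A.mem_ordGE.2 fun _ => ?_)
  rw [A.ord_one]; omega

theorem exists_separating_pair {A B : FFPlace k L} (h : A ≠ B) :
    ∃ z : L, z ≠ 0 ∧ A.ord z < 0 ∧ 0 < B.ord z := by
  obtain ⟨x, hxB, hxA⟩ := exists_notMem h.symm
  obtain ⟨w, hwA, hwB⟩ := exists_notMem h
  rw [← mem_ordGE_zero] at hxB hxA hwA hwB
  have hx0 := A.ne_zero_of_notMem hxA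
  have hw0 := B.ne_zero_of_notMem hwB
  have h1 := A.ord_lt_of_notMem hxA
  have h2 := B.ord_lt_of_notMem hwB
  rw [mem_ordGE_of_ne _ hx0] at hxB
  rw [mem_ordGE_of_ne _ hw0] at hwA
  refine ⟨x * w⁻¹, mul_ne_zero hx0 (inv_ne_zero hw0), ?_, ?_⟩ <;>
    rw [ord_mul _ hx0 (inv_ne_zero hw0), ord_inv] <;> omega

theorem exists_separating (A : FFPlace k L) (S : Finset (FFPlace k L)) (hA : A ∉ S) :
    ∃ z : L, z ≠ 0 ∧ A.ord z < 0 ∧ ∀ B ∈ S, 0 < B.ord z := by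
  induction S using Finset.induction_on with
  | empty =>
    refine ⟨(unifAt A.1)⁻¹, inv_ne_zero A.unifAt_spec.1, ?_, by simp⟩
    rw [ord_inv, ord_unifAt]; omega
  | insert C S hC ih =>
    rw [Finset.mem_insert, not_or] at hA
    obtain ⟨z, hz0, hzA, hzS⟩ := ih hA.2
    obtain ⟨w, hw0, hwA, hwC⟩ := exists_separating_pair hA.1
    have key : ∃ z : L, z ≠ 0 ∧ A.ord z ≤ 0 ∧ 0 ≤ C.ord z ∧ ∀ B ∈ S, 0 < B.ord z := by
      by_cases hzC : 0 ≤ C.ord z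
      · exact ⟨z, hz0, hzA.le, hzC, hzS⟩
      push Not at hzC
      obtain ⟨h1, h2⟩ := A.one_add_of_neg hz0 hzA
      obtain ⟨-, h3⟩ := C.one_add_of_neg hz0 hzC
      refine ⟨z * (1 + z)⁻¹, mul_ne_zero hz0 (inv_ne_zero h1), ?_, ?_, fun B hB => ?_⟩
      · rw [ord_mul _ hz0 (inv_ne_zero h1), ord_inv, h2, add_neg_cancel]
      · rw [ord_mul _ hz0 (inv_ne_zero h1), ord_inv, h3, add_neg_cancel]
      · rw [ord_mul _ hz0 (inv_ne_zero h1), ord_inv,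
          (B.one_add_of_pos ((B.mem_ordGE_of_ne hz0).2 (hzS B hB))).2]
        have := hzS B hB; omega
    obtain ⟨y, hy0, hyA, hyC, hyS⟩ := key
    set r := ∑ B ∈ S, (B.ord w).natAbs + 1 with hr
    refine ⟨y ^ r * w, mul_ne_zero (pow_ne_zero _ hy0) hw0, ?_, fun B hB => ?_⟩
    · rw [ord_mul _ (pow_ne_zero _ hy0) hw0, ord_pow]
      nlinarith
    · rw [ord_mul _ (pow_ne_zero _ hy0) hw0, ord_pow]
      rcases Finset.mem_insert.1 hB with rfl | hB
      · nlinarith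
      · have h1 : (B.ord w).natAbs < r := by
          have := Finset.single_le_sum (f := fun B : FFPlace k L => (B.ord w).natAbs)
            (fun _ _ => Nat.zero_le _) hB
          omega
        have h2 := hyS B hB
        have h3 : -((B.ord w).natAbs : ℤ) ≤ B.ord w := by omega
        have h4 : ((B.ord w).natAbs : ℤ) < r := by exact_mod_cast h1
        nlinarith

theorem exists_approx_one (A : FFPlace k L) (S : Finset (FFPlace k L)) (hA : A ∉ S) (M : ℕ) :
    ∃ y : L, y - 1 ∈ A.ordGE M ∧ ∀ B ∈ S, y ∈ B.ordGE M := by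
  obtain ⟨z, hz0, hzA, hzS⟩ := A.exists_separating S hA
  have hzM : z ^ (M + 1) ≠ 0 := pow_ne_zero _ hz0
  have hMA : A.ord (z ^ (M + 1)) ≤ -(M + 1) := by
    rw [ord_pow]; push_cast; nlinarith
  obtain ⟨h1, h2⟩ := A.one_add_of_neg hzM (by omega)
  refine ⟨z ^ (M + 1) * (1 + z ^ (M + 1))⁻¹, ?_, fun B hB => ?_⟩
  · have e : z ^ (M + 1) * (1 + z ^ (M + 1))⁻¹ - 1 = -(1 + z ^ (M + 1))⁻¹ := by
      field_simp; ring
    rw [e, neg_mem_iff, mem_ordGE_of_ne _ (inv_ne_zero h1), ord_inv, h2]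
    omega
  · have hMB : (M + 1 : ℤ) ≤ B.ord (z ^ (M + 1)) := by
      have := hzS B hB
      rw [ord_pow]; push_cast; nlinarith
    have h3 := (B.one_add_of_pos ((B.mem_ordGE_of_ne hzM).2 (by omega))).2
    rw [mem_ordGE_of_ne _ (mul_ne_zero hzM (inv_ne_zero h1)), ord_mul _ hzM (inv_ne_zero h1),
      ord_inv, h3]
    omega

/-- Weak approximation: an element of prescribed order at one place and large order at finitely
many others. -/
theorem exists_ord_eq (A : FFPlace k L) (S : Finset (FFPlace k L)) (hA : A ∉ S) (m M : ℤ) :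
    ∃ y : L, y ≠ 0 ∧ A.ord y = m ∧ ∀ B ∈ S, y ∈ B.ordGE M := by
  have hπ : unifAt A.1 ^ m ≠ 0 := zpow_ne_zero _ A.unifAt_spec.1
  obtain ⟨w, hwA, hwS⟩ := A.exists_approx_one S hA
    (∑ B ∈ S, (M - B.ord (unifAt A.1 ^ m)).natAbs + 1)
  obtain ⟨hw0, hw⟩ := A.one_add_of_pos (A.ordGE_anti (by rw [Nat.cast_add_one]; omega) hwA)
  rw [add_sub_cancel] at hw0 hw
  refine ⟨w * unifAt A.1 ^ m, mul_ne_zero hw0 hπ, ?_, fun B hB => ?_⟩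
  · rw [ord_mul _ hw0 hπ, hw, ord_zpow _ _ _ A.unifAt_spec.1, ord_unifAt]; ring
  · rw [mul_mem_ordGE_iff _ hπ]
    refine B.ordGE_anti ?_ (hwS B hB)
    have := Finset.single_le_sum (f := fun B : FFPlace k L => (M - B.ord (unifAt A.1 ^ m)).natAbs)
            (fun _ _ => Nat.zero_le _) hB
    omega

end FFPlace

end WeakApproximation

section Fibre

variable {k L F : Type} [Field k] [Field F] [Field L] [Algebra k F] [Algebra k L]
  [Algebra F L] [IsScalarTower k F L] [FiniteDimensional F L]
variable [IsAlgClosed k] [Algebra (RatFunc k) F] [IsScalarTower k (RatFunc k) F]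
  [FiniteDimensional (RatFunc k) F] [Algebra (RatFunc k) L] [IsScalarTower k (RatFunc k) L]
  [FiniteDimensional (RatFunc k) L]

namespace FFPlace

theorem mul_mem_ordGE_of {A : FFPlace k L} {z w : L} {m m' r : ℤ} (hz : z ∈ A.ordGE m)
    (hw : w ∈ A.ordGE m') (h : r ≤ m + m') : z * w ∈ A.ordGE r :=
  A.ordGE_anti h (A.mul_mem_ordGE hz hw)

theorem algebraMap_mem_ordGE_zero {A : FFPlace k L} {x : F}
    (h : x ∈ (A.restrict F).ordGE 0) : algebraMap F L x ∈ A.ordGE 0 := by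
  have := algebraMap_mem_ordGE h
  rwa [mul_zero] at this

theorem sum_ramIdx_le (p : FFPlace k F) (T : Finset (FFPlace k L))
    (hT : ∀ A ∈ T, A.restrict F = p) :
    ∑ A ∈ T, A.ramIdx F ≤ Module.finrank F L := by
  set M : ℤ := ∑ A ∈ T, (A.ramIdx F : ℤ) with hM
  have hMA : ∀ A ∈ T, (A.ramIdx F : ℤ) ≤ M := fun A hA =>
    Finset.single_le_sum (f := fun A : FFPlace k L => (A.ramIdx F : ℤ))
      (fun _ _ => Int.natCast_nonneg _) hA
  have hy : ∀ i : (Σ A : T, Fin (A.1.ramIdx F)), ∃ y : L, y ≠ 0 ∧ i.1.1.ord y = (i.2.1 : ℤ) ∧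
      ∀ B ∈ T.erase i.1.1, y ∈ B.ordGE M := fun i =>
    i.1.1.exists_ord_eq (T.erase i.1.1) (by simp) _ M
  choose y hy0 hyA hyB using hy
  have hind : LinearIndependent F y := by
    rw [Fintype.linearIndependent_iff]
    intro g hg
    by_contra! hne
    obtain ⟨i0, hi0⟩ := hne
    obtain ⟨q, hq, c, hc, i1, -, hi1⟩ := p.exists_scaling (F := F) (L := F)
      (fun q hq => p.exists_residue hq) Finset.univ g ⟨i0, Finset.mem_univ _, hi0⟩
    obtain ⟨i, hi, hmin⟩ := Finset.exists_min_image
      (Finset.univ.filter fun i => c i ≠ 0) (fun i => i.2.1) ⟨i1, by simpa using hi1⟩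
    have hci : c i ≠ 0 := by simpa using hi
    set A := i.1.1 with hA
    have hAT : A ∈ T := i.1.2
    have hAp := hT A hAT
    have hd : ∀ i', algebraMap F L (g i' * q) - algebraMap k L (c i') ∈ A.ordGE (A.ramIdx F) := by
      intro i'
      have h1 := hc i' (Finset.mem_univ _)
      rw [← hAp] at h1
      have h2 := algebraMap_mem_ordGE h1
      rw [mul_one, map_sub, ← IsScalarTower.algebraMap_apply k F L] at h2
      exact h2
    have hyM : ∀ i', i'.1.1 ≠ A → y i' ∈ A.ordGE M := fun i' h =>
      hyB i' A (Finset.mem_erase.2 ⟨h.symm, hAT⟩)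
    have hy0' : ∀ i', y i' ∈ A.ordGE 0 := by
      intro i'
      by_cases h : i'.1.1 = A
      · rw [A.mem_ordGE_of_ne (hy0 i'), ← h, hyA]; positivity
      · exact A.ordGE_anti ((Int.natCast_nonneg _).trans (hMA A hAT)) (hyM i' h)
    have hje : (i.2.1 : ℤ) + 1 ≤ A.ramIdx F := by exact_mod_cast i.2.2
    have hz0 : algebraMap k L (c i) * y i ≠ 0 :=
      mul_ne_zero (by simpa using hci) (hy0 i)
    have hzord : A.ord (algebraMap k L (c i) * y i) = i.2.1 := by
      rw [A.ord_mul (by simpa using hci) (hy0 i), A.ord_const, hyA, zero_add]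
    have hrest : ∀ i' ≠ i, algebraMap k L (c i') * y i' ∈ A.ordGE ((i.2.1 : ℤ) + 1) := by
      intro i' hne
      by_cases hci' : c i' = 0
      · simp [hci']
      by_cases h : i'.1.1 = A
      · rw [A.mem_ordGE_of_ne (mul_ne_zero (by simpa using hci') (hy0 i')),
          A.ord_mul (by simpa using hci') (hy0 i'), A.ord_const, ← h, hyA, zero_add]
        have h1 := hmin i' (by simpa using hci')
        have h2 : i'.2.1 ≠ i.2.1 := by
          intro h2
          apply hne
          obtain ⟨⟨B, hB⟩, j⟩ := i
          obtain ⟨⟨B', hB'⟩, j'⟩ := i'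
          obtain rfl : B' = B := h
          obtain rfl : j' = j := Fin.ext h2
          rfl
        omega
      · exact mul_mem_ordGE_of (A.const_mem _) (hyM i' h) (by have := hMA A hAT; omega)
    have hsum : algebraMap k L (c i) * y i + (∑ i', (algebraMap F L (g i' * q) -
        algebraMap k L (c i')) * y i' + ∑ i' ∈ Finset.univ.erase i, algebraMap k L (c i') * y i')
        = 0 := by
      have h1 := Finset.add_sum_erase Finset.univ (fun i' => algebraMap k L (c i') * y i')
        (Finset.mem_univ i)
      have h2 : ∑ i', algebraMap F L (g i' * q) * y i' = 0 := by
        rw [← mul_zero (algebraMap F L q), ← hg, Finset.mul_sum]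
        refine Finset.sum_congr rfl fun i _ => ?_
        rw [map_mul, Algebra.smul_def]; ring
      rw [add_left_comm, h1, ← Finset.sum_add_distrib, ← h2]
      refine Finset.sum_congr rfl fun i _ => by ring
    have := A.ord_add_eq_of_lt hz0 (w := ∑ i', (algebraMap F L (g i' * q) -
        algebraMap k L (c i')) * y i' + ∑ i' ∈ Finset.univ.erase i, algebraMap k L (c i') * y i')
      (by
        rw [hzord]
        exact add_mem (sum_mem fun i' _ => mul_mem_ordGE_of (hd i') (hy0' i') (by omega))
          (sum_mem fun i' h => hrest i' (Finset.mem_erase.1 h).1))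
    exact this.1 hsum
  have h := hind.fintype_card_le_finrank
  rw [Fintype.card_sigma] at h
  simp only [Fintype.card_fin] at h
  rwa [Finset.sum_coe_sort T (fun A => A.ramIdx F)] at h

theorem finite_fiber (p : FFPlace k F) : {A : FFPlace k L | A.restrict F = p}.Finite := by
  by_contra hinf
  obtain ⟨T, hT, hcard⟩ := Set.Infinite.exists_subset_card_eq hinf (Module.finrank F L + 1)
  have h1 := sum_ramIdx_le p T fun A hA => hT hA
  have h2 : T.card ≤ ∑ A ∈ T, A.ramIdx F := by
    rw [Finset.card_eq_sum_ones]
    exact Finset.sum_le_sum fun A _ => one_le_ramIdx A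
  omega

variable (L) in
/-- The places above a given place. -/
def fiber (p : FFPlace k F) : Finset (FFPlace k L) := (finite_fiber p).toFinset

@[simp] theorem mem_fiber {p : FFPlace k F} {A : FFPlace k L} :
    A ∈ p.fiber L ↔ A.restrict F = p := by simp [fiber]

end FFPlace

end Fibre

section IntegralBasis

theorem exists_integral_basis (R F L : Type) [CommRing R] [IsDomain R] [IsPrincipalIdealRing R]
    [Field F] [Algebra R F] [IsFractionRing R F] [Field L] [Algebra F L] [Algebra R L]
    [IsScalarTower R F L] [FiniteDimensional F L] [CharZero F] :
    ∃ b : Module.Basis (Fin (Module.finrank F L)) F L, ∀ z : L,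
      IsIntegral R z ↔ ∀ i, ∃ r : R, algebraMap R F r = b.repr z i := by
  let C := integralClosure R L
  have : Module.IsTorsionFree R L := Module.IsTorsionFree.trans_faithfulSMul R F L
  have : Module.Free R C := IsIntegralClosure.module_free R F L C
  have : IsNoetherian R C := IsIntegralClosure.isNoetherian R F L C
  have hrank := IsIntegralClosure.rank R F L C
  have : IsLocalization (Algebra.algebraMapSubmonoid C (nonZeroDivisors R)) L :=
    IsIntegralClosure.isLocalization R F L C
  let b0 : Module.Basis (Fin (Module.finrank F L)) R C :=
    (Module.finBasis R C).reindex (finCongr hrank)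
  refine ⟨b0.localizationLocalization F (nonZeroDivisors R) L,
    fun z => ⟨fun hz i => ?_, fun h => ?_⟩⟩
  · have := b0.localizationLocalization_repr_algebraMap F (nonZeroDivisors R) L ⟨z, hz⟩ i
    exact ⟨_, this.symm⟩
  · choose r hr using h
    rw [← (b0.localizationLocalization F (nonZeroDivisors R) L).sum_repr z]
    refine IsIntegral.sum _ fun i _ => ?_
    rw [← hr, algebraMap_smul, b0.localizationLocalization_apply F (nonZeroDivisors R) L]
    exact (b0 i).2.smul _

end IntegralBasis

section PID

variable {k L : Type} [Field k] [Field L] [Algebra k L]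
variable [IsAlgClosed k] [Algebra (RatFunc k) L] [IsScalarTower k (RatFunc k) L]
  [FiniteDimensional (RatFunc k) L]

instance FFPlace.isPrincipalIdealRing (A : FFPlace k L) : IsPrincipalIdealRing A.1 := by
  refine ⟨fun I => ?_⟩
  by_cases hI : I = ⊥
  · subst hI; exact ⟨0, by simp⟩
  obtain ⟨x, ⟨hxI, hx0⟩, hmin⟩ := WellFounded.has_min
    (InvImage.wf (fun x : A.1 => (A.ord (x : L)).toNat) wellFounded_lt)
    {x : A.1 | x ∈ I ∧ x ≠ 0} (Submodule.exists_mem_ne_zero_of_ne_bot hI)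
  refine ⟨x, le_antisymm (fun y hy => ?_) ((Ideal.span_singleton_le_iff_mem _).2 hxI)⟩
  by_cases hy0 : y = 0
  · rw [hy0]; exact zero_mem _
  have h1 := hmin y ⟨hy, hy0⟩
  have hx0' : (x : L) ≠ 0 := by simpa using hx0
  have hy0' : (y : L) ≠ 0 := by simpa using hy0
  have h2 := (A.mem_ordGE_of_ne hx0').1 (A.mem_ordGE_zero.2 x.2)
  have h3 := (A.mem_ordGE_of_ne hy0').1 (A.mem_ordGE_zero.2 y.2)
  have h4 : (y : L) * (x : L)⁻¹ ∈ A.1 := by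
    rw [← A.mem_ordGE_zero, A.mem_ordGE_of_ne (mul_ne_zero hy0' (inv_ne_zero hx0')),
      A.ord_mul hy0' (inv_ne_zero hx0'), A.ord_inv]
    change ¬ (A.ord (y : L)).toNat < (A.ord (x : L)).toNat at h1
    omega
  refine Ideal.mem_span_singleton'.2 ⟨⟨_, h4⟩, Subtype.ext ?_⟩
  change (y : L) * (x : L)⁻¹ * (x : L) = y
  field_simp

end PID

section FundamentalIdentity

variable {k L F : Type} [Field k] [Field F] [Field L] [Algebra k F] [Algebra k L]
  [Algebra F L] [IsScalarTower k F L] [FiniteDimensional F L]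
variable [IsAlgClosed k] [Algebra (RatFunc k) F] [IsScalarTower k (RatFunc k) F]
  [FiniteDimensional (RatFunc k) F] [Algebra (RatFunc k) L] [IsScalarTower k (RatFunc k) L]
  [FiniteDimensional (RatFunc k) L] [CharZero k]

namespace FFPlace

/-- The fundamental identity `∑ e = [L : F]`. -/
theorem sum_ramIdx (p : FFPlace k F) :
    ∑ A ∈ p.fiber L, A.ramIdx F = Module.finrank F L := by
  refine le_antisymm (sum_ramIdx_le p _ fun A hA => mem_fiber.1 hA) ?_
  have : CharZero F := charZero_of_injective_algebraMap (algebraMap k F).injective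
  obtain ⟨b, hb⟩ := exists_integral_basis p.1 F L
  have hbi : ∀ i, IsIntegral p.1 (b i) := fun i => (hb _).2 fun j => by
    rw [b.repr_self, Finsupp.single_apply]
    split_ifs
    exacts [⟨1, map_one _⟩, ⟨0, map_zero _⟩]
  set W := Submodule.span k (Set.range b) with hW
  have hfin : Module.finrank k W = Module.finrank F L := by
    have : LinearIndependent k b := b.linearIndependent.restrict_scalars (by
      intro x y h
      simpa [Algebra.smul_def] using h)
    rw [hW, finrank_span_eq_card this, Fintype.card_fin]
  have hWle : ∀ A ∈ p.fiber L, W ≤ A.ordGE 0 := by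
    intro A hA
    rw [hW, Submodule.span_le]
    rintro _ ⟨i, rfl⟩
    exact A.mem_ordGE_zero.2 (mem_of_isIntegral (hbi i) (mem_fiber.1 hA))
  have hbot : (W ⊓ ⨅ A ∈ p.fiber L, A.ordGE (0 + A.ramIdx F) : Submodule k L) = ⊥ := by
    rw [eq_bot_iff]
    rintro z ⟨hzW, hz⟩
    have hz' : ∀ A : FFPlace k L, A.restrict F = p → z ∈ A.ordGE (A.ramIdx F) := by
      intro A hA
      have := (Submodule.mem_iInf _).1 ((Submodule.mem_iInf _).1 hz A) (mem_fiber.2 hA)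
      rwa [zero_add] at this
    obtain ⟨c, rfl⟩ := (Submodule.mem_span_range_iff_exists_fun k).1 hzW
    have hπ : unifAt p.1 ≠ 0 := p.unifAt_spec.1
    have hint : IsIntegral p.1 ((unifAt p.1)⁻¹ • ∑ i, c i • b i) := by
      refine isIntegral_of_forall_over p _ fun A hA => ?_
      rw [← A.mem_ordGE_zero, Algebra.smul_def, mul_comm, A.mul_mem_ordGE_iff (by simpa using hπ),
        ord_algebraMap, hA, ord_inv, ord_unifAt]
      have := hz' A hA
      convert this using 2
      ring
    have hc : ∀ i, c i = 0 := by
      intro i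
      obtain ⟨r, hr⟩ := (hb _).1 hint i
      have e : b.repr ((unifAt p.1)⁻¹ • ∑ i, c i • b i) i =
          (unifAt p.1)⁻¹ * algebraMap k F (c i) := by
        rw [map_smul, Finsupp.smul_apply, smul_eq_mul]
        congr 1
        have : ∑ i, c i • b i = ∑ i, (algebraMap k F (c i)) • b i :=
          Finset.sum_congr rfl fun i _ => by rw [algebraMap_smul]
        rw [this, b.repr_sum_self]
      rw [e] at hr
      refine p.const_mem_ordGE_one ?_
      have : algebraMap k F (c i) = r * unifAt p.1 := by
        change (r : F) = _ at hr
        rw [hr]; field_simp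
      rw [this]
      refine p.ordGE_anti ?_ (p.mul_mem_ordGE (p.mem_ordGE_zero.2 r.2) (p.self_mem_ordGE))
      rw [ord_unifAt, zero_add]
    simp [hc]
  have := (finrank_le_inf_iInf_ordGE (p.fiber L) (fun _ => 0) (fun A => A.ramIdx F) hWle (by
    rw [hbot]; infer_instance)).2
  rw [hbot, finrank_bot, hfin, zero_add] at this
  exact this

theorem exists_mem_fiber (p : FFPlace k F) : ∃ A : FFPlace k L, A.restrict F = p := by
  by_contra! h
  have h1 := sum_ramIdx (L := L) p
  have : p.fiber L = ∅ := Finset.eq_empty_of_forall_notMem fun A hA => h A (mem_fiber.1 hA)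
  rw [this, Finset.sum_empty] at h1
  exact (Module.finrank_pos (R := F) (M := L)).ne h1

end FFPlace

end FundamentalIdentity

section RationalPlaces

variable {k : Type} [Field k] [IsAlgClosed k]

namespace FFPlace

theorem ratFunc_X_sub_C_ne_zero (a : k) : (RatFunc.X - RatFunc.C a : RatFunc k) ≠ 0 := by
  have := Polynomial.X_sub_C_ne_zero a
  rw [← (RatFunc.algebraMap_injective k).ne_iff] at this
  simpa using this

theorem exists_unit_ord_ratFunc (p : FFPlace k (RatFunc k)) {e : ℤ}
    (h : ∀ b, e ∣ p.ord (RatFunc.X - RatFunc.C b)) : IsUnit e := by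
  have key : ∀ q : RatFunc k, q ≠ 0 → (q ≠ 0 ∧ e ∣ p.ord q) := fun q hq =>
    ratFunc_induction_linear (P := fun q => q ≠ 0 ∧ e ∣ p.ord q)
      (fun c hc => ⟨by simpa using hc, by
        rw [← RatFunc.algebraMap_eq_C, p.ord_const]; exact dvd_zero _⟩)
      (fun b => ⟨ratFunc_X_sub_C_ne_zero b, h b⟩)
      (fun x y hx hy => ⟨mul_ne_zero hx.1 hy.1, by
        rw [p.ord_mul hx.1 hy.1]; exact dvd_add hx.2 hy.2⟩)
      (fun x hx => ⟨inv_ne_zero hx.1, by rw [p.ord_inv]; exact (dvd_neg).2 hx.2⟩) hq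
  have := (key _ p.unifAt_spec.1).2
  rw [ord_unifAt] at this
  exact isUnit_of_dvd_one this

theorem ratFunc_cases (p : FFPlace k (RatFunc k)) :
    (RatFunc.X : RatFunc k) ∉ p.1 ∨ ∃ a, RatFunc.X - RatFunc.C a ∈ p.ordGE 1 := by
  by_cases h : (RatFunc.X : RatFunc k) ∈ p.1
  · right
    rw [← mem_ordGE_zero] at h
    obtain ⟨a, ha⟩ := p.exists_residue h
    exact ⟨a, by rwa [RatFunc.algebraMap_eq_C] at ha⟩
  · exact Or.inl h

theorem ord_X_sub_C_of_finite (p : FFPlace k (RatFunc k)) {a : k}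
    (h : RatFunc.X - RatFunc.C a ∈ p.ordGE 1) (b : k) :
    p.ord (RatFunc.X - RatFunc.C b) = if b = a then 1 else 0 := by
  have h0 : ∀ b, b ≠ a → p.ord (RatFunc.X - RatFunc.C b) = 0 := by
    intro b hb
    have hc : algebraMap k (RatFunc k) (a - b) ≠ 0 :=
      (map_ne_zero _).2 (sub_ne_zero.2 hb.symm)
    have := (p.ord_add_eq_of_lt hc (w := RatFunc.X - RatFunc.C a)
      (by rw [p.ord_const, zero_add]; exact h)).2
    rw [p.ord_const, RatFunc.algebraMap_eq_C, map_sub] at this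
    rw [← this]
    congr 1
    ring
  have h1 : 1 ≤ p.ord (RatFunc.X - RatFunc.C a) :=
    (p.mem_ordGE_of_ne (ratFunc_X_sub_C_ne_zero a)).1 h
  split_ifs with hb
  · subst hb
    have := p.exists_unit_ord_ratFunc (e := p.ord (RatFunc.X - RatFunc.C b)) fun b' => by
      by_cases hb' : b' = b
      · rw [hb']
      · rw [h0 b' hb']; exact dvd_zero _
    rcases Int.isUnit_iff.1 this with h | h <;> omega
  · exact h0 b hb

theorem ord_X_sub_C_of_infinite (p : FFPlace k (RatFunc k)) (h : (RatFunc.X : RatFunc k) ∉ p.1)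
    (b : k) : p.ord (RatFunc.X - RatFunc.C b) = -1 := by
  rw [← p.mem_ordGE_zero] at h
  have hX := p.ne_zero_of_notMem h
  have h1 := p.ord_lt_of_notMem h
  have h0 : ∀ b, p.ord (RatFunc.X - RatFunc.C b) = p.ord RatFunc.X := by
    intro b
    rw [sub_eq_add_neg, ← map_neg, ← RatFunc.algebraMap_eq_C]
    exact (p.ord_add_eq_of_lt hX (p.ordGE_anti (by omega) (p.const_mem _))).2
  rw [h0]
  have := p.exists_unit_ord_ratFunc (e := p.ord RatFunc.X) fun b => by rw [h0]
  rcases Int.isUnit_iff.1 this with h | h <;> omega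

theorem ratFunc_ext {p p' : FFPlace k (RatFunc k)}
    (h : ∀ b, p.ord (RatFunc.X - RatFunc.C b) = p'.ord (RatFunc.X - RatFunc.C b)) : p = p' := by
  have key : ∀ q : RatFunc k, q ≠ 0 → (q ≠ 0 ∧ p.ord q = p'.ord q) := fun q hq =>
    ratFunc_induction_linear (P := fun q => q ≠ 0 ∧ p.ord q = p'.ord q)
      (fun c hc => ⟨by simpa using hc, by
        rw [← RatFunc.algebraMap_eq_C, p.ord_const, p'.ord_const]⟩)
      (fun b => ⟨ratFunc_X_sub_C_ne_zero b, h b⟩)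
      (fun x y hx hy => ⟨mul_ne_zero hx.1 hy.1, by
        rw [p.ord_mul hx.1 hy.1, p'.ord_mul hx.1 hy.1, hx.2, hy.2]⟩)
      (fun x hx => ⟨inv_ne_zero hx.1, by rw [p.ord_inv, p'.ord_inv, hx.2]⟩) hq
  refine eq_of_forall_mem fun x hx => ?_
  rw [← mem_ordGE_zero, mem_ordGE] at hx ⊢
  intro hx0
  rw [← (key x hx0).2]
  exact hx hx0

theorem ratFunc_infinite_unique {p p' : FFPlace k (RatFunc k)}
    (h : (RatFunc.X : RatFunc k) ∉ p.1) (h' : (RatFunc.X : RatFunc k) ∉ p'.1) : p = p' :=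
  ratFunc_ext fun b => by rw [ord_X_sub_C_of_infinite p h, ord_X_sub_C_of_infinite p' h']

variable (k) in
theorem exists_ratFunc_infinite : ∃ p : FFPlace k (RatFunc k), (RatFunc.X : RatFunc k) ∉ p.1 := by
  by_contra! h
  obtain ⟨c, hc⟩ := exists_const_of_forall_place h
  apply ratFunc_X_sub_C_ne_zero c
  rw [hc, RatFunc.algebraMap_eq_C, sub_self]

variable (k) in
/-- The place at infinity of the projective line. -/
def infty : FFPlace k (RatFunc k) := (exists_ratFunc_infinite k).choose

variable (k) in
theorem X_notMem_infty : (RatFunc.X : RatFunc k) ∉ (infty k).1 :=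
  (exists_ratFunc_infinite k).choose_spec

theorem eq_infty_iff {p : FFPlace k (RatFunc k)} :
    p = infty k ↔ (RatFunc.X : RatFunc k) ∉ p.1 :=
  ⟨fun h => h ▸ X_notMem_infty k, fun h => ratFunc_infinite_unique h (X_notMem_infty k)⟩

theorem ord_infty_X_sub_C (b : k) : (infty k).ord (RatFunc.X - RatFunc.C b) = -1 :=
  ord_X_sub_C_of_infinite _ (X_notMem_infty k) b

theorem ord_infty_X : (infty k).ord (RatFunc.X : RatFunc k) = -1 := by
  have := ord_infty_X_sub_C (0 : k)
  rwa [map_zero, sub_zero] at this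

theorem ratFunc_finite_unique {p p' : FFPlace k (RatFunc k)} {a : k}
    (h : RatFunc.X - RatFunc.C a ∈ p.ordGE 1) (h' : RatFunc.X - RatFunc.C a ∈ p'.ordGE 1) :
    p = p' :=
  ratFunc_ext fun b => by rw [ord_X_sub_C_of_finite p h, ord_X_sub_C_of_finite p' h']

/-- The order of `t - a` at any place, when `p` is the place of `t - a`. -/
theorem ord_X_sub_C (p p' : FFPlace k (RatFunc k)) {a : k}
    (h : RatFunc.X - RatFunc.C a ∈ p.ordGE 1) :
    p'.ord (RatFunc.X - RatFunc.C a) =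
      (if p' = p then 1 else 0) - (if p' = infty k then 1 else 0) := by
  have hp : p ≠ infty k := by
    rintro rfl
    rw [mem_ordGE_of_ne _ (ratFunc_X_sub_C_ne_zero a), ord_infty_X_sub_C] at h
    omega
  rcases p'.ratFunc_cases with h' | ⟨a', h'⟩
  · rw [← eq_infty_iff] at h'
    subst h'
    rw [ord_infty_X_sub_C, if_neg hp.symm, if_pos rfl]; rfl
  · have hp' : p' ≠ infty k := by
      rintro rfl
      rw [mem_ordGE_of_ne _ (ratFunc_X_sub_C_ne_zero a'), ord_infty_X_sub_C] at h'
      omega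
    rw [if_neg hp', sub_zero, ord_X_sub_C_of_finite p' h']
    congr 1
    refine propext ⟨fun e => ?_, fun e => ?_⟩
    · subst e; exact ratFunc_finite_unique h' h
    · subst e
      by_contra hne
      have := ord_X_sub_C_of_finite p' h a'
      rw [ord_X_sub_C_of_finite p' h', if_pos rfl, if_neg (Ne.symm hne)] at this
      omega

end FFPlace

end RationalPlaces

section PullDivisor

variable {k L F : Type} [Field k] [Field F] [Field L] [Algebra k F] [Algebra k L]
  [Algebra F L] [IsScalarTower k F L] [FiniteDimensional F L]
variable [IsAlgClosed k] [Algebra (RatFunc k) F] [IsScalarTower k (RatFunc k) F]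
  [FiniteDimensional (RatFunc k) F] [Algebra (RatFunc k) L] [IsScalarTower k (RatFunc k) L]
  [FiniteDimensional (RatFunc k) L]

variable (L) in
/-- The pullback of a point, as a divisor. -/
def pullPoint (p : FFPlace k F) : FFPlace k L →₀ ℤ :=
  ∑ A ∈ p.fiber L, Finsupp.single A (A.ramIdx F : ℤ)

theorem pullPoint_apply (p : FFPlace k F) (A : FFPlace k L) :
    pullPoint L p A = if A.restrict F = p then (A.ramIdx F : ℤ) else 0 := by
  rw [pullPoint, Finsupp.finsetSum_apply]
  simp only [Finsupp.single_apply]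
  rw [Finset.sum_ite_eq']
  simp only [FFPlace.mem_fiber]

variable (L) in
/-- The pullback of a divisor. -/
def pullDiv (D : FFPlace k F →₀ ℤ) : FFPlace k L →₀ ℤ :=
  D.sum fun p n => n • pullPoint L p

theorem pullDiv_apply (D : FFPlace k F →₀ ℤ) (A : FFPlace k L) :
    pullDiv L D A = A.ramIdx F * D (A.restrict F) := by
  rw [pullDiv, Finsupp.sum, Finsupp.finsetSum_apply]
  simp only [Finsupp.smul_apply, pullPoint_apply, smul_eq_mul, mul_ite, mul_zero]
  rw [Finset.sum_ite_eq]
  split_ifs with h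
  · ring
  · rw [Finsupp.notMem_support_iff.1 h, mul_zero]

variable [CharZero k]

theorem divDeg_pullPoint (p : FFPlace k F) :
    divDeg (pullPoint L p) = Module.finrank F L := by
  rw [← FFPlace.sum_ramIdx p, divDeg_eq_sum _ (S := p.fiber L)]
  · push_cast
    refine Finset.sum_congr rfl fun A hA => ?_
    rw [pullPoint_apply, if_pos (FFPlace.mem_fiber.1 hA)]
  · intro A hA
    rw [Finsupp.mem_support_iff, pullPoint_apply] at hA
    rw [FFPlace.mem_fiber]
    by_contra h
    exact hA (if_neg h)

theorem divDeg_pullDiv (D : FFPlace k F →₀ ℤ) :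
    divDeg (pullDiv L D) = Module.finrank F L * divDeg D := by
  induction D using Finsupp.induction_linear with
  | zero => simp [pullDiv, divDeg]
  | add D D' h h' =>
    have : pullDiv L (D + D') = pullDiv L D + pullDiv L D' := by
      ext A
      rw [Finsupp.add_apply, pullDiv_apply, pullDiv_apply, pullDiv_apply, Finsupp.add_apply]
      ring
    rw [this, divDeg_add, divDeg_add, h, h']; ring
  | single p n =>
    have : pullDiv L (Finsupp.single p n) = n • pullPoint L p := by
      rw [pullDiv, Finsupp.sum_single_index (by simp)]
    rw [this, divDeg_zsmul, divDeg_pullPoint, divDeg_single]; ring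

end PullDivisor

section Polynomials

variable {k : Type} [Field k] [IsAlgClosed k]

namespace FFPlace

theorem ord_infty (q : RatFunc k) (hq : q ≠ 0) : (infty k).ord q = -q.intDegree :=
  (ratFunc_induction_linear (P := fun q => q ≠ 0 ∧ (infty k).ord q = -q.intDegree)
      (fun c hc => ⟨by simpa using hc, by
        rw [← RatFunc.algebraMap_eq_C, ord_const, RatFunc.algebraMap_eq_C, RatFunc.intDegree_C,
          neg_zero]⟩)
      (fun b => ⟨ratFunc_X_sub_C_ne_zero b, by
        rw [ord_infty_X_sub_C]
        have : (RatFunc.X - RatFunc.C b : RatFunc k) =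
          algebraMap (Polynomial k) _ (Polynomial.X - Polynomial.C b) := by simp
        rw [this, RatFunc.intDegree_polynomial, Polynomial.natDegree_X_sub_C]; rfl⟩)
      (fun x y hx hy => ⟨mul_ne_zero hx.1 hy.1, by
        rw [ord_mul _ hx.1 hy.1, hx.2, hy.2, RatFunc.intDegree_mul hx.1 hy.1]; ring⟩)
      (fun x hx => ⟨inv_ne_zero hx.1, by rw [ord_inv, hx.2, RatFunc.intDegree_inv]⟩) hq).2

theorem ord_infty_polynomial (f : Polynomial k) (hf : f ≠ 0) :
    (infty k).ord (algebraMap (Polynomial k) (RatFunc k) f) = -f.natDegree := by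
  rw [ord_infty _ (by simpa using hf), RatFunc.intDegree_polynomial]

theorem X_mem_of_ne_infty {p : FFPlace k (RatFunc k)} (hp : p ≠ infty k) :
    (RatFunc.X : RatFunc k) ∈ p.1 := by
  rw [Ne, eq_infty_iff, not_not] at hp; exact hp

theorem polynomial_mem {p : FFPlace k (RatFunc k)} (hp : p ≠ infty k) (f : Polynomial k) :
    algebraMap (Polynomial k) (RatFunc k) f ∈ p.1 := by
  induction f using Polynomial.induction_on with
  | C a => rw [RatFunc.algebraMap_C, ← RatFunc.algebraMap_eq_C]; exact p.2.1 a
  | add p q hp hq => rw [map_add]; exact add_mem hp hq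
  | monomial n a h =>
    rw [pow_succ, ← mul_assoc, map_mul, RatFunc.algebraMap_X]
    exact mul_mem h (X_mem_of_ne_infty hp)

/-- Polynomials in a degree range are characterised by their poles. -/
theorem exists_polynomial {q : RatFunc k} {m : ℤ} (hq : ∀ p ≠ infty k, q ∈ p.ordGE 0)
    (hm : q ∈ (infty k).ordGE (-m)) :
    ∃ f ∈ Polynomial.degreeLT k (m + 1).toNat, algebraMap (Polynomial k) (RatFunc k) f = q := by
  have hint : IsIntegral (Polynomial k) q := by
    have h := isIntegral_of_forall_place (k := k)
      (algebraMap (Polynomial k) (RatFunc k)).range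
      (fun c => ⟨Polynomial.C c, by rw [RatFunc.algebraMap_C, RatFunc.algebraMap_eq_C]⟩) q
      (fun p hp => by
        refine p.mem_ordGE_zero.1 (hq p fun h => ?_)
        subst h
        exact X_notMem_infty k (hp _ ⟨Polynomial.X, RatFunc.algebraMap_X⟩))
    obtain ⟨P, hP, hPz⟩ := h
    let e : Polynomial k →+* (algebraMap (Polynomial k) (RatFunc k)).range :=
      (algebraMap (Polynomial k) (RatFunc k)).rangeRestrict
    have hsurj : Function.Surjective e := RingHom.rangeRestrict_surjective _
    obtain ⟨P', hP', -, hmonic⟩ := Polynomial.lifts_and_degree_eq_and_monic (f := e)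
      ((Polynomial.mem_lifts P).2 (Polynomial.map_surjective e hsurj P)) hP
    refine ⟨P', hmonic, ?_⟩
    rw [← hP', Polynomial.eval₂_map] at hPz
    exact hPz
  obtain ⟨f, rfl⟩ := IsIntegrallyClosed.isIntegral_iff.1 hint
  refine ⟨f, ?_, rfl⟩
  by_cases hf : f = 0
  · rw [hf]; exact zero_mem _
  rw [mem_ordGE_of_ne _ (by simpa using hf), ord_infty_polynomial f hf] at hm
  rw [Polynomial.mem_degreeLT, Polynomial.degree_eq_natDegree hf]
  have : f.natDegree < (m + 1).toNat := by omega
  exact_mod_cast this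

end FFPlace

end Polynomials

section PoleFiltration

variable {k L : Type} [Field k] [Field L] [Algebra k L] [IsAlgClosed k] [Algebra (RatFunc k) L]
  [IsScalarTower k (RatFunc k) L] [FiniteDimensional (RatFunc k) L]

variable (k L) in
/-- The coordinate function. -/
def polyMap : Polynomial k →ₐ[k] L :=
  (IsScalarTower.toAlgHom k (RatFunc k) L).comp
    (IsScalarTower.toAlgHom k (Polynomial k) (RatFunc k))

theorem polyMap_apply (f : Polynomial k) :
    polyMap k L f = algebraMap (RatFunc k) L (algebraMap (Polynomial k) (RatFunc k) f) := rfl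

theorem polyMap_X : polyMap k L Polynomial.X = algebraMap (RatFunc k) L RatFunc.X := by
  rw [polyMap_apply, RatFunc.algebraMap_X]

theorem polyMap_C (c : k) : polyMap k L (Polynomial.C c) = algebraMap k L c :=
  (polyMap k L).commutes c

theorem polyMap_injective : Function.Injective (polyMap k L) :=
  (algebraMap (RatFunc k) L).injective.comp (RatFunc.algebraMap_injective k)

variable (k L) in
/-- Functions with poles bounded by a multiple of the fibre at infinity. -/
def poleSpace (m : ℤ) : Submodule k L := rrSpace (m • pullPoint L (FFPlace.infty k))

variable (k L) in
/-- Functions without finite poles. -/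
def affineSpace : Submodule k L :=
  ⨅ A : FFPlace k L, ⨅ _ : A.restrict (RatFunc k) ≠ FFPlace.infty k, A.ordGE 0

theorem mem_affineSpace {z : L} : z ∈ affineSpace k L ↔
    ∀ A : FFPlace k L, A.restrict (RatFunc k) ≠ FFPlace.infty k → z ∈ A.ordGE 0 := by
  simp [affineSpace, Submodule.mem_iInf]

theorem mem_poleSpace {z : L} {m : ℤ} : z ∈ poleSpace k L m ↔ z ∈ affineSpace k L ∧
    ∀ A : FFPlace k L, A.restrict (RatFunc k) = FFPlace.infty k →
      z ∈ A.ordGE (-(m * A.ramIdx (RatFunc k))) := by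
  rw [poleSpace, mem_rrSpace, mem_affineSpace]
  simp only [Finsupp.smul_apply, pullPoint_apply, smul_eq_mul]
  refine ⟨fun h => ⟨fun A hA => ?_, fun A hA => ?_⟩, fun h A => ?_⟩
  · have := h A; rwa [if_neg hA, mul_zero, neg_zero] at this
  · have := h A; rwa [if_pos hA] at this
  · by_cases hA : A.restrict (RatFunc k) = FFPlace.infty k
    · rw [if_pos hA]; exact h.2 A hA
    · rw [if_neg hA, mul_zero, neg_zero]; exact h.1 A hA

theorem poleSpace_le_affineSpace (m : ℤ) : poleSpace k L m ≤ affineSpace k L :=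
  fun _ hz => (mem_poleSpace.1 hz).1

theorem poleSpace_mono {m m' : ℤ} (h : m ≤ m') : poleSpace k L m ≤ poleSpace k L m' := by
  intro z hz
  rw [mem_poleSpace] at hz ⊢
  refine ⟨hz.1, fun A hA => A.ordGE_anti ?_ (hz.2 A hA)⟩
  have := mul_le_mul_of_nonneg_right h (Int.natCast_nonneg (A.ramIdx (RatFunc k)))
  omega

theorem exists_mem_poleSpace {z : L} (hz : z ∈ affineSpace k L) : ∃ m, z ∈ poleSpace k L m := by
  refine ⟨∑ A ∈ (FFPlace.infty k).fiber L, |A.ord z|, mem_poleSpace.2 ⟨hz, fun A hA => ?_⟩⟩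
  rw [A.mem_ordGE]
  intro _
  have h1 := Finset.single_le_sum (f := fun A : FFPlace k L => |A.ord z|)
    (fun _ _ => abs_nonneg _) (FFPlace.mem_fiber.2 hA)
  have h2 : (1 : ℤ) ≤ A.ramIdx (RatFunc k) := by exact_mod_cast FFPlace.one_le_ramIdx A
  have h3 := neg_abs_le (A.ord z)
  have h4 : |A.ord z| ≤ ∑ A ∈ (FFPlace.infty k).fiber L, |A.ord z| := h1
  nlinarith [abs_nonneg (A.ord z)]

theorem polyMap_mem_affineSpace (f : Polynomial k) : polyMap k L f ∈ affineSpace k L :=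
  mem_affineSpace.2 fun _ hA => FFPlace.algebraMap_mem_ordGE_zero
    ((FFPlace.mem_ordGE_zero _).2 (FFPlace.polynomial_mem hA f))

theorem affineSpace_mul_mem {z w : L} (hz : z ∈ affineSpace k L) (hw : w ∈ affineSpace k L) :
    z * w ∈ affineSpace k L := by
  rw [mem_affineSpace] at hz hw ⊢
  exact fun A hA => FFPlace.mul_mem_ordGE_of (hz A hA) (hw A hA) le_rfl

theorem ord_polyMap {A : FFPlace k L} (hA : A.restrict (RatFunc k) = FFPlace.infty k)
    {f : Polynomial k} (hf : f ≠ 0) :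
    A.ord (polyMap k L f) = -(f.natDegree * A.ramIdx (RatFunc k)) := by
  rw [polyMap_apply, FFPlace.ord_algebraMap, hA, FFPlace.ord_infty_polynomial f hf]
  ring

theorem polyMap_ne_zero {f : Polynomial k} (hf : f ≠ 0) : polyMap k L f ≠ 0 :=
  (map_ne_zero_iff _ polyMap_injective).2 hf

theorem polyMap_mul_mem_poleSpace_iff {z : L} (hz : z ∈ affineSpace k L) {f : Polynomial k}
    (hf : f ≠ 0) {m : ℤ} :
    polyMap k L f * z ∈ poleSpace k L m ↔ z ∈ poleSpace k L (m - f.natDegree) := by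
  rw [mem_poleSpace, mem_poleSpace]
  refine and_congr (iff_of_true (affineSpace_mul_mem (polyMap_mem_affineSpace f) hz) hz)
    (forall₂_congr fun A hA => ?_)
  rw [mul_comm (polyMap k L f) z, A.mul_mem_ordGE_iff (polyMap_ne_zero hf), ord_polyMap hA hf]
  refine iff_of_eq ?_
  congr 1
  congr 1
  ring

theorem polyMap_mul_mem_poleSpace {z : L} {f : Polynomial k} {m r : ℤ} (hz : z ∈ poleSpace k L m)
    (hf : f ≠ 0 → f.natDegree + m ≤ r) : polyMap k L f * z ∈ poleSpace k L r := by
  by_cases h : f = 0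
  · simp [h]
  · rw [polyMap_mul_mem_poleSpace_iff (poleSpace_le_affineSpace _ hz) h]
    refine poleSpace_mono ?_ hz
    have := hf h; omega

end PoleFiltration

section ReducedBasis

variable {k L : Type} [Field k] [Field L] [Algebra k L] [IsAlgClosed k] [Algebra (RatFunc k) L]
  [IsScalarTower k (RatFunc k) L] [FiniteDimensional (RatFunc k) L]

variable (k L) in
/-- The degree over the rational function field. -/
abbrev ffDegree : ℕ := Module.finrank (RatFunc k) L

/-- A basis of the ring of functions without finite poles, over the polynomial ring. -/
structure IsPolyBasis (b : Fin (ffDegree k L) → L) : Prop where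
  mem : ∀ i, b i ∈ affineSpace k L
  gen : ∀ z ∈ affineSpace k L, ∃ p : Fin (ffDegree k L) → Polynomial k,
    z = ∑ i, polyMap k L (p i) * b i
  span : ⊤ ≤ Submodule.span (RatFunc k) (Set.range b)

theorem exists_isPolyBasis [CharZero k] : ∃ b, IsPolyBasis (k := k) (L := L) b := by
  let _ : Algebra (Polynomial k) L := (polyMap k L).toRingHom.toAlgebra
  have : IsScalarTower (Polynomial k) (RatFunc k) L := IsScalarTower.of_algebraMap_eq fun _ => rfl
  have : CharZero (RatFunc k) := charZero_of_injective_algebraMap (algebraMap k _).injective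
  obtain ⟨b, hb⟩ := exists_integral_basis (Polynomial k) (RatFunc k) L
  refine ⟨b, fun i => mem_affineSpace.2 fun A hA => A.mem_ordGE_zero.2 ?_, fun z hz => ?_,
    b.span_eq.ge⟩
  · have hbi : IsIntegral (Polynomial k) (b i) := (hb _).2 fun j => by
      rw [b.repr_self, Finsupp.single_apply]
      split_ifs
      exacts [⟨1, map_one _⟩, ⟨0, map_zero _⟩]
    obtain ⟨P, hP, hPz⟩ := hbi
    let f : Polynomial k →+* (A.restrict (RatFunc k)).1 :=
      (algebraMap (Polynomial k) (RatFunc k)).codRestrict (A.restrict (RatFunc k)).1.toSubring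
        fun x => FFPlace.polynomial_mem hA x
    refine FFPlace.mem_of_isIntegral (p := A.restrict (RatFunc k)) ⟨P.map f, hP.map f, ?_⟩ rfl
    rw [Polynomial.eval₂_map]
    exact hPz
  · have hint : IsIntegral (Polynomial k) z := by
      have h := isIntegral_of_forall_place (k := k) (polyMap k L).toRingHom.range
        (fun c => ⟨Polynomial.C c, polyMap_C c⟩) z
        (fun A hA => A.mem_ordGE_zero.1 (mem_affineSpace.1 hz A fun h => by
          have h1 : (RatFunc.X : RatFunc k) ∈ (A.restrict (RatFunc k)).1 :=
            hA _ ⟨Polynomial.X, polyMap_X⟩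
          rw [h] at h1
          exact FFPlace.X_notMem_infty k h1))
      obtain ⟨P, hP, hPz⟩ := h
      obtain ⟨q, hq, -, hqm⟩ := Polynomial.lifts_and_natDegree_eq_and_monic
        (f := (polyMap k L).toRingHom.rangeRestrict) (p := P) ((Polynomial.mem_lifts P).2
          (Polynomial.map_surjective _ (RingHom.rangeRestrict_surjective _) P)) hP
      refine ⟨q, hqm, ?_⟩
      rw [← hq, Polynomial.eval₂_map] at hPz
      exact hPz
    choose r hr using (hb z).1 hint
    refine ⟨r, ?_⟩
    conv_lhs => rw [← b.sum_repr z]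
    refine Finset.sum_congr rfl fun i _ => ?_
    rw [polyMap_apply, hr, Algebra.smul_def]

namespace IsPolyBasis

variable {b : Fin (ffDegree k L) → L} (hb : IsPolyBasis b)
include hb

theorem of_gen {b' : Fin (ffDegree k L) → L} (h1 : ∀ i, b' i ∈ affineSpace k L)
    (h2 : ∀ z ∈ affineSpace k L, ∃ p : Fin (ffDegree k L) → Polynomial k,
      z = ∑ i, polyMap k L (p i) * b' i) : IsPolyBasis b' := by
  refine ⟨h1, h2, hb.span.trans (Submodule.span_le.2 ?_)⟩
  rintro _ ⟨i, rfl⟩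
  obtain ⟨p, hp⟩ := h2 _ (hb.mem i)
  rw [hp]
  refine sum_mem fun j _ => ?_
  rw [polyMap_apply, ← Algebra.smul_def]
  exact Submodule.smul_mem _ _ (Submodule.subset_span ⟨j, rfl⟩)

theorem linearIndependent : LinearIndependent (RatFunc k) b :=
  linearIndependent_of_top_le_span_of_card_eq_finrank hb.span (by simp)

theorem coeff_unique {p q : Fin (ffDegree k L) → Polynomial k}
    (h : ∑ i, polyMap k L (p i) * b i = ∑ i, polyMap k L (q i) * b i) : p = q := by
  have h1 := Fintype.linearIndependent_iff.1 hb.linearIndependent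
    (fun i => algebraMap _ (RatFunc k) (p i - q i)) (by
      rw [← sub_eq_zero, ← Finset.sum_sub_distrib] at h
      rw [← h]
      refine Finset.sum_congr rfl fun i _ => ?_
      rw [Algebra.smul_def, ← polyMap_apply, map_sub]; ring)
  funext i
  have := h1 i
  rwa [map_eq_zero_iff _ (RatFunc.algebraMap_injective k), sub_eq_zero] at this

theorem update (j : Fin (ffDegree k L)) (q : Fin (ffDegree k L) → Polynomial k) {c : k}
    (hc : c ≠ 0) (hq : q j = Polynomial.C c) :
    IsPolyBasis (Function.update b j (∑ i, polyMap k L (q i) * b i)) := by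
  refine hb.of_gen (fun i => ?_) fun z hz => ?_
  · by_cases hi : i = j
    · subst hi
      rw [Function.update_self]
      exact sum_mem fun l _ => affineSpace_mul_mem (polyMap_mem_affineSpace _) (hb.mem l)
    · rw [Function.update_of_ne hi]; exact hb.mem i
  · obtain ⟨p, rfl⟩ := hb.gen z hz
    set r := p j * Polynomial.C c⁻¹ with hr
    refine ⟨fun i => if i = j then r else p i - r * q i, ?_⟩
    change _ = ∑ i, polyMap k L (if i = j then r else p i - r * q i) * _
    rw [← Finset.add_sum_erase _ (fun i => polyMap k L (if i = j then r else p i - r * q i) *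
        Function.update b j (∑ i, polyMap k L (q i) * b i) i) (Finset.mem_univ j), if_pos rfl,
      Function.update_self,
      ← Finset.add_sum_erase _ (fun i => polyMap k L (p i) * b i) (Finset.mem_univ j),
      ← Finset.add_sum_erase _ (fun i => polyMap k L (q i) * b i) (Finset.mem_univ j)]
    have h1 : ∑ x ∈ Finset.univ.erase j, polyMap k L (if x = j then r else p x - r * q x) *
        Function.update b j (polyMap k L (q j) * b j +
          ∑ i ∈ Finset.univ.erase j, polyMap k L (q i) * b i) x =
        ∑ i ∈ Finset.univ.erase j, polyMap k L (p i) * b i -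
          polyMap k L r * ∑ i ∈ Finset.univ.erase j, polyMap k L (q i) * b i := by
      rw [Finset.mul_sum, ← Finset.sum_sub_distrib]
      refine Finset.sum_congr rfl fun i hi => ?_
      rw [if_neg (Finset.ne_of_mem_erase hi), Function.update_of_ne (Finset.ne_of_mem_erase hi),
        map_sub, map_mul]
      ring
    have h2 : polyMap k L r * polyMap k L (q j) = polyMap k L (p j) := by
      rw [← map_mul, hq, hr, mul_assoc, ← map_mul, inv_mul_cancel₀ hc, map_one, mul_one]
    rw [h1, ← h2]
    ring

end IsPolyBasis

variable (b : Fin (ffDegree k L) → L) (d : Fin (ffDegree k L) → ℤ)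

/-- Coefficient vectors of bounded degree. -/
abbrev CoeffSpace (d : Fin (ffDegree k L) → ℤ) (m : ℤ) : Type :=
  ∀ i, Polynomial.degreeLT k (m - d i + 1).toNat

theorem finrank_coeffSpace (m : ℤ) : Module.finrank k (CoeffSpace (k := k) d m) =
    ∑ i, (m - d i + 1).toNat := by
  rw [Module.finrank_pi_fintype]
  refine Finset.sum_congr rfl fun i _ => ?_
  rw [(Polynomial.degreeLTEquiv k _).finrank_eq, Module.finrank_fin_fun]

instance (m : ℤ) : FiniteDimensional k (CoeffSpace (k := k) d m) :=
  have : ∀ i, FiniteDimensional k (Polynomial.degreeLT k (m - d i + 1).toNat) := fun _ =>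
    FiniteDimensional.of_injective (Polynomial.degreeLTEquiv k _).toLinearMap
      (Polynomial.degreeLTEquiv k _).injective
  inferInstance

/-- The combination of a family with polynomial coefficients. -/
def combine (m : ℤ) : CoeffSpace (k := k) d m →ₗ[k] L where
  toFun p := ∑ i, polyMap k L (p i) * b i
  map_add' p q := by
    rw [← Finset.sum_add_distrib]
    refine Finset.sum_congr rfl fun i _ => ?_
    rw [Pi.add_apply, Submodule.coe_add, map_add, add_mul]
  map_smul' c p := by
    rw [RingHom.id_apply, Finset.smul_sum]
    refine Finset.sum_congr rfl fun i _ => ?_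
    rw [Pi.smul_apply, Submodule.coe_smul, map_smul, smul_mul_assoc]

end ReducedBasis

section ReducedBasisExistence

variable {k L : Type} [Field k] [Field L] [Algebra k L] [IsAlgClosed k] [Algebra (RatFunc k) L]
  [IsScalarTower k (RatFunc k) L] [FiniteDimensional (RatFunc k) L]

/-- A basis of the ring of functions without finite poles adapted to the pole order at infinity. -/
structure IsReducedBasis (b : Fin (ffDegree k L) → L) (d : Fin (ffDegree k L) → ℤ) : Prop
    extends IsPolyBasis b where
  mem_pole : ∀ i, b i ∈ poleSpace k L (d i)
  reduced : ∀ (m : ℤ) (p : Fin (ffDegree k L) → Polynomial k),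
    ∑ i, polyMap k L (p i) * b i ∈ poleSpace k L m → ∀ i, p i ≠ 0 → (p i).natDegree + d i ≤ m

variable {b : Fin (ffDegree k L) → L} {d : Fin (ffDegree k L) → ℤ}

theorem combine_injective (hb : IsPolyBasis b) (m : ℤ) : Function.Injective (combine b d m) := by
  intro p q h
  have := hb.coeff_unique (p := fun i => p i) (q := fun i => q i) h
  funext i
  exact Subtype.ext (congrFun this i)

theorem natDegree_le_of_mem_degreeLT {f : Polynomial k} {r : ℤ}
    (h : f ∈ Polynomial.degreeLT k (r + 1).toNat) (hf : f ≠ 0) : (f.natDegree : ℤ) ≤ r := by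
  rw [Polynomial.mem_degreeLT, Polynomial.degree_eq_natDegree hf] at h
  have : f.natDegree < (r + 1).toNat := by exact_mod_cast h
  omega

theorem mem_degreeLT_of_natDegree_le {f : Polynomial k} {r : ℤ}
    (h : f ≠ 0 → (f.natDegree : ℤ) ≤ r) : f ∈ Polynomial.degreeLT k (r + 1).toNat := by
  by_cases hf : f = 0
  · rw [hf]; exact zero_mem _
  have h1 := h hf
  rw [Polynomial.mem_degreeLT, Polynomial.degree_eq_natDegree hf]
  have : f.natDegree < (r + 1).toNat := by omega
  exact_mod_cast this

theorem combine_mem (hd : ∀ i, b i ∈ poleSpace k L (d i)) {m : ℤ} (p : CoeffSpace d m) :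
    combine b d m p ∈ poleSpace k L m := by
  change ∑ i, polyMap k L (p i) * b i ∈ _
  exact sum_mem fun i _ => polyMap_mul_mem_poleSpace (r := m) (hd i) fun hp => by
    have := natDegree_le_of_mem_degreeLT (p i).2 hp
    omega

theorem sum_toNat_of_le {m : ℤ} (hm : ∀ i, d i ≤ m + 1) :
    ((∑ i, (m - d i + 1).toNat : ℕ) : ℤ) = ffDegree k L * m - ∑ i, d i + ffDegree k L := by
  push_cast
  rw [Finset.sum_congr rfl fun i _ => Int.toNat_of_nonneg (by have := hm i; omega)]
  rw [Finset.sum_add_distrib, Finset.sum_sub_distrib]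
  simp

instance (m : ℤ) : FiniteDimensional k (poleSpace k L m) := rrSpace_finiteDimensional _

variable [CharZero k]

theorem rrDim_pole_le {m : ℤ} (hm : 0 ≤ m) :
    (Module.finrank k (poleSpace k L m) : ℤ) ≤ 1 + ffDegree k L * m := by
  have h0 : (0 : FFPlace k L →₀ ℤ) ≤ m • pullPoint L (FFPlace.infty k) := by
    intro A
    rw [Finsupp.smul_apply, pullPoint_apply, Finsupp.zero_apply, smul_eq_mul]
    split_ifs
    · positivity
    · simp
  have h := rrDim_le h0
  rw [rrDim_eq, rrDim_eq, rrSpace_zero_finrank.2, sub_zero, divDeg_zsmul, divDeg_pullPoint] at h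
  rw [mul_comm]
  exact_mod_cast h

theorem sum_lower_bound (hb : IsPolyBasis b) (hd : ∀ i, b i ∈ poleSpace k L (d i)) :
    (ffDegree k L : ℤ) - 1 ≤ ∑ i, d i := by
  set m : ℤ := ∑ i, |d i| with hm
  have hm0 : 0 ≤ m := Finset.sum_nonneg fun _ _ => abs_nonneg _
  have hdm : ∀ i, d i ≤ m + 1 := fun i => by
    have h1 : |d i| ≤ m :=
      Finset.single_le_sum (f := fun i => |d i|) (fun _ _ => abs_nonneg _) (Finset.mem_univ i)
    have h2 := le_abs_self (d i)
    omega
  have h1 : Module.finrank k (CoeffSpace d m) ≤ Module.finrank k (poleSpace k L m) :=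
    LinearMap.finrank_le_finrank_of_injective
      (f := (combine b d m).codRestrict _ fun p => combine_mem hd p) fun p q h =>
        combine_injective hb m (congrArg Subtype.val h)
  rw [finrank_coeffSpace] at h1
  have h2 := sum_toNat_of_le hdm
  have h3 := rrDim_pole_le (k := k) (L := L) hm0
  have h4 : ((∑ i, (m - d i + 1).toNat : ℕ) : ℤ) ≤ Module.finrank k (poleSpace k L m) := by
    exact_mod_cast h1
  omega

omit [CharZero k] in
theorem exists_reduction (hb : IsPolyBasis b) (hd : ∀ i, b i ∈ poleSpace k L (d i))
    (hred : ¬ IsReducedBasis b d) :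
    ∃ (b' : Fin (ffDegree k L) → L) (d' : Fin (ffDegree k L) → ℤ), IsPolyBasis (k := k) (L := L) b' ∧
      (∀ i, b' i ∈ poleSpace k L (d' i)) ∧ ∑ i, d' i < ∑ i, d i := by
  have : ∃ (m : ℤ) (p : Fin (ffDegree k L) → Polynomial k),
    ∑ i, polyMap k L (p i) * b i ∈ poleSpace k L m ∧ ∃ i, p i ≠ 0 ∧ m < (p i).natDegree + d i := by
    by_contra! h
    exact hred ⟨hb, hd, h⟩
  obtain ⟨m, p, hz, i0, hi0, hm⟩ := this
  obtain ⟨i1, hi1, hmax⟩ := Finset.exists_max_image (Finset.univ.filter fun i => p i ≠ 0)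
    (fun i => ((p i).natDegree : ℤ) + d i) ⟨i0, by simpa using hi0⟩
  set M : ℤ := (p i1).natDegree + d i1 with hM
  have hmaxM : ∀ i, p i ≠ 0 → (p i).natDegree + d i ≤ M := fun i hi => hmax i (by simpa using hi)
  have hmM : m ≤ M - 1 := by
    have := hmaxM i0 hi0; omega
  obtain ⟨j, hj, hjmax⟩ := Finset.exists_max_image
    (Finset.univ.filter fun i => p i ≠ 0 ∧ (p i).natDegree + d i = M) d
    ⟨i1, by simp at hi1; simp [hi1, hM]⟩
  simp only [Finset.mem_filter, Finset.mem_univ, true_and] at hj hjmax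
  set q : Fin (ffDegree k L) → Polynomial k := fun i =>
    if p i ≠ 0 ∧ (p i).natDegree + d i = M then
      Polynomial.C (p i).leadingCoeff * Polynomial.X ^ (d j - d i).toNat else 0 with hq
  have hqj : q j = Polynomial.C (p j).leadingCoeff := by
    simp only [hq]
    rw [if_pos hj, sub_self]; simp
  have hw : ∑ i, polyMap k L (q i) * b i ∈ poleSpace k L (d j - 1) := by
    set e := (p j).natDegree with he
    have hwa : ∑ i, polyMap k L (q i) * b i ∈ affineSpace k L :=
      sum_mem fun l _ => affineSpace_mul_mem (polyMap_mem_affineSpace _) (hb.mem l)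
    have h1 := polyMap_mul_mem_poleSpace_iff hwa (m := M - 1)
      (pow_ne_zero e (Polynomial.X_ne_zero (R := k)))
    rw [Polynomial.natDegree_X_pow] at h1
    rw [show d j - 1 = M - 1 - e by omega, ← h1]
    have e1 : polyMap k L (Polynomial.X ^ e) * ∑ i, polyMap k L (q i) * b i =
        ∑ i, polyMap k L (p i) * b i -
          ∑ i, polyMap k L (p i - q i * Polynomial.X ^ e) * b i := by
      rw [Finset.mul_sum, ← Finset.sum_sub_distrib]
      refine Finset.sum_congr rfl fun i _ => ?_
      rw [map_sub, map_mul]; ring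
    rw [e1]
    refine sub_mem (poleSpace_mono hmM hz) (sum_mem fun i _ =>
      polyMap_mul_mem_poleSpace (hd i) fun hne => ?_)
    by_cases hi : p i ≠ 0 ∧ (p i).natDegree + d i = M
    · have h2 : p i - q i * Polynomial.X ^ e = (p i).eraseLead := by
        have h3 := hjmax i hi
        rw [← Polynomial.self_sub_C_mul_X_pow]
        simp only [hq]
        rw [if_pos hi, mul_assoc, ← pow_add]
        congr 3
        omega
      rw [h2] at hne ⊢
      have := ((p i).eraseLead_natDegree_lt_or_eraseLead_eq_zero).resolve_right hne
      omega
    · have h2 : q i = 0 := if_neg hi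
      rw [h2, zero_mul, sub_zero] at hne ⊢
      have h3 := hmaxM i hne
      have h4 : (p i).natDegree + d i ≠ M := fun h => hi ⟨hne, h⟩
      omega
  refine ⟨_, Function.update d j (d j - 1), hb.update j q
    (Polynomial.leadingCoeff_ne_zero.2 hj.1) hqj, fun i => ?_, ?_⟩
  · by_cases hi : i = j
    · subst hi; rwa [Function.update_self, Function.update_self]
    · rw [Function.update_of_ne hi, Function.update_of_ne hi]; exact hd i
  · rw [Finset.sum_update_of_mem (Finset.mem_univ j),
      ← Finset.add_sum_erase _ d (Finset.mem_univ j), Finset.sdiff_singleton_eq_erase]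
    omega

variable (k L) in
theorem exists_isReducedBasis : ∃ b d, IsReducedBasis (k := k) (L := L) b d := by
  obtain ⟨s, ⟨b, d, hb, hd, hs⟩, hmin⟩ := Int.exists_least_of_bdd
    (P := fun s => ∃ (b : Fin (ffDegree k L) → L) (d : Fin (ffDegree k L) → ℤ),
      IsPolyBasis (k := k) (L := L) b ∧ (∀ i, b i ∈ poleSpace k L (d i)) ∧
      s = ∑ i, d i)
    ⟨(ffDegree k L : ℤ) - 1, by
      rintro _ ⟨b, d, hb, hd, rfl⟩
      exact sum_lower_bound hb hd⟩
    (by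
      obtain ⟨b, hb⟩ := exists_isPolyBasis (k := k) (L := L)
      choose d hd using fun i => exists_mem_poleSpace (hb.mem i)
      exact ⟨_, b, d, hb, hd, rfl⟩)
  refine ⟨b, d, ?_⟩
  by_contra hred
  obtain ⟨b', d', hb', hd', hlt⟩ := exists_reduction hb hd hred
  have := hmin _ ⟨b', d', hb', hd', rfl⟩
  omega

end ReducedBasisExistence

section RiemannTheorem

variable {k L : Type} [Field k] [Field L] [Algebra k L] [IsAlgClosed k] [Algebra (RatFunc k) L]
  [IsScalarTower k (RatFunc k) L] [FiniteDimensional (RatFunc k) L] [CharZero k]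

variable {b : Fin (ffDegree k L) → L} {d : Fin (ffDegree k L) → ℤ}

omit [CharZero k] in
theorem finrank_poleSpace (hb : IsReducedBasis b d) {m : ℤ} (hm : ∀ i, d i ≤ m + 1) :
    (Module.finrank k (poleSpace k L m) : ℤ) =
      ffDegree k L * m - ∑ i, d i + ffDegree k L := by
  have h1 : LinearMap.range (combine b d m) = poleSpace k L m := by
    apply le_antisymm
    · rintro _ ⟨p, rfl⟩
      exact combine_mem hb.mem_pole p
    · intro z hz
      obtain ⟨p, rfl⟩ := hb.gen z (poleSpace_le_affineSpace _ hz)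
      have := hb.reduced m p hz
      exact ⟨fun i => ⟨p i, mem_degreeLT_of_natDegree_le fun h => by
        have := this i h; omega⟩, rfl⟩
  rw [← h1, LinearMap.finrank_range_of_inj (combine_injective hb.toIsPolyBasis m),
    finrank_coeffSpace, sum_toNat_of_le hm]

variable (k L) in
/-- A divisor is principal of degree zero. -/
def IsPrincipalDiv (E : FFPlace k L →₀ ℤ) : Prop :=
  divDeg E = 0 ∧ ∃ q : L, q ≠ 0 ∧ ∀ A, E A = A.ord q

omit [CharZero k] in
theorem IsPrincipalDiv.zero : IsPrincipalDiv k L 0 :=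
  ⟨by simp [divDeg], 1, one_ne_zero, fun A => by rw [A.ord_one]; rfl⟩

omit [CharZero k] in
theorem IsPrincipalDiv.add {E E' : FFPlace k L →₀ ℤ} (h : IsPrincipalDiv k L E)
    (h' : IsPrincipalDiv k L E') : IsPrincipalDiv k L (E + E') := by
  obtain ⟨h1, q, hq, h2⟩ := h
  obtain ⟨h1', q', hq', h2'⟩ := h'
  refine ⟨by rw [divDeg_add, h1, h1', add_zero], q * q', mul_ne_zero hq hq', fun A => ?_⟩
  rw [Finsupp.add_apply, A.ord_mul hq hq', h2, h2']

theorem isPrincipalDiv_point {p : FFPlace k (RatFunc k)} {a : k}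
    (h : RatFunc.X - RatFunc.C a ∈ p.ordGE 1) (n : ℕ) :
    IsPrincipalDiv k L ((n : ℤ) • (pullPoint L p - pullPoint L (FFPlace.infty k))) := by
  have h0 : algebraMap (RatFunc k) L (RatFunc.X - RatFunc.C a) ≠ 0 :=
    (map_ne_zero _).2 (FFPlace.ratFunc_X_sub_C_ne_zero a)
  refine ⟨by rw [divDeg_zsmul, divDeg_sub, divDeg_pullPoint, divDeg_pullPoint]; ring, _,
    pow_ne_zero n h0, fun A => ?_⟩
  rw [A.ord_pow, FFPlace.ord_algebraMap, FFPlace.ord_X_sub_C p _ h, Finsupp.smul_apply,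
    Finsupp.sub_apply, pullPoint_apply, pullPoint_apply, smul_eq_mul]
  split_ifs <;> ring

/-- Every divisor is dominated by a divisor equivalent to a multiple of the fibre at infinity. -/
theorem exists_dominating (R : ℤ) (hR : 0 ≤ R) (D : FFPlace k L →₀ ℤ) : ∃ r, R ≤ r ∧ ∃ E,
    IsPrincipalDiv k L E ∧ D ≤ r • pullPoint L (FFPlace.infty k) + E := by
  induction D using Finsupp.induction_linear with
  | zero =>
    refine ⟨R, le_rfl, 0, IsPrincipalDiv.zero, fun A => ?_⟩
    rw [add_zero, Finsupp.smul_apply, pullPoint_apply, smul_eq_mul, Finsupp.zero_apply]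
    split_ifs
    · positivity
    · simp
  | add D D' h h' =>
    obtain ⟨r, hr, E, hE, h⟩ := h
    obtain ⟨r', hr', E', hE', h'⟩ := h'
    refine ⟨r + r', by omega, E + E', hE.add hE', ?_⟩
    calc D + D' ≤ _ := add_le_add h h'
      _ = _ := by rw [add_smul]; abel
  | single A n =>
    have key : ∀ p : FFPlace k (RatFunc k), A.restrict (RatFunc k) = p →
        Finsupp.single A n ≤ R • pullPoint L (FFPlace.infty k) +
          (n.natAbs : ℤ) • pullPoint L p := by
      intro p hp B
      rw [Finsupp.add_apply, Finsupp.smul_apply, Finsupp.smul_apply, pullPoint_apply,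
        pullPoint_apply, smul_eq_mul, smul_eq_mul]
      have h1 : (0 : ℤ) ≤ R * (if B.restrict (RatFunc k) = FFPlace.infty k
          then (B.ramIdx (RatFunc k) : ℤ) else 0) := by
        refine mul_nonneg hR ?_
        split_ifs
        exacts [Int.natCast_nonneg _, le_rfl]
      have h2 : Finsupp.single A n B ≤ (n.natAbs : ℤ) * (if B.restrict (RatFunc k) = p
          then (B.ramIdx (RatFunc k) : ℤ) else 0) := by
        by_cases hAB : A = B
        · subst hAB
          rw [Finsupp.single_eq_same, if_pos hp]
          have h3 : (1 : ℤ) ≤ A.ramIdx (RatFunc k) := by exact_mod_cast FFPlace.one_le_ramIdx A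
          have h4 : (0 : ℤ) ≤ n.natAbs := Int.natCast_nonneg _
          have h5 : n ≤ n.natAbs := Int.le_natAbs
          nlinarith
        · rw [Finsupp.single_eq_of_ne (Ne.symm hAB)]
          refine mul_nonneg (Int.natCast_nonneg _) ?_
          split_ifs
          exacts [Int.natCast_nonneg _, le_rfl]
      omega
    rcases (A.restrict (RatFunc k)).ratFunc_cases with h | ⟨a, h⟩
    · refine ⟨R + n.natAbs, by omega, 0, IsPrincipalDiv.zero, ?_⟩
      rw [add_zero, add_smul]
      exact key _ (FFPlace.eq_infty_iff.2 h)
    · refine ⟨R + n.natAbs, by omega, _, isPrincipalDiv_point h n.natAbs, ?_⟩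
      refine (key _ rfl).trans_eq ?_
      rw [add_smul, smul_sub]; abel

omit [CharZero k] in
theorem rrDim_add_principal {E : FFPlace k L →₀ ℤ} (hE : IsPrincipalDiv k L E)
    (D : FFPlace k L →₀ ℤ) : rrDim k (D + E) = rrDim k D := by
  obtain ⟨-, q, hq, hE⟩ := hE
  rw [rrDim_eq, rrDim_eq]
  have key : ∀ z : L, z ∈ rrSpace (D + E) ↔ z * q ∈ rrSpace D := by
    intro z
    rw [mem_rrSpace, mem_rrSpace]
    refine forall_congr' fun A => ?_
    rw [A.mul_mem_ordGE_iff hq, Finsupp.add_apply, hE]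
    refine iff_of_eq ?_
    congr 2
    ring
  have hinj : Function.Injective (LinearMap.mulRight k q) := fun x y h => mul_right_cancel₀ hq h
  have : rrSpace D = (rrSpace (D + E)).map (LinearMap.mulRight k q) := by
    ext z
    rw [Submodule.mem_map]
    constructor
    · intro hz
      have e : z * q⁻¹ * q = z := by field_simp
      exact ⟨z * q⁻¹, (key _).2 (by rwa [e]), e⟩
    · rintro ⟨w, hw, rfl⟩
      exact (key w).1 hw
  rw [this]
  exact (Submodule.equivMapOfInjective _ hinj _).finrank_eq

theorem divDeg_sub_rrDim_le (hb : IsReducedBasis b d) (D : FFPlace k L →₀ ℤ) :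
    divDeg D - rrDim k D ≤ ∑ i, d i - ffDegree k L := by
  set R : ℤ := ∑ i, |d i| with hR
  have hR0 : 0 ≤ R := Finset.sum_nonneg fun _ _ => abs_nonneg _
  obtain ⟨r, hr, E, hE, h⟩ := exists_dominating R hR0 D
  have hdm : ∀ i, d i ≤ r + 1 := fun i => by
    have h1 : |d i| ≤ R :=
      Finset.single_le_sum (f := fun i => |d i|) (fun _ _ => abs_nonneg _) (Finset.mem_univ i)
    have h2 := le_abs_self (d i)
    omega
  have h1 := rrDim_le h
  rw [rrDim_add_principal hE, divDeg_sub, divDeg_add, divDeg_zsmul, divDeg_pullPoint, hE.1] at h1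
  have h2 := finrank_poleSpace hb hdm
  rw [poleSpace, ← rrDim_eq] at h2
  have h3 : r * (ffDegree k L : ℤ) = ffDegree k L * r := mul_comm _ _
  change _ ≤ _ + (r * (ffDegree k L : ℤ) + 0 - _) at h1
  omega

theorem genus_eq (hb : IsReducedBasis b d) :
    (ffGenus k L : ℤ) = 1 + (∑ i, d i - ffDegree k L) := by
  set S := {m : ℤ | ∃ D : FFPlace k L →₀ ℤ, m = divDeg D - (rrDim k D : ℤ)} with hS
  have hsup : sSup S = ∑ i, d i - ffDegree k L := by
    refine IsGreatest.csSup_eq ⟨?_, ?_⟩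
    · set R : ℤ := ∑ i, |d i| with hR
      have hdm : ∀ i, d i ≤ R + 1 := fun i => by
        have h1 : |d i| ≤ R :=
          Finset.single_le_sum (f := fun i => |d i|) (fun _ _ => abs_nonneg _) (Finset.mem_univ i)
        have h2 := le_abs_self (d i)
        omega
      refine ⟨R • pullPoint L (FFPlace.infty k), ?_⟩
      have h2 := finrank_poleSpace hb hdm
      rw [poleSpace, ← rrDim_eq] at h2
      have h3 : R * (ffDegree k L : ℤ) = ffDegree k L * R := mul_comm _ _
      rw [h2, divDeg_zsmul, divDeg_pullPoint]
      change _ = R * (ffDegree k L : ℤ) - _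
      omega
    · rintro _ ⟨D, rfl⟩
      exact divDeg_sub_rrDim_le hb D
  have h0 : -1 ≤ ∑ i, d i - (ffDegree k L : ℤ) := by
    have := divDeg_sub_rrDim_le hb 0
    rw [rrDim_eq, rrSpace_zero_finrank.2] at this
    simpa [divDeg] using this
  rw [ffGenus, ← hS, hsup]
  omega

end RiemannTheorem

section TraceIntegral

variable {k L : Type} [Field k] [Field L] [Algebra k L] [IsAlgClosed k] [Algebra (RatFunc k) L]
  [IsScalarTower k (RatFunc k) L] [FiniteDimensional (RatFunc k) L] [CharZero k]

/-- The trace maps every function with poles bounded by the divisor `B` in the fibre of a point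
to a function regular at that point. -/
def TraceIntegral (B : FFPlace k L →₀ ℤ) : Prop :=
  ∀ p : FFPlace k (RatFunc k), ∀ z : L, (∀ A : FFPlace k L, A.restrict (RatFunc k) = p →
    z ∈ A.ordGE (-B A)) → Algebra.trace (RatFunc k) L z ∈ p.ordGE 0

variable {b : Fin (ffDegree k L) → L} {d : Fin (ffDegree k L) → ℤ}

omit [CharZero k] in
theorem pullPoint_infty_of_eq {A : FFPlace k L} (h : A.restrict (RatFunc k) = FFPlace.infty k) :
    pullPoint L (FFPlace.infty k) A = A.ramIdx (RatFunc k) := by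
  rw [pullPoint_apply, if_pos h]

omit [CharZero k] in
theorem pullPoint_infty_of_ne {A : FFPlace k L} (h : A.restrict (RatFunc k) ≠ FFPlace.infty k) :
    pullPoint L (FFPlace.infty k) A = 0 := by
  rw [pullPoint_apply, if_neg h]

variable (k) in
/-- A function with a pole of order `m` at infinity and no other poles off the origin. -/
def scale (m : ℤ) : RatFunc k := RatFunc.X ^ m

omit [IsAlgClosed k] [CharZero k] in
theorem scale_ne_zero (m : ℤ) : scale k m ≠ 0 := zpow_ne_zero _ RatFunc.X_ne_zero

omit [CharZero k] in
theorem ord_infty_scale (m : ℤ) : (FFPlace.infty k).ord (scale k m) = -m := by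
  rw [scale, FFPlace.ord_zpow _ _ _ RatFunc.X_ne_zero, FFPlace.ord_infty_X]; ring

omit [CharZero k] in
theorem ord_scale {A : FFPlace k L} (h : A.restrict (RatFunc k) = FFPlace.infty k) (m : ℤ) :
    A.ord (algebraMap (RatFunc k) L (scale k m)) = -(m * A.ramIdx (RatFunc k)) := by
  rw [FFPlace.ord_algebraMap, h, ord_infty_scale]; ring

theorem trace_mul_algebraMap {F E : Type} [Field F] [Field E] [Algebra F E] (z : E) (q : F) :
    Algebra.trace F E (z * algebraMap F E q) = Algebra.trace F E z * q := by
  rw [mul_comm z, ← Algebra.smul_def, map_smul, smul_eq_mul, mul_comm]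

omit [CharZero k] in
/-- The traces against a basis adapted to infinity are polynomials of bounded degree. -/
theorem TraceIntegral.exists_polynomial {B : FFPlace k L →₀ ℤ} (hB : TraceIntegral B)
    (hb : IsReducedBasis b d) {m : ℤ} {z : L}
    (hz : z ∈ rrSpace (B + m • pullPoint L (FFPlace.infty k))) (i : Fin (ffDegree k L)) :
    ∃ f ∈ Polynomial.degreeLT k (m - -d i + 1).toNat,
      algebraMap (Polynomial k) (RatFunc k) f = Algebra.trace (RatFunc k) L (z * b i) := by
  rw [mem_rrSpace] at hz
  have hbi := mem_poleSpace.1 (hb.mem_pole i)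
  rw [sub_neg_eq_add]
  refine FFPlace.exists_polynomial (fun p hp => hB p _ fun A hA => ?_) ?_
  · have h1 := hz A
    have h2 := mem_affineSpace.1 hbi.1 A (by rw [hA]; exact hp)
    rw [Finsupp.add_apply, Finsupp.smul_apply, pullPoint_infty_of_ne (by rw [hA]; exact hp)] at h1
    exact FFPlace.mul_mem_ordGE_of h1 h2 (by simp)
  · have h := hB (FFPlace.infty k) (z * b i * algebraMap (RatFunc k) L (scale k (-(m + d i))))
      fun A hA => by
        have h1 := hz A
        have h2 := hbi.2 A hA
        rw [Finsupp.add_apply, Finsupp.smul_apply, pullPoint_infty_of_eq hA, smul_eq_mul] at h1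
        rw [A.mul_mem_ordGE_iff ((map_ne_zero _).2 (scale_ne_zero _)), ord_scale hA]
        exact FFPlace.mul_mem_ordGE_of h1 h2 (le_of_eq (by ring))
    rw [trace_mul_algebraMap, FFPlace.mul_mem_ordGE_iff _ (scale_ne_zero _), ord_infty_scale] at h
    convert h using 2
    ring

theorem eq_zero_of_trace_mul_basis (hb : IsPolyBasis b) {z : L}
    (h : ∀ i, Algebra.trace (RatFunc k) L (z * b i) = 0) : z = 0 := by
  have : CharZero (RatFunc k) := charZero_of_injective_algebraMap (algebraMap k _).injective
  refine (traceForm_nondegenerate (RatFunc k) L).1 z fun w => ?_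
  have hw : w ∈ Submodule.span (RatFunc k) (Set.range b) := hb.span trivial
  rw [Algebra.traceForm_apply]
  induction hw using Submodule.span_induction with
  | mem x hx => obtain ⟨i, rfl⟩ := hx; exact h i
  | zero => rw [mul_zero, map_zero]
  | add x y _ _ hx hy => rw [mul_add, map_add, hx, hy, add_zero]
  | smul a x _ hx => rw [mul_smul_comm, map_smul, hx, smul_zero]

theorem TraceIntegral.rrDim_le {B : FFPlace k L →₀ ℤ} (hB : TraceIntegral B)
    (hb : IsReducedBasis b d) {m : ℤ} (hm : ∀ i, -d i ≤ m + 1) :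
    (rrDim k (B + m • pullPoint L (FFPlace.infty k)) : ℤ) ≤
      ffDegree k L * m + ∑ i, d i + ffDegree k L := by
  set V := rrSpace (B + m • pullPoint L (FFPlace.infty k)) with hV
  let φ : V →ₗ[k] (Fin (ffDegree k L) → RatFunc k) := LinearMap.pi fun i =>
    ((Algebra.trace (RatFunc k) L).restrictScalars k ∘ₗ LinearMap.mulRight k (b i)) ∘ₗ V.subtype
  have hφ : ∀ z i, φ z i = Algebra.trace (RatFunc k) L ((z : L) * b i) := fun _ _ => rfl
  let j : CoeffSpace (k := k) (fun i => -d i) m →ₗ[k] (Fin (ffDegree k L) → RatFunc k) :=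
    LinearMap.pi fun i => (IsScalarTower.toAlgHom k (Polynomial k) (RatFunc k)).toLinearMap ∘ₗ
      (Submodule.subtype _ ∘ₗ LinearMap.proj i)
  have hφi : Function.Injective φ := by
    rw [injective_iff_map_eq_zero]
    intro z hz
    exact Subtype.ext (eq_zero_of_trace_mul_basis hb.toIsPolyBasis fun i => congrFun hz i)
  have hle : LinearMap.range φ ≤ LinearMap.range j := by
    rintro _ ⟨z, rfl⟩
    choose f hf hfz using hB.exists_polynomial hb z.2
    exact ⟨fun i => ⟨f i, hf i⟩, funext fun i => hfz i⟩
  have h1 := Submodule.finrank_mono hle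
  rw [LinearMap.finrank_range_of_inj hφi] at h1
  have h2 := LinearMap.finrank_range_le j
  rw [finrank_coeffSpace] at h2
  rw [rrDim_eq, ← hV]
  have h3 := sum_toNat_of_le hm
  rw [Finset.sum_neg_distrib] at h3
  omega

theorem TraceIntegral.divDeg_le_sum {B : FFPlace k L →₀ ℤ} (hB : TraceIntegral B)
    (hb : IsReducedBasis b d) : divDeg B ≤ 2 * ∑ i, d i := by
  set R : ℤ := ∑ i, |d i| with hR
  have hdm : ∀ i, -d i ≤ R + 1 := fun i => by
    have h1 : |d i| ≤ R :=
      Finset.single_le_sum (f := fun i => |d i|) (fun _ _ => abs_nonneg _) (Finset.mem_univ i)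
    have h2 := neg_abs_le (d i)
    omega
  have h1 := hB.rrDim_le hb hdm
  have h2 := divDeg_sub_rrDim_le hb (B + R • pullPoint L (FFPlace.infty k))
  rw [divDeg_add, divDeg_zsmul, divDeg_pullPoint] at h2
  have h3 : R * (ffDegree k L : ℤ) = ffDegree k L * R := mul_comm _ _
  change _ + R * (ffDegree k L : ℤ) - _ ≤ _ at h2
  omega

/-- One half of the Riemann–Hurwitz formula. -/
theorem TraceIntegral.divDeg_le {B : FFPlace k L →₀ ℤ} (hB : TraceIntegral B) :
    divDeg B ≤ 2 * ffGenus k L - 2 + 2 * ffDegree k L := by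
  obtain ⟨b, d, hb⟩ := exists_isReducedBasis k L
  have h1 := hB.divDeg_le_sum hb
  rw [genus_eq hb]
  omega

end TraceIntegral

section TraceDual

variable {k L : Type} [Field k] [Field L] [Algebra k L] [IsAlgClosed k] [Algebra (RatFunc k) L]
  [IsScalarTower k (RatFunc k) L] [FiniteDimensional (RatFunc k) L] [CharZero k]

variable {b b' : Fin (ffDegree k L) → L} {d : Fin (ffDegree k L) → ℤ}

/-- Every function that pairs integrally, under the trace, with all functions regular in the fibre
of `P` has poles bounded by `B` at `P`. -/
def BoundsTraceDual (B : FFPlace k L →₀ ℤ) : Prop :=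
  ∀ (P : FFPlace k L) (z : L), (∀ v : L, (∀ A : FFPlace k L,
    A.restrict (RatFunc k) = P.restrict (RatFunc k) → v ∈ A.ordGE 0) →
      Algebra.trace (RatFunc k) L (z * v) ∈ (P.restrict (RatFunc k)).ordGE 0) → z ∈ P.ordGE (-B P)

omit [IsAlgClosed k] in
theorem exists_traceDual (hb : ⊤ ≤ Submodule.span (RatFunc k) (Set.range b)) :
    ∃ b' : Fin (ffDegree k L) → L, ∀ i j,
      Algebra.trace (RatFunc k) L (b' i * b j) = if j = i then 1 else 0 := by
  have : CharZero (RatFunc k) := charZero_of_injective_algebraMap (algebraMap k _).injective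
  let e := basisOfTopLeSpanOfCardEqFinrank b hb (by simp)
  have he : ∀ j, e j = b j := fun j => by simp [e]
  refine ⟨fun i => (Algebra.traceForm (RatFunc k) L).dualBasis
    (traceForm_nondegenerate (RatFunc k) L) e i, fun i j => ?_⟩
  have := LinearMap.BilinForm.apply_dualBasis_left (traceForm_nondegenerate (RatFunc k) L) e i j
  rw [← he, ← Algebra.traceForm_apply, this]

omit [CharZero k] in
theorem exists_polyMap_mul_mem (hb : IsPolyBasis b) (v : L) :
    ∃ f : Polynomial k, f ≠ 0 ∧ polyMap k L f * v ∈ affineSpace k L := by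
  let e := basisOfTopLeSpanOfCardEqFinrank b hb.span (by simp)
  have he : ∀ j, e j = b j := fun j => by simp [e]
  obtain ⟨f, hf⟩ := IsLocalization.exist_integer_multiples_of_finset
    (nonZeroDivisors (Polynomial k)) (Finset.univ.image fun i => e.repr v i)
  refine ⟨f, nonZeroDivisors.coe_ne_zero f, ?_⟩
  have hv : polyMap k L f * v = ∑ i, polyMap k L f * e.repr v i • e i := by
    rw [← Finset.mul_sum, e.sum_repr]
  rw [hv]
  refine sum_mem fun i _ => ?_
  obtain ⟨g, hg⟩ := hf (e.repr v i) (Finset.mem_image_of_mem _ (Finset.mem_univ i))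
  have h1 : polyMap k L f * e.repr v i • e i = polyMap k L g * b i := by
    rw [polyMap_apply, polyMap_apply, hg, he, Algebra.smul_def, Algebra.smul_def, map_mul]
    ring
  rw [h1]
  exact affineSpace_mul_mem (polyMap_mem_affineSpace _) (hb.mem i)

omit [CharZero k] in
/-- A function regular above a finite point is a quotient of a function without finite poles by a
polynomial not vanishing at the point. -/
theorem exists_polyMap_mul_mem_of_forall_over (hb : IsPolyBasis b) {p : FFPlace k (RatFunc k)}
    (hp : p ≠ FFPlace.infty k) {v : L}
    (hv : ∀ A : FFPlace k L, A.restrict (RatFunc k) = p → v ∈ A.ordGE 0) :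
    ∃ f : Polynomial k, f ≠ 0 ∧ p.ord (algebraMap (Polynomial k) (RatFunc k) f) = 0 ∧
      polyMap k L f * v ∈ affineSpace k L := by
  obtain ⟨a, ha⟩ := p.ratFunc_cases.resolve_left fun h => hp (FFPlace.eq_infty_iff.2 h)
  obtain ⟨f, hf, hfv⟩ := exists_polyMap_mul_mem hb v
  obtain ⟨q, hq, hqa⟩ := Polynomial.exists_eq_pow_rootMultiplicity_mul_and_not_dvd f hf a
  have hq0 : q ≠ 0 := by
    rintro rfl
    exact hqa (dvd_zero _)
  have hX : algebraMap (Polynomial k) (RatFunc k) (Polynomial.X - Polynomial.C a) =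
      RatFunc.X - RatFunc.C a := by simp
  have hqe : q.eval a ≠ 0 := fun h => hqa (Polynomial.dvd_iff_isRoot.2 h)
  refine ⟨q, hq0, ?_, mem_affineSpace.2 fun A hA => ?_⟩
  · obtain ⟨g, hg⟩ : Polynomial.X - Polynomial.C a ∣ q - Polynomial.C (q.eval a) := by
      rw [Polynomial.dvd_iff_isRoot]; simp
    have h1 : q = Polynomial.C (q.eval a) + (Polynomial.X - Polynomial.C a) * g := by
      rw [← hg]; ring
    have h2 : algebraMap k (RatFunc k) (q.eval a) ≠ 0 := (map_ne_zero _).2 hqe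
    have h3 := (p.ord_add_eq_of_lt h2 (w := (RatFunc.X - RatFunc.C a) *
      algebraMap (Polynomial k) (RatFunc k) g) (by
        rw [p.ord_const]
        exact FFPlace.mul_mem_ordGE_of ha
          ((FFPlace.mem_ordGE_zero _).2 (FFPlace.polynomial_mem hp g)) (by norm_num))).2
    rw [p.ord_const] at h3
    have e : algebraMap (Polynomial k) (RatFunc k) q = algebraMap k (RatFunc k) (q.eval a) +
        (RatFunc.X - RatFunc.C a) * algebraMap (Polynomial k) (RatFunc k) g := by
      conv_lhs => rw [h1]
      rw [map_add, map_mul, hX, RatFunc.algebraMap_C, RatFunc.algebraMap_eq_C]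
    rw [e, h3]
  · by_cases hAp : A.restrict (RatFunc k) = p
    · exact FFPlace.mul_mem_ordGE_of (mem_affineSpace.1 (polyMap_mem_affineSpace q) A hA)
        (hv A hAp) (by norm_num)
    · have h1 := mem_affineSpace.1 hfv A hA
      have hne : algebraMap (RatFunc k) L (RatFunc.X - RatFunc.C a) ^ f.rootMultiplicity a ≠ 0 :=
        pow_ne_zero _ ((map_ne_zero _).2 (FFPlace.ratFunc_X_sub_C_ne_zero a))
      have e : polyMap k L f * v = (polyMap k L q * v) *
          algebraMap (RatFunc k) L (RatFunc.X - RatFunc.C a) ^ f.rootMultiplicity a := by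
        conv_lhs => rw [hq]
        rw [map_mul, map_pow, polyMap_apply, hX]; ring
      rw [e, A.mul_mem_ordGE_iff hne, A.ord_pow, FFPlace.ord_algebraMap,
        FFPlace.ord_X_sub_C p _ ha, if_neg hAp, if_neg hA] at h1
      simpa using h1

omit [CharZero k] in
theorem trace_mul_sum (hb' : ∀ i j,
      Algebra.trace (RatFunc k) L (b' i * b j) = if j = i then 1 else 0)
    (r P : Fin (ffDegree k L) → Polynomial k) :
    Algebra.trace (RatFunc k) L ((∑ i, polyMap k L (r i) * b' i) * ∑ j, polyMap k L (P j) * b j) =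
      ∑ i, algebraMap (Polynomial k) (RatFunc k) (r i * P i) := by
  rw [Finset.sum_mul_sum, map_sum]
  refine Finset.sum_congr rfl fun i _ => ?_
  rw [map_sum, Finset.sum_eq_single i]
  · have e : polyMap k L (r i) * b' i * (polyMap k L (P i) * b i) =
        (b' i * b i) *
          algebraMap (RatFunc k) L (algebraMap (Polynomial k) (RatFunc k) (r i * P i)) := by
      rw [← polyMap_apply, map_mul]; ring
    rw [e, trace_mul_algebraMap, hb', if_pos rfl, one_mul]
  · intro j _ hj
    have e : polyMap k L (r i) * b' i * (polyMap k L (P j) * b j) =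
        (b' i * b j) *
          algebraMap (RatFunc k) L (algebraMap (Polynomial k) (RatFunc k) (r i * P j)) := by
      rw [← polyMap_apply, map_mul]; ring
    rw [e, trace_mul_algebraMap, hb', if_neg hj, zero_mul]
  · simp

omit [CharZero k] in
theorem polynomial_mem_ordGE_infty {f : Polynomial k} {m : ℤ}
    (h : f ≠ 0 → (f.natDegree : ℤ) ≤ m) :
    algebraMap (Polynomial k) (RatFunc k) f ∈ (FFPlace.infty k).ordGE (-m) := by
  rw [FFPlace.mem_ordGE]
  intro hf
  have hf' : f ≠ 0 := fun h => hf (by rw [h, map_zero])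
  rw [FFPlace.ord_infty_polynomial f hf']
  have := h hf'
  omega

omit [CharZero k] in
theorem BoundsTraceDual.combine_mem {B : FFPlace k L →₀ ℤ} (hB : BoundsTraceDual B)
    (hb : IsReducedBasis b d) (hb' : ∀ i j,
      Algebra.trace (RatFunc k) L (b' i * b j) = if j = i then 1 else 0)
    {m : ℤ} (r : CoeffSpace (k := k) (fun i => -d i) m) :
    combine b' (fun i => -d i) m r ∈ rrSpace (B + m • pullPoint L (FFPlace.infty k)) := by
  rw [mem_rrSpace]
  intro A
  change ∑ i, polyMap k L (r i) * b' i ∈ _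
  set z := ∑ i, polyMap k L (r i) * b' i with hz
  have key : ∀ (f : Polynomial k) (v : L) (P : Fin (ffDegree k L) → Polynomial k),
      polyMap k L f * v = ∑ i, polyMap k L (P i) * b i →
      Algebra.trace (RatFunc k) L (z * v) * algebraMap (Polynomial k) (RatFunc k) f =
        ∑ i, algebraMap (Polynomial k) (RatFunc k) (r i * P i) := by
    intro f v P h
    rw [← trace_mul_algebraMap, ← polyMap_apply, ← trace_mul_sum hb', ← hz, ← h]
    ring_nf
  by_cases hA : A.restrict (RatFunc k) = FFPlace.infty k
  · rw [Finsupp.add_apply, Finsupp.smul_apply, pullPoint_infty_of_eq hA, smul_eq_mul]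
    have h1 := hB A (z * algebraMap (RatFunc k) L (scale k (-m))) fun v hv => by
      rw [mul_right_comm, trace_mul_algebraMap, FFPlace.mul_mem_ordGE_iff _ (scale_ne_zero _), hA,
        ord_infty_scale]
      obtain ⟨f, hf, hfv⟩ := exists_polyMap_mul_mem hb.toIsPolyBasis v
      obtain ⟨P, hP⟩ := hb.gen _ hfv
      have h2 : polyMap k L f * v ∈ poleSpace k L f.natDegree :=
        mem_poleSpace.2 ⟨hfv, fun C hC => by
          refine FFPlace.mul_mem_ordGE_of C.self_mem_ordGE (hv C (hC.trans hA.symm)) ?_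
          rw [ord_polyMap hC hf, add_zero]⟩
      have h3 := hb.reduced _ P (by rwa [← hP])
      have hf0 : algebraMap (Polynomial k) (RatFunc k) f ≠ 0 := by simpa using hf
      have h4 : Algebra.trace (RatFunc k) L (z * v) * algebraMap (Polynomial k) (RatFunc k) f ∈
          (FFPlace.infty k).ordGE (-(m + f.natDegree)) := by
        rw [key f v P hP]
        refine sum_mem fun i _ => ?_
        rw [map_mul]
        exact FFPlace.mul_mem_ordGE_of
          (polynomial_mem_ordGE_infty (m := m - -d i) (natDegree_le_of_mem_degreeLT (r i).2))
          (polynomial_mem_ordGE_infty (m := f.natDegree - d i) fun h => by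
            have := h3 i h
            omega) (by omega)
      rw [FFPlace.mul_mem_ordGE_iff _ hf0, FFPlace.ord_infty_polynomial f hf] at h4
      convert h4 using 2
      ring
    rw [A.mul_mem_ordGE_iff ((map_ne_zero _).2 (scale_ne_zero _)), ord_scale hA] at h1
    convert h1 using 2
    ring
  · rw [Finsupp.add_apply, Finsupp.smul_apply, pullPoint_infty_of_ne hA, smul_zero, add_zero]
    refine hB A z fun v hv => ?_
    obtain ⟨f, hf, hfp, hfv⟩ := exists_polyMap_mul_mem_of_forall_over hb.toIsPolyBasis hA hv
    obtain ⟨P, hP⟩ := hb.gen _ hfv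
    have hf0 : algebraMap (Polynomial k) (RatFunc k) f ≠ 0 := by simpa using hf
    have h4 : Algebra.trace (RatFunc k) L (z * v) * algebraMap (Polynomial k) (RatFunc k) f ∈
        (A.restrict (RatFunc k)).ordGE 0 := by
      rw [key f v P hP]
      exact sum_mem fun i _ => (FFPlace.mem_ordGE_zero _).2 (FFPlace.polynomial_mem hA _)
    rwa [FFPlace.mul_mem_ordGE_iff _ hf0, hfp, sub_zero] at h4

theorem BoundsTraceDual.sum_le_divDeg {B : FFPlace k L →₀ ℤ} (hB : BoundsTraceDual B)
    (hb : IsReducedBasis b d) : 2 * ∑ i, d i ≤ divDeg B := by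
  obtain ⟨b', hb'⟩ := exists_traceDual hb.span
  set R : ℤ := ∑ i, |d i| with hR
  have hd : ∀ i, |d i| ≤ R := fun i =>
    Finset.single_le_sum (f := fun i => |d i|) (fun _ _ => abs_nonneg _) (Finset.mem_univ i)
  have hR0 : 0 ≤ R := Finset.sum_nonneg fun _ _ => abs_nonneg _
  obtain ⟨r, hr, E, hE, h⟩ := exists_dominating R hR0 (-B)
  have hle : R • pullPoint L (FFPlace.infty k) ≤
      B + (r + R) • pullPoint L (FFPlace.infty k) + E := by
    have h1 := add_le_add_right h (B + R • pullPoint L (FFPlace.infty k))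
    calc _ = _ := by abel
      _ ≤ _ := h1
      _ = _ := by rw [add_smul]; abel
  have h1 := _root_.rrDim_le hle
  rw [rrDim_add_principal hE, divDeg_sub, divDeg_add, divDeg_add, divDeg_zsmul, divDeg_zsmul,
    divDeg_pullPoint, hE.1] at h1
  change _ ≤ _ + (divDeg B + (r + R) * (ffDegree k L : ℤ) + 0 - R * (ffDegree k L : ℤ)) at h1
  have h2 := finrank_poleSpace hb (m := R) fun i => by
    have := hd i
    have := le_abs_self (d i)
    omega
  rw [poleSpace, ← rrDim_eq] at h2
  have hinj : Function.Injective (combine b' (fun i => -d i) (r + R)) := by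
    rw [injective_iff_map_eq_zero]
    intro s hs
    funext j
    refine Subtype.ext (RatFunc.algebraMap_injective k ?_)
    have h3 := trace_mul_sum hb' (fun i => (s i : Polynomial k)) (Pi.single j 1)
    have h4 : ∑ i, polyMap k L (s i) * b' i = 0 := hs
    rw [h4, zero_mul, map_zero, Finset.sum_eq_single j (fun i _ hi => by
      rw [Pi.single_eq_of_ne hi, mul_zero, map_zero]) (by simp), Pi.single_eq_same, mul_one] at h3
    rw [← h3]
    simp
  have h5 : LinearMap.range (combine b' (fun i => -d i) (r + R)) ≤
      rrSpace (B + (r + R) • pullPoint L (FFPlace.infty k)) := by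
    rintro _ ⟨s, rfl⟩
    exact hB.combine_mem hb hb' s
  have : FiniteDimensional k (rrSpace (B + (r + R) • pullPoint L (FFPlace.infty k))) :=
    rrSpace_finiteDimensional _
  have h6 := Submodule.finrank_mono h5
  rw [LinearMap.finrank_range_of_inj hinj, finrank_coeffSpace, ← rrDim_eq] at h6
  have h7 := sum_toNat_of_le (d := fun i => -d i) (m := r + R) fun i => by
    have := hd i
    have := neg_abs_le (d i)
    omega
  rw [Finset.sum_neg_distrib] at h7
  have h8 : (r + R) * (ffDegree k L : ℤ) = ffDegree k L * (r + R) := mul_comm _ _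
  have h9 : R * (ffDegree k L : ℤ) = ffDegree k L * R := mul_comm _ _
  omega

end TraceDual

section RiemannHurwitz

variable {k L : Type} [Field k] [Field L] [Algebra k L] [IsAlgClosed k] [Algebra (RatFunc k) L]
  [IsScalarTower k (RatFunc k) L] [FiniteDimensional (RatFunc k) L] [CharZero k]

theorem TraceIntegral.zero : TraceIntegral (0 : FFPlace k L →₀ ℤ) := fun p z hz => by
  rw [FFPlace.mem_ordGE_zero]
  refine FFPlace.trace_mem_of_forall_over p fun A hA => ?_
  have := hz A hA
  rwa [Finsupp.zero_apply, neg_zero, A.mem_ordGE_zero] at this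

omit [CharZero k] in
theorem FFPlace.exists_sub_mem_ordGE (A : FFPlace k L) {m : ℤ} {w u : L} (hu : u ≠ 0)
    (hum : A.ord u = m) (hw : w ∈ A.ordGE m) :
    ∃ c : k, w - algebraMap k L c * u ∈ A.ordGE (m + 1) := by
  have e1 : w / u * u = w := by field_simp
  have h1 : w / u ∈ A.ordGE 0 := by
    rw [← e1, A.mul_mem_ordGE_iff hu, hum, sub_self] at hw
    exact hw
  obtain ⟨c, hc⟩ := A.exists_residue h1
  refine ⟨c, ?_⟩
  have e2 : w - algebraMap k L c * u = (w / u - algebraMap k L c) * u := by rw [sub_mul, e1]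
  rw [e2, A.mul_mem_ordGE_iff hu, hum]
  simpa using hc

/-- A trace integral divisor of maximal degree bounds the trace dual. -/
theorem TraceIntegral.boundsTraceDual {B : FFPlace k L →₀ ℤ} (hB : TraceIntegral B)
    (hmax : ∀ B' : FFPlace k L →₀ ℤ, TraceIntegral B' → divDeg B' ≤ divDeg B) :
    BoundsTraceDual B := by
  intro P z hz
  by_contra hzP
  have hz0 : z ≠ 0 := P.ne_zero_of_notMem hzP
  have hlt : P.ord z < -B P := P.ord_lt_of_notMem hzP
  set S := ((P.restrict (RatFunc k)).fiber L).erase P with hS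
  obtain ⟨y, hy0, hyP, hyS⟩ := P.exists_ord_eq S (Finset.notMem_erase _ _)
    (-B P - 1 - P.ord z) (∑ A ∈ S, (|A.ord z| + |B A|))
  have hyM : ∀ A ∈ S, |A.ord z| + |B A| ≤ ∑ A ∈ S, (|A.ord z| + |B A|) := fun A hA =>
    Finset.single_le_sum (f := fun A : FFPlace k L => |A.ord z| + |B A|)
      (fun _ _ => by positivity) hA
  have hmem : ∀ A : FFPlace k L, A.restrict (RatFunc k) = P.restrict (RatFunc k) → A ≠ P →
      A ∈ S := fun A hA hAP => Finset.mem_erase.2 ⟨hAP, FFPlace.mem_fiber.2 hA⟩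
  have huP : P.ord (z * y) = -B P - 1 := by rw [P.ord_mul hz0 hy0, hyP]; ring
  have hTI : TraceIntegral (B + Finsupp.single P 1) := by
    intro p w hw
    by_cases hp : P.restrict (RatFunc k) = p
    · subst hp
      have hwP := hw P rfl
      rw [Finsupp.add_apply, Finsupp.single_eq_same, neg_add'] at hwP
      obtain ⟨c, hc⟩ := P.exists_sub_mem_ordGE (mul_ne_zero hz0 hy0) huP hwP
      have e : Algebra.trace (RatFunc k) L w =
          Algebra.trace (RatFunc k) L (w - algebraMap k L c * (z * y)) +
            Algebra.trace (RatFunc k) L (z * (algebraMap k L c * y)) := by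
        rw [← map_add]
        congr 1
        ring
      rw [e]
      refine add_mem (hB _ _ fun A hA => ?_) (hz _ fun A hA => ?_)
      · by_cases hAP : A = P
        · subst hAP
          rwa [sub_add_cancel] at hc
        · have hAS := hmem A hA hAP
          have h1 := hw A hA
          rw [Finsupp.add_apply, Finsupp.single_eq_of_ne hAP, add_zero] at h1
          refine sub_mem h1 ?_
          have h2 := hyM A hAS
          have h3 := neg_abs_le (A.ord z)
          have h4 := neg_abs_le (B A)
          refine FFPlace.mul_mem_ordGE_of (m := 0) ((A.mem_ordGE_zero).2 (A.2.1 c))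
            (A.mul_mem_ordGE A.self_mem_ordGE (hyS A hAS)) ?_
          omega
      · refine FFPlace.mul_mem_ordGE_of (m := 0) (m' := 0) ((A.mem_ordGE_zero).2 (A.2.1 c)) ?_
          (by norm_num)
        by_cases hAP : A = P
        · subst hAP
          rw [A.mem_ordGE_of_ne hy0, hyP]
          omega
        · have hAS := hmem A hA hAP
          exact A.ordGE_anti ((add_nonneg (abs_nonneg _) (abs_nonneg _)).trans (hyM A hAS))
            (hyS A hAS)
    · refine hB p w fun A hA => ?_
      have hAP : A ≠ P := fun h => hp (h ▸ hA)
      have h1 := hw A hA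
      rwa [Finsupp.add_apply, Finsupp.single_eq_of_ne hAP, add_zero] at h1
  have := hmax _ hTI
  rw [divDeg_add, divDeg_single] at this
  omega

variable (k L) in
/-- The other half of the Riemann–Hurwitz formula. -/
theorem exists_traceIntegral : ∃ B : FFPlace k L →₀ ℤ, TraceIntegral B ∧
    2 * (ffGenus k L : ℤ) - 2 + 2 * ffDegree k L ≤ divDeg B := by
  obtain ⟨m, ⟨B, hB, rfl⟩, hmax⟩ := Int.exists_greatest_of_bdd
    (P := fun m => ∃ B : FFPlace k L →₀ ℤ, TraceIntegral B ∧ divDeg B = m)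
    ⟨_, by rintro _ ⟨B, hB, rfl⟩; exact hB.divDeg_le⟩ ⟨_, 0, TraceIntegral.zero, rfl⟩
  obtain ⟨b, d, hb⟩ := exists_isReducedBasis k L
  refine ⟨B, hB, ?_⟩
  have h1 := (hB.boundsTraceDual fun B' hB' => hmax _ ⟨B', hB', rfl⟩).sum_le_divDeg hb
  rw [genus_eq hb]
  omega

/-- A trace integral divisor is not positive at unramified places. -/
theorem TraceIntegral.apply_nonpos {B : FFPlace k L →₀ ℤ} (hB : TraceIntegral B)
    {A : FFPlace k L} (hA : A.ramIdx (RatFunc k) = 1) : B A ≤ 0 := by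
  by_contra! hBA
  set p := A.restrict (RatFunc k) with hp
  set S := (p.fiber L).erase A with hS
  obtain ⟨y, hyA, hyS⟩ := A.exists_approx_one S (Finset.notMem_erase _ _)
    (∑ C ∈ S, (C.ramIdx (RatFunc k) + (B C).natAbs) + 1)
  have hM : ∀ C ∈ S, C.ramIdx (RatFunc k) + (B C).natAbs ≤
      ∑ C ∈ S, (C.ramIdx (RatFunc k) + (B C).natAbs) := fun C hC =>
    Finset.single_le_sum (f := fun C : FFPlace k L => C.ramIdx (RatFunc k) + (B C).natAbs)
      (fun _ _ => Nat.zero_le _) hC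
  have hs0 := p.unifAt_spec.1
  have hsi0 := (map_ne_zero (algebraMap (RatFunc k) L)).2 (inv_ne_zero hs0)
  have hord : ∀ C : FFPlace k L, C.restrict (RatFunc k) = p →
      C.ord (algebraMap (RatFunc k) L (unifAt p.1)⁻¹) = -C.ramIdx (RatFunc k) := by
    intro C hC
    rw [FFPlace.ord_algebraMap, hC, p.ord_inv, p.ord_unifAt]
    ring
  have hy1 : y - 1 ∈ A.ordGE 1 := A.ordGE_anti (by exact_mod_cast Nat.le_add_left 1 _) hyA
  refine FFPlace.trace_notMem_ordGE_one p A hp.symm hy1 (fun C hC hCA => ?_) ?_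
  · exact C.ordGE_anti (by exact_mod_cast Nat.le_add_left 1 _)
      (hyS C (Finset.mem_erase.2 ⟨hCA, FFPlace.mem_fiber.2 hC⟩))
  · have h1 := hB p (y * algebraMap (RatFunc k) L (unifAt p.1)⁻¹) fun C hC => by
      rw [C.mul_mem_ordGE_iff hsi0, hord C hC]
      by_cases hCA : C = A
      · subst hCA
        have h2 : y ∈ C.ordGE 0 := by
          have h3 := add_mem (C.ordGE_anti zero_le_one hy1) (C.mem_ordGE_zero.2 (one_mem C.1))
          rwa [sub_add_cancel] at h3
        refine C.ordGE_anti ?_ h2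
        rw [hA]
        push_cast
        omega
      · have hCS : C ∈ S := Finset.mem_erase.2 ⟨hCA, FFPlace.mem_fiber.2 hC⟩
        refine C.ordGE_anti ?_ (hyS C hCS)
        have h2 := hM C hCS
        push_cast
        zify at h2
        have h3 := neg_abs_le (B C)
        omega
    rw [trace_mul_algebraMap, p.mul_mem_ordGE_iff (inv_ne_zero hs0), p.ord_inv, p.ord_unifAt] at h1
    simpa using h1

end RiemannHurwitz

section Compositum

variable {k C D X : Type} [Field k] [Field C] [Field D] [Field X] [IsAlgClosed k] [CharZero k]
  [Algebra k C] [Algebra (RatFunc k) C] [IsScalarTower k (RatFunc k) C]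
  [FiniteDimensional (RatFunc k) C]
  [Algebra k D] [Algebra (RatFunc k) D] [IsScalarTower k (RatFunc k) D]
  [FiniteDimensional (RatFunc k) D]
  [Algebra k X] [Algebra (RatFunc k) X] [IsScalarTower k (RatFunc k) X]
  [FiniteDimensional (RatFunc k) X]
  [Algebra C X] [IsScalarTower k C X] [IsScalarTower (RatFunc k) C X] [FiniteDimensional C X]
  [Algebra D X] [IsScalarTower k D X] [IsScalarTower (RatFunc k) D X] [FiniteDimensional D X]

namespace FFPlace

omit [CharZero k] in
theorem restrict_restrict (A : FFPlace k X) :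
    (A.restrict D).restrict (RatFunc k) = A.restrict (RatFunc k) := by
  refine (restrict_eq fun x hx => ?_).symm
  rw [IsScalarTower.algebraMap_apply (RatFunc k) D X]
  exact hx

omit [CharZero k] in
theorem restrict_eq_infty_iff {A : FFPlace k C} :
    A.restrict (RatFunc k) = infty k ↔ algebraMap (RatFunc k) C RatFunc.X ∉ A.1 := eq_infty_iff

omit [CharZero k] in
theorem ramIdx_eq_one {A : FFPlace k C} (hA : A.restrict (RatFunc k) = infty k)
    (h : A.ord (algebraMap (RatFunc k) C RatFunc.X) = -1) : A.ramIdx (RatFunc k) = 1 := by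
  rw [ord_algebraMap, hA, ord_infty_X] at h
  omega

theorem ramIdx_eq_finrank {p : FFPlace k (RatFunc k)} {P : FFPlace k C}
    (hP : ∀ A : FFPlace k C, A.restrict (RatFunc k) = p ↔ A = P) :
    P.ramIdx (RatFunc k) = Module.finrank (RatFunc k) C := by
  rw [← sum_ramIdx (L := C) p]
  have : p.fiber C = {P} := by
    ext A
    rw [mem_fiber, Finset.mem_singleton, hP]
  rw [this, Finset.sum_singleton]

omit [CharZero k] in
theorem sum_ne_zero_of_ord_ne (A : FFPlace k C) {ι : Type} (S : Finset ι) (f : ι → C)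
    (hS : S.Nonempty) (h0 : ∀ i ∈ S, f i ≠ 0)
    (h : ∀ i ∈ S, ∀ j ∈ S, A.ord (f i) = A.ord (f j) → i = j) : ∑ i ∈ S, f i ≠ 0 := by
  obtain ⟨i, hi, hmin⟩ := Finset.exists_min_image S (fun i => A.ord (f i)) hS
  rw [← Finset.add_sum_erase S f hi]
  refine (A.ord_add_eq_of_lt (h0 i hi) (sum_mem fun j hj => ?_)).1
  rw [Finset.mem_erase] at hj
  rw [A.mem_ordGE_of_ne (h0 j hj.2)]
  have h1 := hmin j hj.2
  have h2 : A.ord (f i) ≠ A.ord (f j) := fun e => hj.1 (h i hi j hj.2 e).symm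
  omega

end FFPlace

variable {P : FFPlace k C}

/-- A compositum of an extension totally ramified at infinity with an extension unramified at
infinity has the maximal possible degree. -/
theorem finrank_le_of_totallyRamified
    (hP : ∀ A : FFPlace k C, A.restrict (RatFunc k) = FFPlace.infty k ↔ A = P)
    (hD : ∀ A : FFPlace k D, A.restrict (RatFunc k) = FFPlace.infty k →
      A.ramIdx (RatFunc k) = 1) :
    Module.finrank (RatFunc k) C ≤ Module.finrank D X := by
  set n := Module.finrank (RatFunc k) C with hn
  have hPn : P.ramIdx (RatFunc k) = n := FFPlace.ramIdx_eq_finrank hP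
  obtain ⟨Q, hQ⟩ := FFPlace.exists_mem_fiber (L := X) (FFPlace.infty k)
  have hQC : Q.restrict C = P := (hP _).1 (Q.restrict_restrict.trans hQ)
  have hQD : (Q.restrict D).restrict (RatFunc k) = FFPlace.infty k := Q.restrict_restrict.trans hQ
  have hPi : P.restrict (RatFunc k) = FFPlace.infty k := (hP P).2 rfl
  have heC : Q.ord (algebraMap (RatFunc k) X RatFunc.X) = -(Q.ramIdx C * n) := by
    rw [IsScalarTower.algebraMap_apply (RatFunc k) C X, FFPlace.ord_algebraMap,
      FFPlace.ord_algebraMap, hQC, hPi, FFPlace.ord_infty_X, hPn]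
    ring
  have heD : Q.ord (algebraMap (RatFunc k) X RatFunc.X) = -(Q.ramIdx D) := by
    rw [IsScalarTower.algebraMap_apply (RatFunc k) D X, FFPlace.ord_algebraMap,
      FFPlace.ord_algebraMap, hQD, FFPlace.ord_infty_X, hD _ hQD]
    ring
  have he : (Q.ramIdx D : ℤ) = Q.ramIdx C * n := by omega
  have hπ0 := P.unifAt_spec.1
  set π : X := algebraMap C X (unifAt P.1) with hπ
  have hπX : π ≠ 0 := (map_ne_zero _).2 hπ0
  have hordπ : Q.ord π = Q.ramIdx C := by
    rw [hπ, FFPlace.ord_algebraMap, hQC, P.ord_unifAt, mul_one]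
  have h1 : (1 : ℤ) ≤ Q.ramIdx C := by exact_mod_cast FFPlace.one_le_ramIdx Q
  have hli : LinearIndependent D fun i : Fin n => π ^ (i : ℕ) := by
    rw [Fintype.linearIndependent_iff]
    intro g hg
    by_contra! hne
    obtain ⟨i0, hi0⟩ := hne
    have hterm : ∀ i, g i ≠ 0 → g i • π ^ (i : ℕ) ≠ 0 ∧ Q.ord (g i • π ^ (i : ℕ)) =
        Q.ramIdx C * (n * (Q.restrict D).ord (g i) + i) := by
      intro i hi
      have hgi : algebraMap D X (g i) ≠ 0 := (map_ne_zero _).2 hi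
      rw [Algebra.smul_def]
      refine ⟨mul_ne_zero hgi (pow_ne_zero _ hπX), ?_⟩
      rw [Q.ord_mul hgi (pow_ne_zero _ hπX), Q.ord_pow, FFPlace.ord_algebraMap, hordπ, he]
      ring
    refine Q.sum_ne_zero_of_ord_ne (Finset.univ.filter fun i => g i ≠ 0)
      (fun i => g i • π ^ (i : ℕ)) ⟨i0, by simpa using hi0⟩ (fun i hi => ?_)
      (fun i hi j hj hij => ?_) ?_
    · exact (hterm i (Finset.mem_filter.1 hi).2).1
    · rw [(hterm i (Finset.mem_filter.1 hi).2).2, (hterm j (Finset.mem_filter.1 hj).2).2] at hij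
      have h2 := mul_left_cancel₀ (by omega) hij
      have h3 := congrArg (· % (n : ℤ)) h2
      simp only [Int.mul_add_emod_self_left] at h3
      rw [Int.emod_eq_of_lt (by omega) (by exact_mod_cast i.2),
        Int.emod_eq_of_lt (by omega) (by exact_mod_cast j.2)] at h3
      exact Fin.ext (by exact_mod_cast h3)
    · rw [Finset.sum_filter]
      refine Eq.trans ?_ hg
      refine Finset.sum_congr rfl fun i _ => ?_
      split_ifs with h
      · rfl
      · rw [not_not.1 h, zero_smul]
  have := hli.fintype_card_le_finrank
  rwa [Fintype.card_fin] at this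

/-- The pullback of a trace integral divisor, with the ramification at infinity added. -/
theorem TraceIntegral.pullback {B : FFPlace k D →₀ ℤ} (hB : TraceIntegral B)
    (hP : ∀ A : FFPlace k C, A.restrict (RatFunc k) = FFPlace.infty k ↔ A = P)
    (hD : ∀ A : FFPlace k D, A.restrict (RatFunc k) = FFPlace.infty k →
      A.ramIdx (RatFunc k) = 1) :
    TraceIntegral (pullDiv X B +
      ((Module.finrank (RatFunc k) C : ℤ) - 1) • pullPoint X P) := by
  intro p z hz
  have hPi : P.restrict (RatFunc k) = FFPlace.infty k := (hP P).2 rfl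
  by_cases hp : p = FFPlace.infty k
  · subst hp
    have hPn : P.ramIdx (RatFunc k) = Module.finrank (RatFunc k) C := FFPlace.ramIdx_eq_finrank hP
    set n := Module.finrank (RatFunc k) C with hn
    set w := Algebra.trace C X z with hw
    have hπ0 : unifAt P.1 ^ ((n : ℤ) - 1) ≠ 0 := zpow_ne_zero _ P.unifAt_spec.1
    have hπo : P.ord (unifAt P.1 ^ ((n : ℤ) - 1)) = n - 1 := by
      rw [P.ord_zpow _ _ P.unifAt_spec.1, P.ord_unifAt, mul_one]
    have h1 : w ∈ P.ordGE (0 - ((n : ℤ) - 1)) := by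
      rw [← hπo, ← P.mul_mem_ordGE_iff hπ0, hw, ← trace_mul_algebraMap, P.mem_ordGE_zero]
      refine FFPlace.trace_mem_of_forall_over P fun A hA => ?_
      have hAi : A.restrict (RatFunc k) = FFPlace.infty k := by
        rw [← FFPlace.restrict_restrict (D := C), hA, hPi]
      have hAD : (A.restrict D).restrict (RatFunc k) = FFPlace.infty k :=
        A.restrict_restrict.trans hAi
      rw [← A.mem_ordGE_zero, A.mul_mem_ordGE_iff ((map_ne_zero _).2 hπ0), FFPlace.ord_algebraMap,
        hA, hπo]
      refine A.ordGE_anti ?_ (hz A hAi)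
      rw [Finsupp.add_apply, Finsupp.smul_apply, pullDiv_apply, pullPoint_apply, if_pos hA,
        smul_eq_mul]
      have h2 := mul_nonpos_of_nonneg_of_nonpos (Int.natCast_nonneg (A.ramIdx D))
        (hB.apply_nonpos (hD _ hAD))
      have h3 : ((n : ℤ) - 1) * A.ramIdx C = A.ramIdx C * ((n : ℤ) - 1) := mul_comm _ _
      omega
    have h4 : Algebra.trace (RatFunc k) C (w * algebraMap (RatFunc k) C (scale k (-1))) ∈
        (FFPlace.infty k).ordGE 1 := by
      refine FFPlace.trace_mem_ordGE_one _ fun A hA => ?_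
      obtain rfl := (hP A).1 hA
      rw [A.mul_mem_ordGE_iff ((map_ne_zero _).2 (scale_ne_zero _)), ord_scale hA, hPn]
      convert h1 using 2
      ring
    rw [trace_mul_algebraMap, FFPlace.mul_mem_ordGE_iff _ (scale_ne_zero _), ord_infty_scale, hw,
      Algebra.trace_trace] at h4
    exact h4
  · rw [← Algebra.trace_trace (S := D)]
    refine hB p _ fun Q hQ => ?_
    have hy0 : unifAt Q.1 ^ B Q ≠ 0 := zpow_ne_zero _ Q.unifAt_spec.1
    have hyo : Q.ord (unifAt Q.1 ^ B Q) = B Q := by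
      rw [Q.ord_zpow _ _ Q.unifAt_spec.1, Q.ord_unifAt, mul_one]
    rw [← zero_sub, ← hyo, ← Q.mul_mem_ordGE_iff hy0, ← trace_mul_algebraMap, Q.mem_ordGE_zero]
    refine FFPlace.trace_mem_of_forall_over Q fun A hA => ?_
    have hAp : A.restrict (RatFunc k) = p := by
      rw [← FFPlace.restrict_restrict (D := D), hA, hQ]
    have hAC : A.restrict C ≠ P := fun h => hp <| by
      rw [← hAp, ← FFPlace.restrict_restrict (D := C), h, hPi]
    have h1 := hz A hAp
    rw [Finsupp.add_apply, Finsupp.smul_apply, pullDiv_apply, pullPoint_apply, if_neg hAC,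
      smul_zero, add_zero, hA] at h1
    rw [← A.mem_ordGE_zero, A.mul_mem_ordGE_iff ((map_ne_zero _).2 hy0), FFPlace.ord_algebraMap,
      hA, hyo, zero_sub]
    exact h1

/-- The genus of a compositum of maximal degree. -/
theorem le_ffGenus_compositum
    (hP : ∀ A : FFPlace k C, A.restrict (RatFunc k) = FFPlace.infty k ↔ A = P)
    (hD : ∀ A : FFPlace k D, A.restrict (RatFunc k) = FFPlace.infty k →
      A.ramIdx (RatFunc k) = 1)
    (hX : Module.finrank (RatFunc k) X =
      Module.finrank (RatFunc k) C * Module.finrank (RatFunc k) D) :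
    (Module.finrank (RatFunc k) C : ℤ) * (2 * (ffGenus k D : ℤ) - 2) +
      ((Module.finrank (RatFunc k) C : ℤ) - 1) * Module.finrank (RatFunc k) D ≤
        2 * (ffGenus k X : ℤ) - 2 := by
  obtain ⟨B, hB, hdeg⟩ := exists_traceIntegral k D
  have h1 := (hB.pullback (X := X) hP hD).divDeg_le
  have hXD : Module.finrank D X = Module.finrank (RatFunc k) C := by
    have h2 := Module.finrank_mul_finrank (RatFunc k) D X
    rw [hX, mul_comm] at h2
    exact Nat.eq_of_mul_eq_mul_right Module.finrank_pos h2
  have hXC : Module.finrank C X = Module.finrank (RatFunc k) D := by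
    have h2 := Module.finrank_mul_finrank (RatFunc k) C X
    rw [hX] at h2
    exact Nat.eq_of_mul_eq_mul_left Module.finrank_pos h2
  rw [divDeg_add, divDeg_zsmul, divDeg_pullPoint, divDeg_pullDiv, hXD, hXC] at h1
  simp only [ffDegree, hX] at h1 hdeg
  set n := Module.finrank (RatFunc k) C
  set d := Module.finrank (RatFunc k) D
  push_cast at h1
  have h3 := mul_le_mul_of_nonneg_left hdeg (Int.natCast_nonneg n)
  linarith

end Compositum

section TensorProductField

variable {k C D : Type} [Field k] [Field C] [Field D] [IsAlgClosed k] [CharZero k]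
  [Algebra k C] [Algebra (RatFunc k) C] [IsScalarTower k (RatFunc k) C]
  [FiniteDimensional (RatFunc k) C]
  [Algebra k D] [Algebra (RatFunc k) D] [IsScalarTower k (RatFunc k) D]
  [FiniteDimensional (RatFunc k) D]

variable {P : FFPlace k C}

theorem isField_tensorProduct
    (hP : ∀ A : FFPlace k C, A.restrict (RatFunc k) = FFPlace.infty k ↔ A = P)
    (hD : ∀ A : FFPlace k D, A.restrict (RatFunc k) = FFPlace.infty k →
      A.ramIdx (RatFunc k) = 1) : IsField (C ⊗[RatFunc k] D) := by
  obtain ⟨m, hm⟩ := Ideal.exists_maximal (C ⊗[RatFunc k] D)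
  let X := (C ⊗[RatFunc k] D) ⧸ m
  let _ : Field X := Ideal.Quotient.field m
  have : IsScalarTower k (RatFunc k) X := inferInstance
  have : FiniteDimensional (RatFunc k) X := inferInstance
  have : IsScalarTower k C X := inferInstance
  have : IsScalarTower (RatFunc k) C X := inferInstance
  have : FiniteDimensional C X := FiniteDimensional.right (RatFunc k) C X
  let φ : D →ₐ[RatFunc k] X := (Ideal.Quotient.mkₐ (RatFunc k) m).comp
    Algebra.TensorProduct.includeRight
  let _ : Algebra D X := φ.toRingHom.toAlgebra
  have : IsScalarTower (RatFunc k) D X := IsScalarTower.of_algebraMap_eq fun q =>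
    (φ.commutes q).symm
  have : IsScalarTower k D X := IsScalarTower.of_algebraMap_eq fun c => by
    rw [IsScalarTower.algebraMap_apply k (RatFunc k) X,
      IsScalarTower.algebraMap_apply k (RatFunc k) D,
      IsScalarTower.algebraMap_apply (RatFunc k) D X]
  have : FiniteDimensional D X := FiniteDimensional.right (RatFunc k) D X
  have h1 := finrank_le_of_totallyRamified (X := X) hP hD
  let ψ : (C ⊗[RatFunc k] D) →ₗ[RatFunc k] X := (Ideal.Quotient.mkₐ (RatFunc k) m).toLinearMap
  have hψ : Function.Surjective ψ := Ideal.Quotient.mk_surjective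
  have h2 : Module.finrank (RatFunc k) (C ⊗[RatFunc k] D) = Module.finrank (RatFunc k) X := by
    refine le_antisymm ?_ (LinearMap.finrank_le_finrank_of_surjective hψ)
    rw [Module.finrank_tensorProduct, ← Module.finrank_mul_finrank (RatFunc k) D X, mul_comm]
    exact Nat.mul_le_mul_left _ h1
  have hinj : Function.Injective ψ :=
    (LinearMap.injective_iff_surjective_of_finrank_eq_finrank h2).2 hψ
  exact (RingEquiv.ofBijective (Ideal.Quotient.mk m) ⟨hinj, hψ⟩).toMulEquiv.isField
    (Field.toIsField X)

theorem le_genusRing_tensorProduct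
    (hP : ∀ A : FFPlace k C, A.restrict (RatFunc k) = FFPlace.infty k ↔ A = P)
    (hD : ∀ A : FFPlace k D, A.restrict (RatFunc k) = FFPlace.infty k →
      A.ramIdx (RatFunc k) = 1) :
    (Module.finrank (RatFunc k) C : ℤ) * (2 * (ffGenus k D : ℤ) - 2) +
      ((Module.finrank (RatFunc k) C : ℤ) - 1) * Module.finrank (RatFunc k) D ≤
        2 * (genusRing k (C ⊗[RatFunc k] D) : ℤ) - 2 := by
  have hT := isField_tensorProduct hP hD
  rw [genusRing, dif_pos hT]
  let X := C ⊗[RatFunc k] D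
  let _ : Field X := hT.toField
  let _ : Algebra k X := inferInstanceAs (Algebra k (C ⊗[RatFunc k] D))
  let _ : Algebra (RatFunc k) X := inferInstanceAs (Algebra (RatFunc k) (C ⊗[RatFunc k] D))
  let _ : Algebra C X := inferInstanceAs (Algebra C (C ⊗[RatFunc k] D))
  let φ : D →ₐ[RatFunc k] C ⊗[RatFunc k] D := Algebra.TensorProduct.includeRight
  let _ : Algebra D X := φ.toRingHom.toAlgebra
  have : IsScalarTower k (RatFunc k) X :=
    inferInstanceAs (IsScalarTower k (RatFunc k) (C ⊗[RatFunc k] D))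
  have : FiniteDimensional (RatFunc k) X :=
    inferInstanceAs (FiniteDimensional (RatFunc k) (C ⊗[RatFunc k] D))
  have : IsScalarTower k C X := inferInstanceAs (IsScalarTower k C (C ⊗[RatFunc k] D))
  have : IsScalarTower (RatFunc k) C X :=
    inferInstanceAs (IsScalarTower (RatFunc k) C (C ⊗[RatFunc k] D))
  have : FiniteDimensional C X := FiniteDimensional.right (RatFunc k) C X
  have : IsScalarTower (RatFunc k) D X := IsScalarTower.of_algebraMap_eq fun q =>
    (φ.commutes q).symm
  have : IsScalarTower k D X := IsScalarTower.of_algebraMap_eq fun c => by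
    rw [IsScalarTower.algebraMap_apply k (RatFunc k) X,
      IsScalarTower.algebraMap_apply k (RatFunc k) D,
      IsScalarTower.algebraMap_apply (RatFunc k) D X]
  have : FiniteDimensional D X := FiniteDimensional.right (RatFunc k) D X
  exact le_ffGenus_compositum (X := X) hP hD
    (Module.finrank_tensorProduct (R := RatFunc k) (S := RatFunc k) (M := C) (M' := D))

end TensorProductField

theorem genus_estimate_fiber_product
    (k : Type) [Field k] [IsAlgClosed k] [CharZero k]
    (KC KD : Type) [Field KC] [Field KD]
    [Algebra (RatFunc k) KC] [Algebra (RatFunc k) KD]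
    [Algebra k KC] [IsScalarTower k (RatFunc k) KC]
    [Algebra k KD] [IsScalarTower k (RatFunc k) KD]
    [FiniteDimensional (RatFunc k) KC] [FiniteDimensional (RatFunc k) KD]
    (n d : ℕ) (hn : 2 ≤ n)
    (hdegC : Module.finrank (RatFunc k) KC = n)
    (hdegD : Module.finrank (RatFunc k) KD = d)
    -- (1) no non-trivial intermediate extension of `k(ℙ¹) ⊆ k(C)`
    (h1 : ∀ M : IntermediateField (RatFunc k) KC, M = ⊥ ∨ M = ⊤)
    -- (2) `#f^{-1}(∞) = 1`: exactly one place of `K_C` over `∞`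
    (h2 : ∃! A : FFPlace k KC, algebraMap (RatFunc k) KC RatFunc.X ∉ A.1)
    -- (3) `D̃ → D → ℙ¹` is étale over `∞`: every place of `K_D` over `∞` is unramified
    (h3 : ∀ A : FFPlace k KD, algebraMap (RatFunc k) KD RatFunc.X ∉ A.1 →
      ordAt A.1 (algebraMap (RatFunc k) KD RatFunc.X) = -1) :
    IsField (KC ⊗[RatFunc k] KD) ∧
      2 * (genusRing k (KC ⊗[RatFunc k] KD) : ℤ) - 2 ≥
        (n : ℤ) * (2 * (ffGenus k KD : ℤ) - 2) + ((n : ℤ) - 1) * (d : ℤ) := by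
  obtain ⟨P, hP0, hPu⟩ := h2
  have hP : ∀ A : FFPlace k KC, A.restrict (RatFunc k) = FFPlace.infty k ↔ A = P := fun A => by
    rw [FFPlace.restrict_eq_infty_iff]
    exact ⟨hPu A, fun h => h ▸ hP0⟩
  have hD : ∀ A : FFPlace k KD, A.restrict (RatFunc k) = FFPlace.infty k →
      A.ramIdx (RatFunc k) = 1 := fun A hA =>
    FFPlace.ramIdx_eq_one hA (h3 A (FFPlace.restrict_eq_infty_iff.1 hA))
  subst hdegC hdegD
  exact ⟨isField_tensorProduct hP hD, le_genusRing_tensorProduct hP hD⟩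

end
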